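/- Let 0 < d < n be integers and let E ⊆ ℝ^n be a LARRF set of dimension d with constants ε and C₀, where ε is small enough depending only on n and d. Let q satisfy 1 ≤ q < 2d/(d−2) if d > 2, 1 ≤ q < ∞ if d = 2, and 1 ≤ q ≤ ∞ if d = 1. Then there is a constant C_q, depending only on n, d, C₀ and q, such that ∫_{y ∈ E ∩ B(x,r)} ∫₀^r β_q(y,t)² (dt/t) dH^d(y) ≤ C_q r^d for every x ∈ E and 0 < r ≤ 1. (Corollary 15.35: local geometric lemma for LARRF sets.) -/

import Mathlib

open Metric Set MeasureTheory
open scoped ENNReal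

noncomputable section

set_option synthInstance.maxHeartbeats 1000000
set_option maxHeartbeats 1000000

/-- `ℝⁿ`. -/
abbrev V (n : ℕ) := EuclideanSpace ℝ (Fin n)

/-- `P` is a `d`-dimensional affine plane of `ℝⁿ`. -/
def IsAffinePlane (n d : ℕ) (P : Set (V n)) : Prop :=
  ∃ Q : AffineSubspace ℝ (V n), (Q : Set (V n)) = P ∧
    Module.finrank ℝ Q.direction = d ∧ (Q : Set (V n)).Nonempty

/-- The normalized local Hausdorff distance `d_{x,r}(A,B)`. -/
def nhd {n : ℕ} (x : V n) (r : ℝ) (A B : Set (V n)) : ℝ :=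
  r⁻¹ * max (⨆ y ∈ A ∩ ball x r, infDist y B) (⨆ y ∈ B ∩ ball x r, infDist y A)

/-- `E` is a locally Ahlfors-regular Reifenberg-flat (LARRF) set of dimension `d`
with constants `ε` and `C₀` (Definition 15.1). -/
def IsLARRF (n d : ℕ) (ε C₀ : ℝ) (E : Set (V n)) : Prop :=
  E.Nonempty ∧ IsClosed E ∧
  ∀ x ∈ E, ∀ r : ℝ, 0 < r → r ≤ 1 →
    (∃ P : Set (V n), IsAffinePlane n d P ∧ x ∈ P ∧ nhd x r P E ≤ ε) ∧
    ENNReal.ofReal (C₀⁻¹ * r ^ d) ≤ μH[(d : ℝ)] (E ∩ ball x r) ∧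
    μH[(d : ℝ)] (E ∩ ball x r) ≤ ENNReal.ofReal (C₀ * r ^ d)

/-- The Jones number `β_q(x,r)` for finite `q ≥ 1`, valued in `ℝ≥0∞`:
`inf_P ( r^{-d} ∫_{E ∩ B(x,r)} (dist(y,P)/r)^q dH^d(y) )^{1/q}`, the infimum
being over `d`-planes `P` meeting `B(x,r)`. -/
def betaQ (n d : ℕ) (q : ℝ) (E : Set (V n)) (x : V n) (r : ℝ) : ℝ≥0∞ :=
  ⨅ P ∈ {P : Set (V n) | IsAffinePlane n d P ∧ (P ∩ ball x r).Nonempty},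
    ((∫⁻ y in E ∩ ball x r, ENNReal.ofReal ((infDist y P / r) ^ q) ∂(μH[(d : ℝ)])) /
      ENNReal.ofReal (r ^ d)) ^ (1 / q)

/-- The Jones number `β_∞(x,r)`, valued in `ℝ≥0∞`. -/
def betaTop (n d : ℕ) (E : Set (V n)) (x : V n) (r : ℝ) : ℝ≥0∞ :=
  ⨅ P ∈ {P : Set (V n) | IsAffinePlane n d P ∧ (P ∩ ball x r).Nonempty},
    ENNReal.ofReal (r⁻¹ * ⨆ y ∈ E ∩ ball x r, infDist y P)

/-- `β_q(x,r)` for `q ∈ [1,∞]`. -/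
def betaE (n d : ℕ) (q : ℝ≥0∞) (E : Set (V n)) (x : V n) (r : ℝ) : ℝ≥0∞ :=
  if q = ⊤ then betaTop n d E x r else betaQ n d q.toReal E x r

set_option linter.unusedSectionVars false

/-- The symmetric second difference of `f` at `p` with step `w`. -/
def secDiff {G H : Type*} [AddGroup G] [AddCommGroup H] (f : G → H) (w p : G) : H :=
  (f (p + w) - f p) - (f p - f (p - w))

section SquareFunction

variable {G H : Type*} [NormedAddCommGroup G] [NormedSpace ℝ G] [FiniteDimensional ℝ G]
  [MeasurableSpace G] [BorelSpace G] [NormedAddCommGroup H] [InnerProductSpace ℝ H]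

/-- The local quadratic oscillation of `f` near `p` at the dyadic scale `2⁻ˡ`. -/
def sqOsc (lam : Measure G) (R : ℝ) (l : ℕ) (f : G → H) (p : G) : ℝ≥0∞ :=
  ∫⁻ v in ball (0 : G) R, ∫⁻ w in ball (0 : G) R,
    ‖(2 : ℝ) ^ l • secDiff f ((1 / 2 : ℝ) ^ l • w) (p + (1 / 2 : ℝ) ^ l • v)‖ₑ ^ 2 ∂lam ∂lam

variable (lam : Measure G) [lam.IsAddHaarMeasure]

theorem enorm_secDiff_sq_add (f : G → H) (w p : G) :
    ‖secDiff f w p‖ₑ ^ 2 + ‖f (p + w) - f (p - w)‖ₑ ^ 2 =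
      2 * ‖f (p + w) - f p‖ₑ ^ 2 + 2 * ‖f p - f (p - w)‖ₑ ^ 2 := by
  have h := parallelogram_law_with_norm ℝ (f (p + w) - f p) (f p - f (p - w))
  have h1 : f (p + w) - f p + (f p - f (p - w)) = f (p + w) - f (p - w) := by abel
  rw [h1] at h
  simp only [← ofReal_norm, secDiff]
  rw [← ENNReal.ofReal_pow (norm_nonneg _), ← ENNReal.ofReal_pow (norm_nonneg _),
    ← ENNReal.ofReal_pow (norm_nonneg _), ← ENNReal.ofReal_pow (norm_nonneg _),
    ← ENNReal.ofReal_add (by positivity) (by positivity)]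
  have h2 : (2 : ℝ≥0∞) = ENNReal.ofReal 2 := by simp
  rw [h2, ← ENNReal.ofReal_mul (by norm_num), ← ENNReal.ofReal_mul (by norm_num),
    ← ENNReal.ofReal_add (by positivity) (by positivity)]
  congr 1
  nlinarith

theorem lintegral_secDiff_sq_add {f : G → H} (hf : Continuous f) (w : G) :
    (∫⁻ p, ‖secDiff f w p‖ₑ ^ 2 ∂lam) + ∫⁻ p, ‖f (p + (2 : ℝ) • w) - f p‖ₑ ^ 2 ∂lam =
      4 * ∫⁻ p, ‖f (p + w) - f p‖ₑ ^ 2 ∂lam := by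
  have e1 : ∫⁻ p, ‖f (p + (2 : ℝ) • w) - f p‖ₑ ^ 2 ∂lam =
      ∫⁻ p, ‖f (p + w) - f (p - w)‖ₑ ^ 2 ∂lam := by
    rw [← lintegral_sub_right_eq_self _ w]
    congr 1; ext p; congr 4
    rw [two_smul]; abel
  have e2 : ∫⁻ p, ‖f p - f (p - w)‖ₑ ^ 2 ∂lam = ∫⁻ p, ‖f (p + w) - f p‖ₑ ^ 2 ∂lam := by
    rw [← lintegral_add_right_eq_self _ w]
    simp
  have m1 : Measurable fun p => ‖f (p + w) - f p‖ₑ ^ 2 := by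
    apply Continuous.measurable; fun_prop
  have m2 : Measurable fun p => ‖f p - f (p - w)‖ₑ ^ 2 := by
    apply Continuous.measurable; fun_prop
  have m3 : Measurable fun p => ‖f (p + w) - f (p - w)‖ₑ ^ 2 := by
    apply Continuous.measurable; fun_prop
  rw [e1, ← lintegral_add_right _ m3]
  simp only [enorm_secDiff_sq_add]
  rw [lintegral_add_left (m1.const_mul _), lintegral_const_mul _ m1, lintegral_const_mul _ m2, e2]
  ring

theorem sum_four_pow_mul_secDiff_le {f : G → H} (hf : Continuous f) (w : G) (m K : ℕ)
    (hmK : m ≤ K) :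
    (∑ l ∈ Finset.Ico m K, (4 : ℝ≥0∞) ^ l * ∫⁻ p, ‖secDiff f ((1 / 2 : ℝ) ^ l • w) p‖ₑ ^ 2 ∂lam) ≤
      (4 : ℝ≥0∞) ^ K * ∫⁻ p, ‖f (p + (2 : ℝ) • (1 / 2 : ℝ) ^ K • w) - f p‖ₑ ^ 2 ∂lam := by
  induction K, hmK using Nat.le_induction with
  | base => simp
  | succ K hK ih =>
    rw [Finset.sum_Ico_succ_top hK]
    have h := lintegral_secDiff_sq_add lam hf ((1 / 2 : ℝ) ^ K • w)
    have e : (2 : ℝ) • (1 / 2 : ℝ) ^ (K + 1) • w = (1 / 2 : ℝ) ^ K • w := by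
      rw [smul_smul]; congr 1; rw [pow_succ]; ring
    rw [e, pow_succ, mul_assoc, ← h, mul_add, add_comm]
    gcongr

theorem lintegral_difference_sq_le {f : G → H} {K ρ : ℝ}
    (hf : ∀ x y, ‖f x - f y‖ ≤ K * ‖x - y‖) (hs : ∀ x, ρ < ‖x‖ → f x = 0) (w : G) :
    ∫⁻ p, ‖f (p + w) - f p‖ₑ ^ 2 ∂lam ≤
      2 * ENNReal.ofReal ((K * ‖w‖) ^ 2) * lam (closedBall 0 ρ) := by
  have hb : ∀ p, ‖f (p + w) - f p‖ₑ ^ 2 ≤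
      (closedBall (0 : G) ρ ∪ closedBall (-w) ρ).indicator
        (fun _ => ENNReal.ofReal ((K * ‖w‖) ^ 2)) p := by
    intro p
    by_cases hp : p ∈ closedBall (0 : G) ρ ∪ closedBall (-w) ρ
    · rw [indicator_of_mem hp, ← ofReal_norm, ← ENNReal.ofReal_pow (norm_nonneg _)]
      apply ENNReal.ofReal_le_ofReal
      gcongr
      simpa using hf (p + w) p
    · rw [indicator_of_notMem hp]
      simp only [mem_union, mem_closedBall, not_or, not_le, dist_eq_norm] at hp
      rw [hs p (by simpa using hp.1), hs (p + w) (by simpa using hp.2)]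
      simp
  calc _ ≤ ∫⁻ p, _ ∂lam := lintegral_mono hb
    _ ≤ ENNReal.ofReal ((K * ‖w‖) ^ 2) * lam (closedBall (0 : G) ρ ∪ closedBall (-w) ρ) :=
      lintegral_indicator_const_le _ _
    _ ≤ ENNReal.ofReal ((K * ‖w‖) ^ 2) * (lam (closedBall (0 : G) ρ) + lam (closedBall 0 ρ)) := by
      gcongr
      refine (measure_union_le _ _).trans ?_
      rw [Measure.addHaar_closedBall_center lam (-w)]
    _ = _ := by ring

theorem lintegral_sqOsc {f : G → H} (hf : Continuous f) (R : ℝ) (l : ℕ) :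
    ∫⁻ p, sqOsc lam R l f p ∂lam = lam (ball 0 R) *
      ∫⁻ w in ball (0 : G) R, 4 ^ l * ∫⁻ p, ‖secDiff f ((1 / 2 : ℝ) ^ l • w) p‖ₑ ^ 2 ∂lam ∂lam := by
  have hc : Continuous fun x : G × G × G =>
      ‖(2 : ℝ) ^ l • secDiff f ((1 / 2 : ℝ) ^ l • x.2.2) (x.1 + (1 / 2 : ℝ) ^ l • x.2.1)‖ₑ ^ 2 := by
    unfold secDiff; fun_prop
  unfold sqOsc
  rw [lintegral_lintegral_swap]
  swap
  · apply Measurable.aemeasurable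
    exact Measurable.lintegral_prod_right' (f := fun x : (G × G) × G =>
      ‖(2 : ℝ) ^ l • secDiff f ((1 / 2 : ℝ) ^ l • x.2) (x.1.1 + (1 / 2 : ℝ) ^ l • x.1.2)‖ₑ ^ 2)
      (by apply Continuous.measurable; unfold secDiff; fun_prop)
  have key : ∀ v : G, ∫⁻ p, ∫⁻ w in ball (0 : G) R,
      ‖(2 : ℝ) ^ l • secDiff f ((1 / 2 : ℝ) ^ l • w) (p + (1 / 2 : ℝ) ^ l • v)‖ₑ ^ 2 ∂lam ∂lam =
      ∫⁻ w in ball (0 : G) R,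
        4 ^ l * ∫⁻ p, ‖secDiff f ((1 / 2 : ℝ) ^ l • w) p‖ₑ ^ 2 ∂lam ∂lam := by
    intro v
    rw [lintegral_lintegral_swap]
    swap
    · apply Measurable.aemeasurable
      apply Continuous.measurable; unfold Function.uncurry secDiff; fun_prop
    congr 1; ext w
    rw [lintegral_add_right_eq_self
      (fun p => ‖(2 : ℝ) ^ l • secDiff f ((1 / 2 : ℝ) ^ l • w) p‖ₑ ^ 2) ((1 / 2 : ℝ) ^ l • v)]
    rw [← lintegral_const_mul]
    swap
    · apply Continuous.measurable; unfold secDiff; fun_prop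
    congr 1; ext p
    rw [enorm_smul, mul_pow]
    congr 1
    rw [← ofReal_norm, ← ENNReal.ofReal_pow (norm_nonneg _)]
    have : ‖(2 : ℝ) ^ l‖ ^ 2 = (4 : ℝ) ^ l := by
      rw [norm_pow, ← pow_mul, mul_comm, pow_mul]; norm_num
    rw [this, ENNReal.ofReal_pow (by norm_num)]; norm_num
  simp only [key]
  rw [setLIntegral_const, mul_comm]

theorem sum_lintegral_sqOsc_le {f : G → H} {K ρ R : ℝ} (hK : 0 ≤ K)
    (hf : ∀ x y, ‖f x - f y‖ ≤ K * ‖x - y‖) (hs : ∀ x, ρ < ‖x‖ → f x = 0) (m N : ℕ) :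
    ∑ l ∈ Finset.Ico m N, ∫⁻ p, sqOsc lam R l f p ∂lam ≤
      lam (ball 0 R) ^ 2 * (8 * ENNReal.ofReal ((K * R) ^ 2)) * lam (closedBall 0 ρ) := by
  have hfc : Continuous f := by
    refine (LipschitzWith.of_dist_le_mul (K := K.toNNReal) fun x y => ?_).continuous
    rw [dist_eq_norm, dist_eq_norm, Real.coe_toNNReal _ hK]; exact hf x y
  rcases le_or_gt N m with h | hmN
  · simp [Finset.Ico_eq_empty_of_le h]
  simp only [lintegral_sqOsc lam hfc]
  rw [← Finset.mul_sum, ← lintegral_finsetSum]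
  swap
  · intro l _
    apply Measurable.const_mul
    exact Measurable.lintegral_prod_right' (f := fun x : G × G =>
      ‖secDiff f ((1 / 2 : ℝ) ^ l • x.1) x.2‖ₑ ^ 2)
      (by apply Continuous.measurable; unfold secDiff; fun_prop)
  have hb : ∀ w ∈ ball (0 : G) R, (∑ l ∈ Finset.Ico m N,
      (4 : ℝ≥0∞) ^ l * ∫⁻ p, ‖secDiff f ((1 / 2 : ℝ) ^ l • w) p‖ₑ ^ 2 ∂lam) ≤
      (8 * ENNReal.ofReal ((K * R) ^ 2)) * lam (closedBall 0 ρ) := by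
    intro w hw
    refine (sum_four_pow_mul_secDiff_le lam hfc w m N hmN.le).trans ?_
    refine (mul_le_mul_right (lintegral_difference_sq_le lam hf hs _) _).trans ?_
    rw [← mul_assoc, ← mul_assoc]
    gcongr ?_ * _
    have h4 : (4 : ℝ≥0∞) = ENNReal.ofReal 4 := by norm_num
    have h8 : (8 : ℝ≥0∞) = 2 * ENNReal.ofReal 4 := by norm_num
    rw [h8, h4, mul_comm _ (2 : ℝ≥0∞), mul_assoc, mul_assoc, ← ENNReal.ofReal_pow (by norm_num),
      ← ENNReal.ofReal_mul (by positivity), ← ENNReal.ofReal_mul (by positivity)]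
    gcongr 2 * ?_
    apply ENNReal.ofReal_le_ofReal
    rw [norm_smul, norm_smul, norm_pow]
    have hw' : ‖w‖ ≤ R := by simpa using (mem_ball_zero_iff.1 hw).le
    have : (4 : ℝ) ^ N * (K * (‖(2 : ℝ)‖ * (‖(1 / 2 : ℝ)‖ ^ N * ‖w‖))) ^ 2 =
        4 * (K * ‖w‖) ^ 2 := by
      have e : (4 : ℝ) ^ N * ((1 / 2 : ℝ) ^ N) ^ 2 = 1 := by
        rw [← pow_mul, mul_comm N 2, pow_mul, ← mul_pow]; norm_num
      rw [Real.norm_of_nonneg (by norm_num : (0 : ℝ) ≤ 2),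
        Real.norm_of_nonneg (by norm_num : (0 : ℝ) ≤ 1 / 2)]
      linear_combination (4 * (K * ‖w‖) ^ 2) * e
    rw [this]
    gcongr
  calc _ ≤ lam (ball 0 R) * ∫⁻ w in ball (0 : G) R,
        (8 * ENNReal.ofReal ((K * R) ^ 2)) * lam (closedBall 0 ρ) ∂lam := by
        gcongr 1
        exact setLIntegral_mono measurable_const hb
    _ = _ := by rw [setLIntegral_const]; ring

end SquareFunction

/-- The Cauchy–Schwarz inequality against the constant function. -/
theorem sq_lintegral_le {α : Type*} [MeasurableSpace α] (μ : Measure α) {f : α → ℝ≥0∞}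
    (hf : AEMeasurable f μ) : (∫⁻ a, f a ∂μ) ^ 2 ≤ μ univ * ∫⁻ a, f a ^ 2 ∂μ := by
  have h := ENNReal.lintegral_mul_le_Lp_mul_Lq μ Real.HolderConjugate.two_two hf
    (aemeasurable_const (b := (1 : ℝ≥0∞)))
  simp only [Pi.mul_apply, mul_one, ENNReal.one_rpow, lintegral_const, one_mul] at h
  calc (∫⁻ a, f a ∂μ) ^ 2 ≤ ((∫⁻ a, f a ^ (2 : ℝ) ∂μ) ^ (1 / 2 : ℝ) * μ univ ^ (1 / 2 : ℝ)) ^ 2 := by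
        gcongr
    _ = _ := by
        rw [mul_pow, ← ENNReal.rpow_natCast, ← ENNReal.rpow_natCast, ← ENNReal.rpow_mul,
          ← ENNReal.rpow_mul]
        norm_num [mul_comm]

section Mollifier

variable {G H : Type*} [NormedAddCommGroup G] [NormedSpace ℝ G] [FiniteDimensional ℝ G]
  [MeasurableSpace G] [BorelSpace G] [NormedAddCommGroup H] [InnerProductSpace ℝ H]
  [CompleteSpace H] (lam : Measure G) [lam.IsAddHaarMeasure]

/-- The average of `F` around `p` against a kernel `κ` in two variables. -/
def kerAvg (κ : G × G → ℝ) (F : G → H) (p : G) : H :=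
  ∫ z, κ z • F (p + (z.1 + z.2)) ∂(lam.prod lam)

theorem integrable_kernel_smul {κ : G × G → ℝ} (hκ : Continuous κ) (hs : HasCompactSupport κ)
    {g : G × G → H} (hg : Continuous g) : Integrable (fun z => κ z • g z) (lam.prod lam) :=
  (hκ.smul hg).integrable_of_hasCompactSupport hs.smul_right

theorem kerAvg_eq_add_secDiff {κ : G × G → ℝ} (hκ : Continuous κ) (hs : HasCompactSupport κ)
    (he : ∀ u v, κ (u, -v) = κ (u, v)) {F : G → H} (hF : Continuous F) (p : G) :
    kerAvg lam κ F p = (∫ z, κ z • F (p + z.1) ∂(lam.prod lam)) +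
      (1 / 2 : ℝ) • ∫ z, κ z • secDiff F z.2 (p + z.1) ∂(lam.prod lam) := by
  have hrefl : ∫ z, κ z • F (p + (z.1 - z.2)) ∂(lam.prod lam) = kerAvg lam κ F p := by
    have mp : MeasurePreserving (Prod.map (id : G → G) (Neg.neg : G → G))
        (lam.prod lam) (lam.prod lam) :=
      (MeasurePreserving.id lam).prod (Measure.measurePreserving_neg lam)
    have h := mp.integral_comp'
      (f := (MeasurableEquiv.refl G).prodCongr (MeasurableEquiv.neg G))
      (g := fun z => κ z • F (p + (z.1 + z.2)))
    rw [kerAvg, ← h]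
    congr 1; ext z
    have e : ((MeasurableEquiv.refl G).prodCongr (MeasurableEquiv.neg G)) z = (z.1, -z.2) := rfl
    rw [e, he, sub_eq_add_neg]
  have i1 := integrable_kernel_smul lam hκ hs (g := fun z => F (p + (z.1 + z.2))) (by fun_prop)
  have i2 := integrable_kernel_smul lam hκ hs (g := fun z => F (p + (z.1 - z.2))) (by fun_prop)
  have i3 := integrable_kernel_smul lam hκ hs (g := fun z => F (p + z.1)) (by fun_prop)
  have e : ∫ z, κ z • secDiff F z.2 (p + z.1) ∂(lam.prod lam) =
      kerAvg lam κ F p - (2 : ℝ) • (∫ z, κ z • F (p + z.1) ∂(lam.prod lam)) +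
        kerAvg lam κ F p := by
    have e2 : ∫ z, κ z • secDiff F z.2 (p + z.1) ∂(lam.prod lam) =
        ∫ z, (κ z • F (p + (z.1 + z.2)) - (2 : ℝ) • (κ z • F (p + z.1))) +
          κ z • F (p + (z.1 - z.2)) ∂(lam.prod lam) := by
      congr 1; ext z
      simp only [secDiff, smul_sub, two_smul, add_assoc, add_sub_assoc]
      abel
    have i4 : Integrable (fun z => (2 : ℝ) • (κ z • F (p + z.1))) (lam.prod lam) := i3.smul _
    have i5 : Integrable (fun z => κ z • F (p + (z.1 + z.2)) - (2 : ℝ) • (κ z • F (p + z.1)))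
      (lam.prod lam) := i1.sub i4
    rw [e2, integral_add i5 i2, hrefl, integral_sub i1 i4, integral_smul, kerAvg]
  rw [e]
  module

/-- The mean of the second differences of `F` near `p` at unit scale. -/
def meanOsc (F : G → H) (p : G) : ℝ≥0∞ :=
  ∫⁻ z in ball (0 : G) 2 ×ˢ ball (0 : G) 2, ‖secDiff F z.2 (p + z.1)‖ₑ ∂(lam.prod lam)

theorem enorm_integral_secDiff_le {κ : G × G → ℝ} {M : ℝ} (hM : ∀ z, |κ z| ≤ M) {r s : ℝ}
    (hs : ∀ z, κ z ≠ 0 → z ∈ ball (0 : G) r ×ˢ ball (0 : G) s) (F : G → H) (p : G) :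
    ‖∫ z, κ z • secDiff F z.2 (p + z.1) ∂(lam.prod lam)‖ₑ ≤
      ENNReal.ofReal M * ∫⁻ z in ball (0 : G) r ×ˢ ball (0 : G) s,
        ‖secDiff F z.2 (p + z.1)‖ₑ ∂(lam.prod lam) := by
  refine (enorm_integral_le_lintegral_enorm _).trans ?_
  rw [← lintegral_const_mul' _ _ ENNReal.ofReal_ne_top, ← lintegral_indicator
    (measurableSet_ball.prod measurableSet_ball)]
  refine lintegral_mono fun z => ?_
  by_cases hz : κ z = 0
  · simp [hz]
  · rw [indicator_of_mem (hs z hz), enorm_smul]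
    gcongr
    rw [← ofReal_norm]
    exact ENNReal.ofReal_le_ofReal (hM z)

theorem sq_meanOsc_le {F : G → H} (hF : Continuous F) (p : G) :
    meanOsc lam F p ^ 2 ≤ lam (ball 0 2) ^ 2 * ∫⁻ v in ball (0 : G) 2, ∫⁻ w in ball (0 : G) 2,
      ‖secDiff F w (p + v)‖ₑ ^ 2 ∂lam ∂lam := by
  have hc : Continuous fun z : G × G => ‖secDiff F z.2 (p + z.1)‖ₑ := by
    unfold secDiff; fun_prop
  refine (sq_lintegral_le _ hc.measurable.aemeasurable).trans ?_
  rw [← Measure.prod_restrict, lintegral_prod _ (hc.measurable.pow_const 2).aemeasurable, Measure.prod_restrict,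
    Measure.restrict_apply_univ, Measure.prod_prod, ← pow_two]

theorem meanOsc_translate {F : G → H} {p h : G} (hh : ‖h‖ ≤ 1) :
    ∫⁻ z in ball (0 : G) 1 ×ˢ ball (0 : G) 2, ‖secDiff F z.2 (p + h + z.1)‖ₑ ∂(lam.prod lam) ≤
      meanOsc lam F p := by
  have mp : MeasurePreserving (Prod.map (fun x : G => h + x) (id : G → G))
      (lam.prod lam) (lam.prod lam) :=
    (measurePreserving_add_left lam h).prod (MeasurePreserving.id lam)
  have me : MeasurableEmbedding (Prod.map (fun x : G => h + x) (id : G → G)) :=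
    ((MeasurableEquiv.addLeft h).prodCongr (MeasurableEquiv.refl G)).measurableEmbedding
  have e := mp.setLIntegral_comp_emb me (fun z => ‖secDiff F z.2 (p + z.1)‖ₑ)
    (ball (0 : G) 1 ×ˢ ball (0 : G) 2)
  simp only [Prod.map_fst, Prod.map_snd, id_eq, ← add_assoc] at e
  rw [e]
  refine lintegral_mono_set ?_
  rintro _ ⟨z, ⟨hz1, hz2⟩, rfl⟩
  refine ⟨?_, hz2⟩
  simp only [mem_ball_zero_iff, Prod.map_fst] at *
  linarith [norm_add_le h z.1]

end Mollifier

section Bump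

variable {G H : Type*} [NormedAddCommGroup G] [NormedSpace ℝ G] [FiniteDimensional ℝ G]
  [MeasurableSpace G] [BorelSpace G] [NormedAddCommGroup H] [InnerProductSpace ℝ H]
  [CompleteSpace H] (lam : Measure G) [lam.IsAddHaarMeasure]

theorem exists_secDiff_le_of_contDiff {ψ : G → ℝ} (hψ : ContDiff ℝ 2 ψ)
    (hs : HasCompactSupport ψ) : ∃ C : ℝ, 0 ≤ C ∧ ∀ h u, |secDiff ψ h u| ≤ C * ‖h‖ ^ 2 := by
  have h1 : ContDiff ℝ 1 (fderiv ℝ ψ) := hψ.fderiv_right (by norm_num)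
  obtain ⟨C, hC⟩ := h1.lipschitzWith_of_hasCompactSupport (hs.fderiv ℝ) (by simp)
  refine ⟨C, C.2, fun h u => ?_⟩
  have hd : Differentiable ℝ ψ := hψ.differentiable (by norm_num)
  have hd2 : ∀ x : G, HasFDerivAt (fun x => ψ (x + h) - ψ x)
      (fderiv ℝ ψ (x + h) - fderiv ℝ ψ x) x := fun x =>
    ((hasFDerivAt_comp_add_right h).2 (hd (x + h)).hasFDerivAt).sub (hd x).hasFDerivAt
  have := convex_univ.norm_image_sub_le_of_norm_hasFDerivWithin_le (𝕜 := ℝ)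
    (f := fun x => ψ (x + h) - ψ x) (C := C * ‖h‖)
    (fun x _ => (hd2 x).hasFDerivWithinAt) (fun x _ => by
      have := hC.dist_le_mul (x + h) x
      simpa [dist_eq_norm] using this) (mem_univ (u - h)) (mem_univ u)
  have e : u - (u - h) = h := by abel
  rw [e, mul_assoc, ← pow_two, Real.norm_eq_abs] at this
  simpa [secDiff] using this

theorem kerAvg_translate (κ : G × G → ℝ) (F : G → H) (p h : G) :
    kerAvg lam κ F (p + h) = kerAvg lam (fun z => κ (z.1, z.2 - h)) F p := by
  have e := integral_add_right_eq_self (μ := lam.prod lam)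
    (fun z : G × G => κ (z.1, z.2 - h) • F (p + (z.1 + z.2))) ((0, h) : G × G)
  rw [kerAvg, kerAvg, ← e]
  congr 1; ext z
  simp only [Prod.fst_add, Prod.snd_add, add_zero, add_sub_cancel_right]
  congr 2; abel

/-- A smooth even probability density supported in the unit ball. -/
def unitBump : G → ℝ := (⟨1 / 2, 1, by norm_num, by norm_num⟩ : ContDiffBump (0 : G)).normed lam

theorem contDiff_unitBump : ContDiff ℝ 2 (unitBump lam) :=
  ContDiffBump.contDiff_normed (n := 2) _

theorem continuous_unitBump : Continuous (unitBump lam) := (contDiff_unitBump lam).continuous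

theorem hasCompactSupport_unitBump : HasCompactSupport (unitBump lam) :=
  ContDiffBump.hasCompactSupport_normed _

theorem unitBump_nonneg (x : G) : 0 ≤ unitBump lam x := ContDiffBump.nonneg_normed _ _

theorem unitBump_neg (x : G) : unitBump lam (-x) = unitBump lam x := ContDiffBump.normed_neg _ _

theorem integral_unitBump : ∫ x, unitBump lam x ∂lam = 1 := ContDiffBump.integral_normed _

theorem norm_lt_one_of_unitBump_ne_zero {x : G} (hx : unitBump lam x ≠ 0) : ‖x‖ < 1 := by
  have : x ∈ Function.support (unitBump lam) := hx
  rw [unitBump, ContDiffBump.support_normed_eq] at this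
  simpa using this

theorem exists_unitBump_le : ∃ C : ℝ, 0 ≤ C ∧ ∀ x, unitBump lam x ≤ C := by
  obtain ⟨C, hC⟩ := (continuous_unitBump lam).bounded_above_of_compact_support
    (hasCompactSupport_unitBump lam)
  exact ⟨C, (norm_nonneg _).trans (hC 0), fun x => (le_abs_self _).trans (hC x)⟩

/-- The dilate by the factor `1 / 2` of `unitBump`. -/
def halfBump (x : G) : ℝ := 2 ^ Module.finrank ℝ G * unitBump lam ((2 : ℝ) • x)

theorem integral_halfBump : ∫ x, halfBump lam x ∂lam = 1 := by
  unfold halfBump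
  rw [integral_const_mul, Measure.integral_comp_smul, integral_unitBump, abs_of_pos (by positivity),
    smul_eq_mul, mul_one]
  field_simp

/-- The product kernel of two functions. -/
def tensor (a b : G → ℝ) (z : G × G) : ℝ := a z.1 * b z.2

theorem hasCompactSupport_tensor {a b : G → ℝ} (ha : HasCompactSupport a)
    (hb : HasCompactSupport b) : HasCompactSupport (tensor a b) := by
  refine HasCompactSupport.intro (K := tsupport a ×ˢ tsupport b) (ha.isCompact.prod hb.isCompact) ?_
  intro z hz
  rw [mem_prod, not_and_or] at hz
  rcases hz with h | h <;> simp [tensor, image_eq_zero_of_notMem_tsupport h]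

theorem integral_tensor_smul_fst (a b : G → ℝ) (g : G → H) 
    (hi : Integrable (fun z : G × G => tensor a b z • g z.1) (lam.prod lam)) :
    ∫ z, tensor a b z • g z.1 ∂(lam.prod lam) = (∫ v, b v ∂lam) • ∫ u, a u • g u ∂lam := by
  rw [integral_prod _ hi, ← integral_smul]
  congr 1; ext u
  simp only [tensor, mul_comm (a u), mul_smul]
  rw [integral_smul_const]

theorem kerAvg_tensor_comm (a b : G → ℝ) (F : G → H) (p : G) :
    kerAvg lam (tensor a b) F p = kerAvg lam (tensor b a) F p := by
  rw [kerAvg, ← integral_prod_swap, kerAvg]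
  congr 1; ext z
  simp [tensor, mul_comm, add_comm]

open scoped Convolution in
theorem contDiff_average {F : G → H} (hF : Continuous F) :
    ContDiff ℝ 2 fun p => ∫ u, unitBump lam u • F (p + u) ∂lam := by
  have h : ContDiff ℝ 2 (unitBump lam ⋆[ContinuousLinearMap.lsmul ℝ ℝ, lam] F) :=
    (hasCompactSupport_unitBump lam).contDiff_convolution_left (n := 2)
      (ContinuousLinearMap.lsmul ℝ ℝ) (contDiff_unitBump lam) (hF.locallyIntegrable (μ := lam))
  convert h using 1
  funext p
  rw [convolution, ← integral_neg_eq_self]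
  congr 1; ext u
  simp [unitBump_neg, sub_eq_add_neg]

theorem contDiff_kerAvg {F : G → H} (hF : Continuous F) :
    ContDiff ℝ 2 (kerAvg lam (tensor (unitBump lam) (unitBump lam)) F) := by
  convert contDiff_average lam (contDiff_average lam hF).continuous using 1
  ext p
  have hc := continuous_unitBump lam
  rw [kerAvg, integral_prod _ (integrable_kernel_smul lam (by unfold tensor; fun_prop)
    (hasCompactSupport_tensor (hasCompactSupport_unitBump lam) (hasCompactSupport_unitBump lam))
    (g := fun z => F (p + (z.1 + z.2))) (by fun_prop))]
  congr 1; ext u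
  rw [← integral_smul]
  congr 1; ext v
  simp [tensor, mul_smul, add_assoc]

theorem exists_secDiff_kerAvg_le : ∃ C : ℝ, 0 ≤ C ∧ ∀ F : G → H, Continuous F → ∀ p k h : G,
    ‖k‖ ≤ 1 → ‖h‖ ≤ 1 →
    ‖secDiff (kerAvg lam (tensor (unitBump lam) (unitBump lam)) F) h (p + k)‖ₑ ≤
      ENNReal.ofReal (C * ‖h‖ ^ 2) * meanOsc lam F p := by
  obtain ⟨C1, hC1, h1⟩ := exists_secDiff_le_of_contDiff (contDiff_unitBump lam)
    (hasCompactSupport_unitBump lam)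
  obtain ⟨C2, hC2, h2⟩ := exists_unitBump_le lam
  refine ⟨C2 * C1, by positivity, fun F hF p k h hk hh => ?_⟩
  have hψ := continuous_unitBump lam
  set ψ := unitBump lam with hψd
  have hcs : Continuous (secDiff ψ h) := by unfold secDiff; fun_prop
  have hsupp : ∀ x, secDiff ψ h x ≠ 0 → ‖x‖ < 2 := by
    intro x hx
    by_contra hx2
    push Not at hx2
    have hz : ∀ y, ‖y - x‖ ≤ 1 → ψ y = 0 := by
      intro y hy
      by_contra hne
      have := norm_lt_one_of_unitBump_ne_zero lam hne
      have := norm_sub_norm_le x y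
      rw [norm_sub_rev] at this
      linarith
    apply hx
    simp only [secDiff]
    rw [hz (x + h) (by simpa using hh), hz x (by simp), hz (x - h) (by simpa using hh)]
    simp
  have hss : HasCompactSupport (secDiff ψ h) := by
    refine HasCompactSupport.intro (isCompact_closedBall (0 : G) 2) fun x hx => ?_
    by_contra hne
    exact hx (by simpa using (hsupp x hne).le)
  have hT : HasCompactSupport (tensor ψ (secDiff ψ h)) :=
    hasCompactSupport_tensor (hasCompactSupport_unitBump lam) hss
  have hTc : Continuous (tensor ψ (secDiff ψ h)) := by unfold tensor; fun_prop
  have h_int : ∀ a, Integrable (fun v => ψ (v + a)) lam := fun a =>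
    (hψ.integrable_of_hasCompactSupport (hasCompactSupport_unitBump lam)).comp_add_right a
  have hzero : ∫ v, secDiff ψ h v ∂lam = 0 := by
    have e0 := integral_add_right_eq_self (μ := lam) ψ h
    have e1 := integral_add_right_eq_self (μ := lam) ψ (-h)
    have i0 : Integrable (fun v => ψ v) lam := by simpa using h_int 0
    have i1 : Integrable (fun v => ψ (v - h)) lam := by simpa [sub_eq_add_neg] using h_int (-h)
    unfold secDiff
    have j1 : Integrable (fun v => ψ (v + h) - ψ v) lam := (h_int h).sub i0
    have j2 : Integrable (fun v => ψ v - ψ (v - h)) lam := i0.sub i1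
    rw [integral_sub j1 j2, integral_sub (h_int h) i0, integral_sub i0 i1, e0]
    simp only [← sub_eq_add_neg] at e1
    rw [e1]; simp
  have heq : secDiff (kerAvg lam (tensor ψ ψ) F) h (p + k) =
      kerAvg lam (tensor ψ (secDiff ψ h)) F (p + k) := by
    have hcT : HasCompactSupport (tensor ψ ψ) := hasCompactSupport_tensor
      (hasCompactSupport_unitBump lam) (hasCompactSupport_unitBump lam)
    have hi : ∀ a : G, Integrable
        (fun z : G × G => tensor ψ ψ (z.1, z.2 - a) • F (p + k + (z.1 + z.2))) (lam.prod lam) := by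
      intro a
      refine integrable_kernel_smul lam (κ := fun z => tensor ψ ψ (z.1, z.2 - a))
        (by unfold tensor; fun_prop) ?_ (g := fun z => F (p + k + (z.1 + z.2))) (by fun_prop)
      have := hcT.comp_homeomorph (Homeomorph.addRight ((0, -a) : G × G))
      convert this using 1
      ext z
      simp [tensor, sub_eq_add_neg]
    have hi0 := hi 0
    simp only [sub_zero] at hi0
    have e3 := kerAvg_translate lam (tensor ψ ψ) F (p + k) (-h)
    rw [← sub_eq_add_neg] at e3
    rw [secDiff, kerAvg_translate lam _ _ (p + k) h, e3]
    simp only [kerAvg]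
    have hih := hi (-h)
    rw [← integral_sub (hi h) hi0, ← integral_sub hi0 hih]
    refine (integral_sub ((hi h).sub hi0) (hi0.sub hih)).symm.trans ?_
    congr 1; ext z
    simp only [tensor, secDiff, ← sub_smul, Pi.sub_apply, sub_neg_eq_add]
    congr 1; ring
  have hev : ∀ u v, tensor ψ (secDiff ψ h) (u, -v) = tensor ψ (secDiff ψ h) (u, v) := by
    intro u v
    simp only [tensor, secDiff]
    have a1 : ψ (-v + h) = ψ (v - h) := by rw [hψd, ← unitBump_neg]; congr 1; abel
    have a2 : ψ (-v - h) = ψ (v + h) := by rw [hψd, ← unitBump_neg]; congr 1; abel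
    rw [a1, a2, hψd, unitBump_neg]; ring
  rw [heq, kerAvg_eq_add_secDiff lam hTc hT hev hF,
    integral_tensor_smul_fst lam ψ (secDiff ψ h) (fun u => F (p + k + u))
      (integrable_kernel_smul lam hTc hT (g := fun z => F (p + k + z.1)) (by fun_prop)),
    hzero, zero_smul, zero_add]
  have hb := enorm_integral_secDiff_le lam (κ := tensor ψ (secDiff ψ h)) (M := C2 * (C1 * ‖h‖ ^ 2))
    (fun z => by
      rw [tensor, abs_mul, abs_of_nonneg (unitBump_nonneg lam _)]
      gcongr
      · exact h2 _
      · exact h1 _ _) (r := 1) (s := 2) (fun z hz => by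
        have h3 : ψ z.1 ≠ 0 := fun h0 => hz (by simp [tensor, h0])
        have h4 : secDiff ψ h z.2 ≠ 0 := fun h0 => hz (by simp [tensor, h0])
        exact ⟨by simpa using norm_lt_one_of_unitBump_ne_zero lam h3, by simpa using hsupp _ h4⟩)
        F (p + k)
  calc _ ≤ ‖∫ z, tensor ψ (secDiff ψ h) z • secDiff F z.2 (p + k + z.1) ∂(lam.prod lam)‖ₑ := by
        rw [enorm_smul]
        refine mul_le_of_le_one_left zero_le ?_
        rw [← ofReal_norm]; norm_num
    _ ≤ _ := hb
    _ ≤ _ := by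
        rw [mul_assoc]
        gcongr
        exact meanOsc_translate lam hk

end Bump

section Smoothing

variable {G H : Type*} [NormedAddCommGroup G] [NormedSpace ℝ G] [FiniteDimensional ℝ G]
  [MeasurableSpace G] [BorelSpace G] [NormedAddCommGroup H] [InnerProductSpace ℝ H]
  [CompleteSpace H] (lam : Measure G) [lam.IsAddHaarMeasure]

theorem norm_sub_fderiv_le_of_secDiff_le {g : G → H} {p h : G} (hg : DifferentiableAt ℝ g p)
    {M : ℝ} (hM : 0 ≤ M)
    (hs : ∀ t : ℝ, 0 < t → t ≤ 1 / 2 → ‖secDiff g (t • h) (p + t • h)‖ ≤ M * t ^ 2) :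
    ‖g (p + h) - g p - fderiv ℝ g p h‖ ≤ 2 * M := by
  have key : ∀ N : ℕ, ‖(g (p + h) - g p) - (2 : ℝ) ^ N • (g (p + (1 / 2 : ℝ) ^ N • h) - g p)‖ ≤
      2 * M - 2 * M * (1 / 2) ^ N := by
    intro N
    induction N with
    | zero => simp
    | succ N ih =>
      have h1 := hs ((1 / 2) ^ (N + 1)) (by positivity) (by
        rw [pow_succ]
        have := pow_le_one₀ (n := N) (by norm_num : (0 : ℝ) ≤ 1 / 2) (by norm_num)
        linarith)
      have e : (g (p + h) - g p) - (2 : ℝ) ^ (N + 1) • (g (p + (1 / 2 : ℝ) ^ (N + 1) • h) - g p) =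
          ((g (p + h) - g p) - (2 : ℝ) ^ N • (g (p + (1 / 2 : ℝ) ^ N • h) - g p)) +
          (2 : ℝ) ^ N • secDiff g ((1 / 2 : ℝ) ^ (N + 1) • h) (p + (1 / 2 : ℝ) ^ (N + 1) • h) := by
        have e1 : p + (1 / 2 : ℝ) ^ (N + 1) • h + (1 / 2 : ℝ) ^ (N + 1) • h =
            p + (1 / 2 : ℝ) ^ N • h := by
          rw [add_assoc, ← add_smul, pow_succ]; congr 2; ring
        rw [secDiff, e1, add_sub_cancel_right, pow_succ]
        module
      rw [e]
      refine (norm_add_le _ _).trans ?_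
      rw [norm_smul, Real.norm_of_nonneg (by positivity)]
      have h2 : (2 : ℝ) ^ N * (M * ((1 / 2 : ℝ) ^ (N + 1)) ^ 2) ≤ M * (1 / 2) ^ N := by
        have e3 : (2 : ℝ) ^ N * (1 / 2 : ℝ) ^ N = 1 := by rw [← mul_pow]; norm_num
        have e4 : (2 : ℝ) ^ N * (M * ((1 / 2 : ℝ) ^ (N + 1)) ^ 2) = M * (1 / 2) ^ N / 4 := by
          rw [pow_succ]; linear_combination (M * (1 / 2) ^ N / 4) * e3
        rw [e4]
        have : 0 ≤ M * (1 / 2 : ℝ) ^ N := by positivity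
        linarith
      have h3 := mul_le_mul_of_nonneg_left h1 (by positivity : (0 : ℝ) ≤ 2 ^ N)
      rw [pow_succ (1 / 2 : ℝ) N] at *
      linarith
  have hlim : Filter.Tendsto (fun N : ℕ => (2 : ℝ) ^ N • (g (p + (1 / 2 : ℝ) ^ N • h) - g p))
      Filter.atTop (nhds (fderiv ℝ g p h)) := by
    have := (hg.hasFDerivAt.lim_real h).comp
      (tendsto_pow_atTop_atTop_of_one_lt (by norm_num : (1 : ℝ) < 2))
    refine this.congr fun N => ?_
    simp
  refine le_of_tendsto ((tendsto_const_nhds.sub hlim).norm) (Filter.Eventually.of_forall fun N => ?_)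
  refine (key N).trans ?_
  have : 0 ≤ 2 * M * (1 / 2 : ℝ) ^ N := by positivity
  linarith

theorem exists_affine_approx_kerAvg : ∃ C : ℝ, 0 < C ∧ ∀ F : G → H, Continuous F → ∀ p : G,
    ∃ L : G →L[ℝ] H, ∀ h : G, ‖h‖ ≤ 2 →
    ‖kerAvg lam (tensor (unitBump lam) (unitBump lam)) F (p + h) -
      kerAvg lam (tensor (unitBump lam) (unitBump lam)) F p - L h‖ₑ ≤
      ENNReal.ofReal C * meanOsc lam F p := by
  obtain ⟨C, hC, H0⟩ := exists_secDiff_kerAvg_le (H := H) lam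
  refine ⟨8 * C + 1, by positivity, fun F hF p => ?_⟩
  set g := kerAvg lam (tensor (unitBump lam) (unitBump lam)) F with hg
  refine ⟨fderiv ℝ g p, fun h hh => ?_⟩
  by_cases htop : meanOsc lam F p = ⊤
  · rw [htop, ENNReal.mul_top (by simpa using by positivity)]
    exact le_top
  have hd : DifferentiableAt ℝ g p := ((contDiff_kerAvg lam hF).differentiable (by norm_num)) p
  have := norm_sub_fderiv_le_of_secDiff_le hd (h := h)
    (M := C * 4 * (meanOsc lam F p).toReal) (by positivity) (fun t ht0 ht => by
      have hth : ‖t • h‖ ≤ 1 := by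
        rw [norm_smul, Real.norm_of_nonneg ht0.le]; nlinarith [norm_nonneg h]
      have h1 := H0 F hF p (t • h) (t • h) hth hth
      rw [← ENNReal.ofReal_toReal htop, ← ENNReal.ofReal_mul (by positivity), ← ofReal_norm,
        ENNReal.ofReal_le_ofReal_iff (by positivity)] at h1
      refine h1.trans ?_
      rw [norm_smul, Real.norm_of_nonneg ht0.le]
      have : ‖h‖ ^ 2 ≤ 4 := by nlinarith [norm_nonneg h]
      have h3 : C * (t * ‖h‖) ^ 2 ≤ C * 4 * t ^ 2 := by
        rw [mul_pow]; nlinarith [mul_nonneg hC (sq_nonneg t)]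
      calc _ ≤ C * 4 * t ^ 2 * (meanOsc lam F p).toReal := by gcongr
        _ = _ := by ring)
  rw [← ENNReal.ofReal_toReal htop, ← ENNReal.ofReal_mul (by positivity), ← ofReal_norm]
  apply ENNReal.ofReal_le_ofReal
  refine this.trans ?_
  nlinarith [ENNReal.toReal_nonneg (a := meanOsc lam F p)]

theorem continuous_halfBump : Continuous (halfBump lam) := by
  have := continuous_unitBump lam
  unfold halfBump; fun_prop

theorem hasCompactSupport_halfBump : HasCompactSupport (halfBump lam) := by
  refine HasCompactSupport.intro (isCompact_closedBall (0 : G) 1) fun x hx => ?_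
  have : unitBump lam ((2 : ℝ) • x) = 0 := by
    by_contra h
    have := norm_lt_one_of_unitBump_ne_zero lam h
    rw [norm_smul] at this
    simp only [mem_closedBall_zero_iff, not_le, Real.norm_ofNat] at *
    linarith
  simp [halfBump, this]

theorem norm_lt_one_of_halfBump_ne_zero {x : G} (hx : halfBump lam x ≠ 0) : ‖x‖ < 1 := by
  have := norm_lt_one_of_unitBump_ne_zero lam (x := (2 : ℝ) • x) fun h => hx (by simp [halfBump, h])
  rw [norm_smul, Real.norm_ofNat] at this
  linarith [norm_nonneg x]

theorem exists_kerAvg_tensor_sub_le {a b b' : G → ℝ} (ha : Continuous a) (hb : Continuous b)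
    (hb' : Continuous b') (has : HasCompactSupport a) (hbs : HasCompactSupport b)
    (hbs' : HasCompactSupport b') (hbe : ∀ v, b (-v) = b v) (hbe' : ∀ v, b' (-v) = b' v)
    (hbi : ∫ v, b v ∂lam = 1) (hbi' : ∫ v, b' v ∂lam = 1) (ha1 : ∀ x, a x ≠ 0 → ‖x‖ < 1)
    (hb1 : ∀ x, b x ≠ 0 → ‖x‖ < 1) (hb1' : ∀ x, b' x ≠ 0 → ‖x‖ < 1) :
    ∃ C : ℝ, 0 ≤ C ∧ ∀ F : G → H, Continuous F → ∀ p : G,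
      ‖kerAvg lam (tensor a b) F p - kerAvg lam (tensor a b') F p‖ₑ ≤
        ENNReal.ofReal C * meanOsc lam F p := by
  have main : ∀ {c : G → ℝ}, Continuous c → HasCompactSupport c → (∀ v, c (-v) = c v) →
      ∫ v, c v ∂lam = 1 → (∀ x, c x ≠ 0 → ‖x‖ < 1) → ∃ C : ℝ, 0 ≤ C ∧ ∀ F : G → H,
      Continuous F → ∀ p : G, ‖kerAvg lam (tensor a c) F p - ∫ u, a u • F (p + u) ∂lam‖ₑ ≤
        ENNReal.ofReal C * meanOsc lam F p := by
    intro c hc hcs hce hci hc1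
    have hT : Continuous (tensor a c) := by unfold tensor; fun_prop
    have hTs := hasCompactSupport_tensor has hcs
    obtain ⟨C, hC⟩ := hT.bounded_above_of_compact_support hTs
    refine ⟨C, (norm_nonneg _).trans (hC 0), fun F hF p => ?_⟩
    rw [kerAvg_eq_add_secDiff lam hT hTs (fun u v => by simp [tensor, hce]) hF,
      integral_tensor_smul_fst lam a c (fun u => F (p + u))
        (integrable_kernel_smul lam hT hTs (g := fun z => F (p + z.1)) (by fun_prop)),
      hci, one_smul, add_sub_cancel_left, enorm_smul]
    refine (mul_le_of_le_one_left zero_le ?_).trans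
      ((enorm_integral_secDiff_le lam hC (r := 2) (s := 2) (fun z hz => ?_) F p).trans le_rfl)
    · rw [← ofReal_norm]; norm_num
    · have h3 : a z.1 ≠ 0 := fun h0 => hz (by simp [tensor, h0])
      have h4 : c z.2 ≠ 0 := fun h0 => hz (by simp [tensor, h0])
      refine ⟨?_, ?_⟩ <;> rw [mem_ball_zero_iff]
      · linarith [ha1 _ h3]
      · linarith [hc1 _ h4]
  obtain ⟨C1, hC1, h1⟩ := main hb hbs hbe hbi hb1
  obtain ⟨C2, hC2, h2⟩ := main hb' hbs' hbe' hbi' hb1'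
  refine ⟨C1 + C2, by positivity, fun F hF p => ?_⟩
  rw [← sub_sub_sub_cancel_right _ _ (∫ u, a u • F (p + u) ∂lam), ENNReal.ofReal_add hC1 hC2, add_mul]
  exact (enorm_sub_le).trans (add_le_add (h1 F hF p) (h2 F hF p))

theorem exists_kerAvg_sub_halfBump_le : ∃ C : ℝ, 0 ≤ C ∧ ∀ F : G → H, Continuous F → ∀ p : G,
    ‖kerAvg lam (tensor (unitBump lam) (unitBump lam)) F p -
      kerAvg lam (tensor (halfBump lam) (halfBump lam)) F p‖ₑ ≤
        ENNReal.ofReal C * meanOsc lam F p := by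
  have u1 := continuous_unitBump lam
  have u2 := hasCompactSupport_unitBump lam
  have u3 := unitBump_neg lam
  have u4 := integral_unitBump lam
  have u5 := fun x => norm_lt_one_of_unitBump_ne_zero lam (x := x)
  have v1 := continuous_halfBump lam
  have v2 := hasCompactSupport_halfBump lam
  have v3 : ∀ v, halfBump lam (-v) = halfBump lam v := fun v => by
    rw [halfBump, smul_neg, unitBump_neg, halfBump]
  have v4 := integral_halfBump lam
  have v5 := fun x => norm_lt_one_of_halfBump_ne_zero lam (x := x)
  obtain ⟨C1, hC1, h1⟩ := exists_kerAvg_tensor_sub_le (H := H) lam u1 u1 v1 u2 u2 v2 u3 v3 u4 v4 u5 u5 v5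
  obtain ⟨C2, hC2, h2⟩ := exists_kerAvg_tensor_sub_le (H := H) lam v1 u1 v1 v2 u2 v2 u3 v3 u4 v4 v5 u5 v5
  refine ⟨C1 + C2, by positivity, fun F hF p => ?_⟩
  rw [← sub_add_sub_cancel _ (kerAvg lam (tensor (unitBump lam) (halfBump lam)) F p),
    ENNReal.ofReal_add hC1 hC2, add_mul]
  refine (enorm_add_le _ _).trans (add_le_add (h1 F hF p) ?_)
  rw [kerAvg_tensor_comm]
  exact h2 F hF p

end Smoothing

section DyadicSmoothing

variable {G H : Type*} [NormedAddCommGroup G] [NormedSpace ℝ G] [FiniteDimensional ℝ G]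
  [MeasurableSpace G] [BorelSpace G] [NormedAddCommGroup H] [InnerProductSpace ℝ H]
  [CompleteSpace H] (lam : Measure G) [lam.IsAddHaarMeasure]

/-- The mollification of `f` at scale `2⁻ˡ`. -/
def dyadicSmooth (l : ℕ) (f : G → H) (p : G) : H :=
  ∫ z, tensor (unitBump lam) (unitBump lam) z • f (p + (1 / 2 : ℝ) ^ l • (z.1 + z.2)) ∂(lam.prod lam)

/-- The blow-up of `f` at `p` at scale `2⁻ˡ`. -/
def blowUp (l : ℕ) (f : G → H) (p x : G) : H := (2 : ℝ) ^ l • f (p + (1 / 2 : ℝ) ^ l • x)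

theorem two_pow_mul_half_pow (l : ℕ) : (2 : ℝ) ^ l * (1 / 2) ^ l = 1 := by
  rw [← mul_pow]; norm_num

theorem kerAvg_blowUp (l : ℕ) (f : G → H) (p x : G) :
    kerAvg lam (tensor (unitBump lam) (unitBump lam)) (blowUp l f p) x =
      (2 : ℝ) ^ l • dyadicSmooth lam l f (p + (1 / 2 : ℝ) ^ l • x) := by
  rw [kerAvg, dyadicSmooth, ← integral_smul]
  congr 1; ext z
  rw [blowUp, smul_comm, smul_add _ x, ← add_assoc]

theorem kerAvg_halfBump_blowUp (l : ℕ) (f : G → H) (p : G) :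
    kerAvg lam (tensor (halfBump lam) (halfBump lam)) (blowUp l f p) 0 =
      (2 : ℝ) ^ l • dyadicSmooth lam (l + 1) f p := by
  have e := Measure.integral_comp_smul (lam.prod lam) (fun z : G × G =>
    tensor (unitBump lam) (unitBump lam) z • f (p + (1 / 2 : ℝ) ^ (l + 1) • (z.1 + z.2))) 2
  rw [abs_of_pos (by positivity), Module.finrank_prod] at e
  have e2 : dyadicSmooth lam (l + 1) f p = (2 : ℝ) ^ (Module.finrank ℝ G + Module.finrank ℝ G) •
      ∫ z : G × G, tensor (unitBump lam) (unitBump lam) ((2 : ℝ) • z) •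
        f (p + (1 / 2 : ℝ) ^ (l + 1) • (((2 : ℝ) • z).1 + ((2 : ℝ) • z).2)) ∂(lam.prod lam) := by
    rw [e, smul_smul, mul_inv_cancel₀ (by positivity), one_smul, dyadicSmooth]
  rw [e2, kerAvg, ← integral_smul, ← integral_smul]
  congr 1; ext z
  have e3 : (1 / 2 : ℝ) ^ (l + 1) • (((2 : ℝ) • z).1 + ((2 : ℝ) • z).2) =
      (1 / 2 : ℝ) ^ l • (z.1 + z.2) := by
    rw [Prod.smul_fst, Prod.smul_snd, ← smul_add, smul_smul, pow_succ]; congr 1; ring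
  rw [e3, blowUp, zero_add, smul_smul, smul_smul, smul_smul]
  congr 1
  simp only [tensor, halfBump, Prod.smul_fst, Prod.smul_snd]
  ring

theorem sq_meanOsc_blowUp_le {f : G → H} (hf : Continuous f) (l : ℕ) (p : G) :
    meanOsc lam (blowUp l f p) 0 ^ 2 ≤ lam (ball 0 2) ^ 2 * sqOsc lam 2 l f p := by
  have hc : Continuous (blowUp l f p) := by unfold blowUp; fun_prop
  refine (sq_meanOsc_le lam hc 0).trans_eq ?_
  congr 1
  unfold sqOsc
  have : ∀ v w, secDiff (blowUp l f p) w (0 + v) =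
      (2 : ℝ) ^ l • secDiff f ((1 / 2 : ℝ) ^ l • w) (p + (1 / 2 : ℝ) ^ l • v) := by
    intro v w
    simp only [secDiff, blowUp, zero_add, smul_sub, smul_add, add_assoc, add_sub_assoc]
  simp only [this]

theorem norm_dyadicSmooth_sub_le {f : G → H} {K : ℝ} (hK : 0 ≤ K)
    (hf : ∀ x y, ‖f x - f y‖ ≤ K * ‖x - y‖) (l : ℕ) (p : G) :
    ‖dyadicSmooth lam l f p - f p‖ ≤ 2 * K * (1 / 2) ^ l := by
  have hfc : Continuous f := by
    refine (LipschitzWith.of_dist_le_mul (K := K.toNNReal) fun x y => ?_).continuous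
    rw [dist_eq_norm, dist_eq_norm, Real.coe_toNNReal _ hK]; exact hf x y
  have u1 := continuous_unitBump lam
  have hT : Continuous (tensor (unitBump lam) (unitBump lam)) := by unfold tensor; fun_prop
  have hTs := hasCompactSupport_tensor (hasCompactSupport_unitBump lam)
    (hasCompactSupport_unitBump lam)
  have hTi : ∫ z, tensor (unitBump lam) (unitBump lam) z ∂(lam.prod lam) = 1 := by
    unfold tensor
    rw [integral_prod_mul, integral_unitBump, one_mul]
  have e : f p = ∫ z, tensor (unitBump lam) (unitBump lam) z • f p ∂(lam.prod lam) := by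
    rw [integral_smul_const, hTi, one_smul]
  have hTint : Integrable (tensor (unitBump lam) (unitBump lam)) (lam.prod lam) :=
    hT.integrable_of_hasCompactSupport hTs
  rw [dyadicSmooth]
  rw [e]
  rw [← integral_sub (integrable_kernel_smul lam hT hTs
    (g := fun z => f (p + (1 / 2 : ℝ) ^ l • (z.1 + z.2))) (by fun_prop)) (hTint.smul_const _)]
  have hb : ∀ z, ‖tensor (unitBump lam) (unitBump lam) z • f (p + (1 / 2 : ℝ) ^ l • (z.1 + z.2)) -
      tensor (unitBump lam) (unitBump lam) z • f p‖ ≤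
      tensor (unitBump lam) (unitBump lam) z * (2 * K * (1 / 2) ^ l) := by
    intro z
    have hT0 : 0 ≤ tensor (unitBump lam) (unitBump lam) z :=
      mul_nonneg (unitBump_nonneg lam _) (unitBump_nonneg lam _)
    rw [← smul_sub, norm_smul, Real.norm_of_nonneg hT0]
    by_cases hz : tensor (unitBump lam) (unitBump lam) z = 0
    · simp [hz]
    have h3 : unitBump lam z.1 ≠ 0 := fun h0 => hz (by simp [tensor, h0])
    have h4 : unitBump lam z.2 ≠ 0 := fun h0 => hz (by simp [tensor, h0])
    have h5 := norm_lt_one_of_unitBump_ne_zero lam h3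
    have h6 := norm_lt_one_of_unitBump_ne_zero lam h4
    gcongr
    refine (hf _ _).trans ?_
    rw [add_sub_cancel_left, norm_smul, norm_pow, Real.norm_of_nonneg (by norm_num : (0 : ℝ) ≤ 1 / 2)]
    have : ‖z.1 + z.2‖ ≤ 2 := (norm_add_le _ _).trans (by linarith)
    calc _ ≤ K * ((1 / 2) ^ l * 2) := by gcongr
      _ = _ := by ring
  refine (norm_integral_le_of_norm_le (hTint.mul_const _) (Filter.Eventually.of_forall hb)).trans_eq ?_
  rw [integral_mul_const, hTi, one_mul]

/-- A Lipschitz function admits smooth approximations at all dyadic scales which are controlled by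
the local quadratic oscillation. -/
theorem exists_dyadic_approximation : ∃ C : ℝ≥0∞, C ≠ ⊤ ∧ ∀ (f : G → H) (K : ℝ), 0 ≤ K →
    (∀ x y, ‖f x - f y‖ ≤ K * ‖x - y‖) → ∃ g : ℕ → G → H,
      (∀ l p, ∃ L : G →ₗ[ℝ] H, ∀ h, ‖h‖ ≤ 2 * (1 / 2) ^ l →
        ‖(2 : ℝ) ^ l • (g l (p + h) - g l p - L h)‖ₑ ^ 2 ≤ C * sqOsc lam 2 l f p) ∧
      (∀ l p, ‖(2 : ℝ) ^ l • (g l p - g (l + 1) p)‖ₑ ^ 2 ≤ C * sqOsc lam 2 l f p) ∧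
      ∀ l p, ‖g l p - f p‖ ≤ 2 * K * (1 / 2) ^ l := by
  obtain ⟨C1, hC1, h1⟩ := exists_affine_approx_kerAvg (H := H) lam
  obtain ⟨C2, hC2, h2⟩ := exists_kerAvg_sub_halfBump_le (H := H) lam
  refine ⟨ENNReal.ofReal (C1 + C2) ^ 2 * lam (ball 0 2) ^ 2,
    ENNReal.mul_ne_top (by finiteness) (ENNReal.pow_ne_top measure_ball_lt_top.ne),
    fun f K hK hf => ⟨fun l => dyadicSmooth lam l f, ?_, ?_, norm_dyadicSmooth_sub_le lam hK hf⟩⟩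
  all_goals
    have hfc : Continuous f := by
      refine (LipschitzWith.of_dist_le_mul (K := K.toNNReal) fun x y => ?_).continuous
      rw [dist_eq_norm, dist_eq_norm, Real.coe_toNNReal _ hK]; exact hf x y
    intro l p
    have hc : Continuous (blowUp l f p) := by unfold blowUp; fun_prop
    have hsq : ∀ x : ℝ≥0∞, x ≤ ENNReal.ofReal (C1 + C2) * meanOsc lam (blowUp l f p) 0 →
        x ^ 2 ≤ ENNReal.ofReal (C1 + C2) ^ 2 * lam (ball 0 2) ^ 2 * sqOsc lam 2 l f p := by
      intro x hx
      calc x ^ 2 ≤ (ENNReal.ofReal (C1 + C2) * meanOsc lam (blowUp l f p) 0) ^ 2 := by gcongr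
        _ ≤ _ := by
          rw [mul_pow, mul_assoc]
          gcongr
          exact sq_meanOsc_blowUp_le lam hfc l p
  · obtain ⟨L, hL⟩ := h1 (blowUp l f p) hc 0
    refine ⟨L, fun h hh => hsq _ ?_⟩
    have hn : ‖(2 : ℝ) ^ l • h‖ ≤ 2 := by
      rw [norm_smul, norm_pow, Real.norm_ofNat]
      calc _ ≤ (2 : ℝ) ^ l * (2 * (1 / 2) ^ l) := by gcongr
        _ = 2 := by linear_combination 2 * two_pow_mul_half_pow l
    have := hL ((2 : ℝ) ^ l • h) hn
    rw [kerAvg_blowUp, kerAvg_blowUp, smul_zero, zero_add, add_zero, smul_smul, mul_comm,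
      two_pow_mul_half_pow, one_smul, map_smul, ← smul_sub, ← smul_sub] at this
    refine this.trans ?_
    gcongr
    linarith
  · apply hsq
    have := h2 (blowUp l f p) hc 0
    rw [kerAvg_blowUp, kerAvg_halfBump_blowUp, smul_zero, add_zero, ← smul_sub] at this
    refine this.trans ?_
    gcongr
    linarith

end DyadicSmoothing

section SqOscWindow

variable {G : Type*} [NormedAddCommGroup G] [NormedSpace ℝ G] [FiniteDimensional ℝ G]
  [MeasurableSpace G] [BorelSpace G]
variable {H : Type*} [NormedAddCommGroup H] [InnerProductSpace ℝ H] [CompleteSpace H]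
variable (lam : Measure G) [lam.IsAddHaarMeasure]

theorem sqOsc_le_sqOsc_of_near {f : G → H} (R : ℝ) (l : ℕ) {p p' : G}
    (h : ‖p - p'‖ ≤ (1 / 2) ^ l) : sqOsc lam R l f p ≤ sqOsc lam (R + 1) l f p' := by
  set c : G := (2 : ℝ) ^ l • (p - p') with hc
  have hcn : ‖c‖ ≤ 1 := by
    rw [hc, norm_smul, Real.norm_of_nonneg (by positivity)]
    calc (2 : ℝ) ^ l * ‖p - p'‖ ≤ 2 ^ l * (1 / 2) ^ l := by gcongr
      _ = 1 := two_pow_mul_half_pow l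
  let Φ : G → ℝ≥0∞ := fun v => ∫⁻ w in ball 0 (R + 1),
    ‖(2 : ℝ) ^ l • secDiff f ((1 / 2 : ℝ) ^ l • w) (p' + (1 / 2 : ℝ) ^ l • v)‖ₑ ^ 2 ∂lam
  have h1 : sqOsc lam R l f p ≤ ∫⁻ v in ball 0 R, Φ (v + c) ∂lam := by
    unfold sqOsc
    refine lintegral_mono fun v => ?_
    have : p' + (1 / 2 : ℝ) ^ l • (v + c) = p + (1 / 2 : ℝ) ^ l • v := by
      rw [hc, smul_add, smul_smul, mul_comm, two_pow_mul_half_pow, one_smul]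
      abel
    simp only [Φ, this]
    exact lintegral_mono_set (ball_subset_ball (by linarith))
  refine h1.trans ?_
  rw [← lintegral_indicator measurableSet_ball]
  calc ∫⁻ v, (ball 0 R).indicator (fun v => Φ (v + c)) v ∂lam
      ≤ ∫⁻ v, (ball 0 (R + 1)).indicator Φ (v + c) ∂lam := by
        refine lintegral_mono fun v => ?_
        by_cases hv : v ∈ ball (0 : G) R
        · have : v + c ∈ ball (0 : G) (R + 1) := by
            rw [mem_ball_zero_iff] at hv ⊢
            linarith [norm_add_le v c]
          simp [hv, this]
        · simp [hv]
    _ = ∫⁻ v, (ball 0 (R + 1)).indicator Φ v ∂lam := lintegral_add_right_eq_self _ c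
    _ = sqOsc lam (R + 1) l f p' := by
        rw [lintegral_indicator measurableSet_ball]
        rfl

theorem measurable_sqOsc {f : G → H} (hf : Continuous f) (R : ℝ) (l : ℕ) :
    Measurable (sqOsc lam R l f) := by
  have hc : Continuous fun z : (G × G) × G =>
      ‖(2 : ℝ) ^ l • secDiff f ((1 / 2 : ℝ) ^ l • z.2) (z.1.1 + (1 / 2 : ℝ) ^ l • z.1.2)‖ₑ := by
    unfold secDiff
    fun_prop
  have h1 : Measurable fun z : G × G => ∫⁻ w in ball 0 R,
      ‖(2 : ℝ) ^ l • secDiff f ((1 / 2 : ℝ) ^ l • w) (z.1 + (1 / 2 : ℝ) ^ l • z.2)‖ₑ ^ 2 ∂lam :=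
    (hc.measurable.pow_const 2).lintegral_prod_right'
  exact h1.lintegral_prod_right'

end SqOscWindow

theorem ofReal_half_pow (l : ℕ) : ENNReal.ofReal ((1 / 2) ^ l) = 2⁻¹ ^ l := by
  rw [ENNReal.ofReal_pow (by norm_num), one_div, ENNReal.ofReal_inv_of_pos (by norm_num)]
  norm_num

section RegionDefect

variable {G : Type*} [NormedAddCommGroup G] [NormedSpace ℝ G] [FiniteDimensional ℝ G]
  [MeasurableSpace G] [BorelSpace G]
variable {H : Type*} [NormedAddCommGroup H] [InnerProductSpace ℝ H] [CompleteSpace H]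
variable {X : Type*} [MetricSpace X]
variable (lam : Measure G) [lam.IsAddHaarMeasure]

/-- The defect at scale `2⁻ˡ`: the oscillation of `f` where `h ≤ 2⁻ˡ`, plus one where `h` is
comparable to `2⁻ˡ`. -/
def defect (f : G → H) (p : X → G) (h : X → ℝ) (l : ℕ) (u : X) : ℝ≥0∞ :=
  {u | h u ≤ (1 / 2) ^ l}.indicator (fun u => sqOsc lam 2 l f (p u)) u +
    {u | (1 / 2) ^ (l + 1) < h u ∧ h u ≤ 4 * (1 / 2) ^ l}.indicator 1 u

/-- A version of `defect` with slightly larger windows. -/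
def wideDefect (f : G → H) (p : X → G) (h : X → ℝ) (l : ℕ) (u : X) : ℝ≥0∞ :=
  {u | h u ≤ 2 * (1 / 2) ^ l}.indicator (fun u => sqOsc lam 3 l f (p u)) u +
    {u | (1 / 2) ^ (l + 2) < h u ∧ h u < 5 * (1 / 2) ^ l}.indicator 1 u

theorem defect_le_wideDefect {f : G → H} {p : X → G} {h : X → ℝ}
    (hp : ∀ u v, ‖p u - p v‖ ≤ dist u v) (hh : ∀ u v, h u ≤ h v + dist u v) (l : ℕ) {u v : X}
    (huv : dist u v ≤ (1 / 2) ^ (l + 2)) : defect lam f p h l u ≤ wideDefect lam f p h l v := by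
  have h0 : (0 : ℝ) < (1 / 2) ^ l := by positivity
  have e1 : (1 / 2 : ℝ) ^ (l + 1) = (1 / 2) ^ l / 2 := by ring
  have e2 : (1 / 2 : ℝ) ^ (l + 2) = (1 / 2) ^ l / 4 := by ring
  rw [e2] at huv
  have hvu := hh v u
  rw [dist_comm] at hvu
  have huv' := hh u v
  unfold defect wideDefect
  rw [e1, e2]
  gcongr
  · by_cases hu : h u ≤ (1 / 2) ^ l
    · have hv : h v ≤ 2 * (1 / 2) ^ l := by linarith
      rw [indicator_of_mem (by exact hu), indicator_of_mem (by exact hv)]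
      have := sqOsc_le_sqOsc_of_near lam (f := f) 2 l ((hp u v).trans (by linarith))
      norm_num at this ⊢
      exact this
    · rw [indicator_of_notMem (by exact hu)]
      exact zero_le
  · by_cases hu : (1 / 2) ^ l / 2 < h u ∧ h u ≤ 4 * (1 / 2) ^ l
    · have hv : (1 / 2) ^ l / 4 < h v ∧ h v < 5 * (1 / 2) ^ l := by
        constructor <;> linarith
      rw [indicator_of_mem (by exact hu), indicator_of_mem (by exact hv)]
      simp
    · rw [indicator_of_notMem (by exact hu)]
      exact zero_le

theorem enorm_le_of_sq_le {x : H} {C S : ℝ≥0∞} (h : ‖x‖ₑ ^ 2 ≤ C * S) :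
    ‖x‖ₑ ≤ C ^ (1 / 2 : ℝ) * S ^ (1 / 2 : ℝ) := by
  rw [← ENNReal.mul_rpow_of_nonneg _ _ (by norm_num)]
  calc ‖x‖ₑ = (‖x‖ₑ ^ 2) ^ (1 / 2 : ℝ) := by
        rw [← ENNReal.rpow_natCast, ← ENNReal.rpow_mul]; norm_num
    _ ≤ _ := by gcongr

/-- Pointwise distance of `y` to the affine approximation at scale `2⁻ᵏ`, in terms of defects. -/
theorem enorm_affine_error_le {C : ℝ≥0∞} {f : G → H} {g : ℕ → G → H} {K : ℝ} (hK : 0 ≤ K)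
    (hg : ∀ l p, ‖(2 : ℝ) ^ l • (g l p - g (l + 1) p)‖ₑ ^ 2 ≤ C * sqOsc lam 2 l f p)
    (hgf : ∀ l p, ‖g l p - f p‖ ≤ 2 * K * (1 / 2) ^ l)
    {p : X → G} {y : X → H} {h : X → ℝ}
    (hp : ∀ u v, ‖p u - p v‖ ≤ dist u v) (hh : ∀ u v, h u ≤ h v + dist u v)
    {z u : X} {k N : ℕ} {L : G →ₗ[ℝ] H}
    (hL : ∀ w, ‖w‖ ≤ 2 * (1 / 2) ^ k →
      ‖(2 : ℝ) ^ k • (g k (p z + w) - g k (p z) - L w)‖ₑ ^ 2 ≤ C * sqOsc lam 2 k f (p z))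
    (hz : h z ≤ (1 / 2) ^ k) (hzu : dist u z ≤ 2 * (1 / 2) ^ k) (hN : (1 / 2) ^ N ≤ h u)
    (hkN : k ≤ N) (hy : ‖y u - f (p u)‖ ≤ K * h u) :
    ‖(2 : ℝ) ^ k • (y u - g k (p z) - L (p u - p z))‖ₑ ≤
      (C ^ (1 / 2 : ℝ) + ENNReal.ofReal (12 * K)) * (sqOsc lam 2 k f (p z) ^ (1 / 2 : ℝ) +
        ∑ l ∈ Finset.Ico k (N + 1), 2⁻¹ ^ (l - k) * defect lam f p h l u ^ (1 / 2 : ℝ)) := by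
  classical
  have h0 : ∀ l, (0 : ℝ) < (1 / 2) ^ l := fun l => by positivity
  obtain ⟨l0, hl0⟩ : ∃ l0, (k ≤ l0 ∧ (1 / 2) ^ (l0 + 1) < h u) ∧
      ∀ l, k ≤ l → l < l0 → h u ≤ (1 / 2) ^ (l + 1) := by
    have hex : ∃ l, k ≤ l ∧ (1 / 2) ^ (l + 1) < h u :=
      ⟨N, hkN, lt_of_lt_of_le (by rw [pow_succ]; linarith [h0 N]) hN⟩
    refine ⟨Nat.find hex, Nat.find_spec hex, fun l hl hlt => ?_⟩
    have := Nat.find_min hex hlt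
    push Not at this
    exact this hl
  obtain ⟨⟨hk0, hlow⟩, hmin⟩ := hl0
  have hl0N : l0 ≤ N := by
    by_contra hcon
    push Not at hcon
    have := hmin N hkN hcon
    rw [pow_succ] at this
    linarith [h0 N]
  have hup : h u ≤ 4 * (1 / 2) ^ l0 := by
    rcases hk0.eq_or_lt with rfl | hlt
    · have := hh u z
      linarith [h0 k]
    · have := hmin (l0 - 1) (by omega) (by omega)
      rw [Nat.sub_add_cancel (by omega)] at this
      linarith [h0 l0]
  have tele : g k (p u) - g l0 (p u) = ∑ l ∈ Finset.Ico k l0, (g l (p u) - g (l + 1) (p u)) := by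
    rw [← neg_inj, ← Finset.sum_neg_distrib]
    simp only [neg_sub]
    exact (Finset.sum_Ico_sub (fun l => g l (p u)) hk0).symm
  have split : y u - g k (p z) - L (p u - p z) =
      ((y u - f (p u)) - (g l0 (p u) - f (p u))) -
        (∑ l ∈ Finset.Ico k l0, (g l (p u) - g (l + 1) (p u))) +
        (g k (p z + (p u - p z)) - g k (p z) - L (p u - p z)) := by
    rw [← tele, add_sub_cancel]; abel
  have hpow : ∀ l, k ≤ l → (2 : ℝ) ^ k = (1 / 2) ^ (l - k) * 2 ^ l := by
    intro l hl
    obtain ⟨j, rfl⟩ := Nat.exists_eq_add_of_le hl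
    rw [add_tsub_cancel_left, pow_add]
    calc (2 : ℝ) ^ k = 2 ^ k * ((2 : ℝ) ^ j * (1 / 2) ^ j) := by
          rw [two_pow_mul_half_pow, mul_one]
      _ = _ := by ring
  have hhalf : ∀ j : ℕ, ‖((1 / 2 : ℝ) ^ j)‖ₑ = 2⁻¹ ^ j := by
    intro j
    rw [← ofReal_norm, Real.norm_of_nonneg (by positivity), ofReal_half_pow]
  have t1 : ‖(2 : ℝ) ^ k • ((y u - f (p u)) - (g l0 (p u) - f (p u)))‖ₑ ≤
      ENNReal.ofReal (12 * K) * (2⁻¹ ^ (l0 - k) * defect lam f p h l0 u ^ (1 / 2 : ℝ)) := by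
    have hd : 1 ≤ defect lam f p h l0 u := by
      unfold defect
      refine le_trans ?_ le_add_self
      rw [indicator_of_mem (by exact ⟨hlow, hup⟩)]
      simp
    have hd' : 1 ≤ defect lam f p h l0 u ^ (1 / 2 : ℝ) := ENNReal.one_le_rpow hd (by norm_num)
    rw [hpow l0 hk0, mul_smul, enorm_smul, hhalf]
    have : ‖(2 : ℝ) ^ l0 • ((y u - f (p u)) - (g l0 (p u) - f (p u)))‖ₑ ≤
        ENNReal.ofReal (12 * K) := by
      rw [← ofReal_norm]
      apply ENNReal.ofReal_le_ofReal
      rw [norm_smul, Real.norm_of_nonneg (by positivity)]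
      calc (2 : ℝ) ^ l0 * ‖(y u - f (p u)) - (g l0 (p u) - f (p u))‖
          ≤ 2 ^ l0 * (K * (4 * (1 / 2) ^ l0) + 2 * K * (1 / 2) ^ l0) := by
            gcongr
            refine (norm_sub_le _ _).trans (add_le_add (hy.trans ?_) (hgf l0 _))
            gcongr
        _ = 6 * K * (2 ^ l0 * (1 / 2) ^ l0) := by ring
        _ ≤ 12 * K := by rw [two_pow_mul_half_pow]; linarith
    calc _ ≤ 2⁻¹ ^ (l0 - k) * (ENNReal.ofReal (12 * K) * 1) := by rw [mul_one]; gcongr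
      _ ≤ 2⁻¹ ^ (l0 - k) * (ENNReal.ofReal (12 * K) * defect lam f p h l0 u ^ (1 / 2 : ℝ)) := by
          gcongr
      _ = _ := by ring
  have t2 : ‖(2 : ℝ) ^ k • ∑ l ∈ Finset.Ico k l0, (g l (p u) - g (l + 1) (p u))‖ₑ ≤
      C ^ (1 / 2 : ℝ) * ∑ l ∈ Finset.Ico k l0,
        2⁻¹ ^ (l - k) * defect lam f p h l u ^ (1 / 2 : ℝ) := by
    rw [Finset.smul_sum, Finset.mul_sum]
    refine (enorm_sum_le _ _).trans (Finset.sum_le_sum fun l hl => ?_)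
    rw [Finset.mem_Ico] at hl
    have hle : h u ≤ (1 / 2) ^ l := by
      refine (hmin l hl.1 hl.2).trans ?_
      rw [pow_succ]; linarith [h0 l]
    have hd : sqOsc lam 2 l f (p u) ≤ defect lam f p h l u := by
      unfold defect
      rw [indicator_of_mem (by exact hle)]
      exact le_self_add
    rw [hpow l hl.1, mul_smul, enorm_smul, hhalf]
    calc _ ≤ 2⁻¹ ^ (l - k) * (C ^ (1 / 2 : ℝ) * sqOsc lam 2 l f (p u) ^ (1 / 2 : ℝ)) := by
          gcongr
          exact enorm_le_of_sq_le (hg l (p u))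
      _ ≤ 2⁻¹ ^ (l - k) * (C ^ (1 / 2 : ℝ) * defect lam f p h l u ^ (1 / 2 : ℝ)) := by
          gcongr
      _ = _ := by ring
  have t3 := enorm_le_of_sq_le (hL (p u - p z) ((hp u z).trans hzu))
  have s1 : ∑ l ∈ Finset.Ico k l0, (2⁻¹ : ℝ≥0∞) ^ (l - k) * defect lam f p h l u ^ (1 / 2 : ℝ) ≤
      ∑ l ∈ Finset.Ico k (N + 1), 2⁻¹ ^ (l - k) * defect lam f p h l u ^ (1 / 2 : ℝ) :=
    Finset.sum_le_sum_of_subset (Finset.Ico_subset_Ico_right (by omega))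
  have s2 : (2⁻¹ : ℝ≥0∞) ^ (l0 - k) * defect lam f p h l0 u ^ (1 / 2 : ℝ) ≤
      ∑ l ∈ Finset.Ico k (N + 1), 2⁻¹ ^ (l - k) * defect lam f p h l u ^ (1 / 2 : ℝ) :=
    Finset.single_le_sum (f := fun l => (2⁻¹ : ℝ≥0∞) ^ (l - k) * defect lam f p h l u ^ (1 / 2 : ℝ))
      (fun _ _ => zero_le) (Finset.mem_Ico.2 ⟨hk0, by omega⟩)
  rw [split, smul_add, smul_sub]
  calc _ ≤ ENNReal.ofReal (12 * K) * (∑ l ∈ Finset.Ico k (N + 1),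
          2⁻¹ ^ (l - k) * defect lam f p h l u ^ (1 / 2 : ℝ)) +
        C ^ (1 / 2 : ℝ) * (∑ l ∈ Finset.Ico k (N + 1),
          2⁻¹ ^ (l - k) * defect lam f p h l u ^ (1 / 2 : ℝ)) +
        C ^ (1 / 2 : ℝ) * sqOsc lam 2 k f (p z) ^ (1 / 2 : ℝ) := by
        refine (enorm_add_le _ _).trans (add_le_add ((enorm_sub_le).trans (add_le_add ?_ ?_)) t3)
        · exact t1.trans (by gcongr)
        · exact t2.trans (by gcongr)
    _ ≤ _ := by
        rw [add_mul, mul_add, mul_add]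
        calc _ = C ^ (1 / 2 : ℝ) * sqOsc lam 2 k f (p z) ^ (1 / 2 : ℝ) + C ^ (1 / 2 : ℝ) * (∑ l ∈ Finset.Ico k (N + 1),
          2⁻¹ ^ (l - k) * defect lam f p h l u ^ (1 / 2 : ℝ)) + ENNReal.ofReal (12 * K) * (∑ l ∈ Finset.Ico k (N + 1),
          2⁻¹ ^ (l - k) * defect lam f p h l u ^ (1 / 2 : ℝ)) := by ring
          _ ≤ _ := by
            gcongr
            exact le_add_self

end RegionDefect

theorem sq_sum_weighted_le {ι : Type*} (s : Finset ι) (w a : ι → ℝ≥0∞) :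
    (∑ i ∈ s, w i * a i) ^ 2 ≤ (∑ i ∈ s, w i) * ∑ i ∈ s, w i * a i ^ 2 := by
  have h := ENNReal.inner_le_Lp_mul_Lq s (fun i => w i ^ (1 / 2 : ℝ))
    (fun i => w i ^ (1 / 2 : ℝ) * a i) (p := 2) (q := 2) Real.HolderConjugate.two_two
  have e : ∀ x : ℝ≥0∞, (x ^ (1 / 2 : ℝ)) ^ (2 : ℝ) = x := fun x => by
    rw [← ENNReal.rpow_mul]; norm_num
  have e' : ∀ x : ℝ≥0∞, (x ^ (1 / 2 : ℝ)) ^ 2 = x := fun x => by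
    rw [← ENNReal.rpow_natCast]; exact_mod_cast e x
  have e2 : ∀ i, w i ^ (1 / 2 : ℝ) * (w i ^ (1 / 2 : ℝ) * a i) = w i * a i := fun i => by
    rw [← mul_assoc, ← sq, e']
  simp only [e2, e, ENNReal.mul_rpow_of_nonneg _ _ (zero_le_two : (0 : ℝ) ≤ 2)] at h
  calc (∑ i ∈ s, w i * a i) ^ 2 ≤ _ := pow_le_pow_left' h 2
    _ = _ := by
      rw [mul_pow, e', e']
      simp only [← ENNReal.rpow_natCast, Nat.cast_ofNat]

theorem eLpNorm_sqrt_le {X : Type*} [MeasurableSpace X] {ν : Measure X} {Γ : X → ℝ≥0∞}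
    (hΓ : Measurable Γ) {A S : ℝ≥0∞} (hsup : ∀ᵐ u ∂ν, Γ u ≤ A * S) (h_int : ∫⁻ u, Γ u ∂ν ≤ S)
    {q : ℝ≥0∞} (hq : 2 ≤ q) :
    eLpNorm (fun u => Γ u ^ (1 / 2 : ℝ)) q ν ≤ A ^ (1 / 2 - q.toReal⁻¹ : ℝ) * S ^ (1 / 2 : ℝ) := by
  by_cases hqt : q = ⊤
  · subst hqt
    rw [eLpNorm_exponent_top, ENNReal.toReal_top, inv_zero, sub_zero,
      ← ENNReal.mul_rpow_of_nonneg _ _ (by norm_num)]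
    refine essSup_le_of_ae_le _ ?_
    filter_upwards [hsup] with u hu
    rw [enorm_eq_self]
    gcongr
  · have hq0 : q ≠ 0 := (lt_of_lt_of_le (by norm_num) hq).ne'
    have hq2 : 2 ≤ q.toReal := by
      have := ENNReal.toReal_mono hqt hq
      simpa using this
    set s := q.toReal
    have hs0 : 0 < s := by linarith
    have hs1 : s⁻¹ ≤ 1 / 2 := by
      rw [inv_le_comm₀ hs0 (by norm_num)]; norm_num; exact hq2
    rw [eLpNorm_eq_lintegral_rpow_enorm_toReal hq0 hqt]
    have h1 : ∫⁻ u, ‖Γ u ^ (1 / 2 : ℝ)‖ₑ ^ s ∂ν ≤ (A * S) ^ (s / 2 - 1) * S := by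
      calc _ ≤ ∫⁻ u, (A * S) ^ (s / 2 - 1) * Γ u ∂ν := by
            refine lintegral_mono_ae ?_
            filter_upwards [hsup] with u hu
            rw [enorm_eq_self, ← ENNReal.rpow_mul,
              show (1 / 2 : ℝ) * s = (s / 2 - 1) + 1 by ring,
              ENNReal.rpow_add_of_nonneg _ _ (by linarith) (by norm_num), ENNReal.rpow_one]
            gcongr
            linarith
        _ = (A * S) ^ (s / 2 - 1) * ∫⁻ u, Γ u ∂ν := lintegral_const_mul _ hΓ
        _ ≤ _ := by gcongr
    calc _ ≤ ((A * S) ^ (s / 2 - 1) * S) ^ (1 / s) := by gcongr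
      _ = A ^ (1 / 2 - s⁻¹ : ℝ) * S ^ (1 / 2 : ℝ) := by
        rw [ENNReal.mul_rpow_of_nonneg _ _ (by positivity), ← ENNReal.rpow_mul,
          ENNReal.mul_rpow_of_nonneg _ _ (by
            apply mul_nonneg <;> [linarith; positivity]), mul_assoc,
          ← ENNReal.rpow_add_of_nonneg _ _ (by
            apply mul_nonneg <;> [linarith; positivity]) (by positivity)]
        congr 2 <;> field_simp
        ring

section RegionNorm

variable {G : Type*} [NormedAddCommGroup G] [NormedSpace ℝ G] [FiniteDimensional ℝ G]
  [MeasurableSpace G] [BorelSpace G]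
variable {H : Type*} [NormedAddCommGroup H] [InnerProductSpace ℝ H] [CompleteSpace H]
variable {X : Type*} [MetricSpace X] [MeasurableSpace X] [BorelSpace X]
variable (lam : Measure G) [lam.IsAddHaarMeasure]

theorem measurable_defect {f : G → H} (hf : Continuous f) {p : X → G} {h : X → ℝ}
    (hp : Continuous p) (hh : Continuous h) (l : ℕ) : Measurable (defect lam f p h l) := by
  unfold defect
  refine Measurable.add (Measurable.indicator ((measurable_sqOsc lam hf 2 l).comp hp.measurable)
    (measurableSet_le hh.measurable measurable_const)) (measurable_one.indicator ?_)
  exact (measurableSet_lt measurable_const hh.measurable).inter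
    (measurableSet_le hh.measurable measurable_const)

theorem measurable_wideDefect {f : G → H} (hf : Continuous f) {p : X → G} {h : X → ℝ}
    (hp : Continuous p) (hh : Continuous h) (l : ℕ) : Measurable (wideDefect lam f p h l) := by
  unfold wideDefect
  refine Measurable.add (Measurable.indicator ((measurable_sqOsc lam hf 3 l).comp hp.measurable)
    (measurableSet_le hh.measurable measurable_const)) (measurable_one.indicator ?_)
  exact (measurableSet_lt measurable_const hh.measurable).inter
    (measurableSet_lt hh.measurable measurable_const)

/-- Mass of the wide defect near `z`, normalized at scale `2⁻ᵏ`. -/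
def defectMass (μ : Measure X) (d : ℕ) (f : G → H) (p : X → G) (h : X → ℝ) (l k : ℕ) (z : X) :
    ℝ≥0∞ :=
  2 ^ (k * d) * ∫⁻ u in ball z (3 * (1 / 2) ^ k), wideDefect lam f p h l u ∂μ

theorem defect_le_defectMass {μ : Measure X} {d : ℕ} {C : ℝ≥0∞}
    {f : G → H} {p : X → G} {h : X → ℝ}
    (hp : ∀ u v, ‖p u - p v‖ ≤ dist u v) (hh : ∀ u v, h u ≤ h v + dist u v) {k l : ℕ} (hkl : k ≤ l)
    {z u : X} (hlow : 1 ≤ C * 2 ^ ((l + 2) * d) * μ (ball u ((1 / 2) ^ (l + 2))))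
    (hzu : dist u z ≤ 2 * (1 / 2) ^ k) :
    defect lam f p h l u ≤
      C * 4 ^ d * 2 ^ ((l - k) * d) * defectMass lam μ d f p h l k z := by
  have hsub : ball u ((1 / 2) ^ (l + 2)) ⊆ ball z (3 * (1 / 2) ^ k) := by
    refine ball_subset_ball' ?_
    have : (1 / 2 : ℝ) ^ (l + 2) ≤ (1 / 2) ^ k :=
      pow_le_pow_of_le_one (by norm_num) (by norm_num) (by omega)
    linarith
  have hpow : (2 : ℝ≥0∞) ^ ((l + 2) * d) = 4 ^ d * 2 ^ ((l - k) * d) * 2 ^ (k * d) := by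
    rw [show (4 : ℝ≥0∞) = 2 ^ 2 by norm_num, ← pow_mul, ← pow_add, ← pow_add]
    congr 1
    obtain ⟨j, rfl⟩ := Nat.exists_eq_add_of_le hkl
    rw [add_tsub_cancel_left]; ring
  calc defect lam f p h l u
      ≤ (C * 2 ^ ((l + 2) * d) * μ (ball u ((1 / 2) ^ (l + 2)))) * defect lam f p h l u :=
        le_mul_of_one_le_left' hlow
    _ = C * 2 ^ ((l + 2) * d) *
          ∫⁻ _ in ball u ((1 / 2) ^ (l + 2)), defect lam f p h l u ∂μ := by
        rw [setLIntegral_const]; ring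
    _ ≤ C * 2 ^ ((l + 2) * d) *
          ∫⁻ v in ball u ((1 / 2) ^ (l + 2)), wideDefect lam f p h l v ∂μ := by
        gcongr 1
        refine setLIntegral_mono' measurableSet_ball fun v hv => ?_
        refine defect_le_wideDefect lam hp hh l ?_
        rw [dist_comm]
        exact (mem_ball.1 hv).le
    _ ≤ C * 2 ^ ((l + 2) * d) *
          ∫⁻ v in ball z (3 * (1 / 2) ^ k), wideDefect lam f p h l v ∂μ := by
        gcongr
    _ = _ := by
        rw [hpow]; unfold defectMass; ring

/-- The `L^q` norm of the square root of the defect near `z`. -/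
theorem eLpNorm_defect_le {μ : Measure X} {d : ℕ} {C : ℝ≥0∞} {f : G → H} (hf : Continuous f)
    {p : X → G} {h : X → ℝ} (hpc : Continuous p) (hhc : Continuous h)
    (hp : ∀ u v, ‖p u - p v‖ ≤ dist u v) (hh : ∀ u v, h u ≤ h v + dist u v) {k l : ℕ} (hkl : k ≤ l)
    {z : X} (hlow : ∀ᵐ u ∂μ, 1 ≤ C * 2 ^ ((l + 2) * d) * μ (ball u ((1 / 2) ^ (l + 2))))
    {q : ℝ≥0∞} (hq : 2 ≤ q) :
    eLpNorm (fun u => defect lam f p h l u ^ (1 / 2 : ℝ)) q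
        ((2 : ℝ≥0∞) ^ (k * d) • μ.restrict (ball z (2 * (1 / 2) ^ k))) ≤
      (C * 4 ^ d * 2 ^ ((l - k) * d)) ^ (1 / 2 - q.toReal⁻¹ : ℝ) *
        defectMass lam μ d f p h l k z ^ (1 / 2 : ℝ) := by
  refine eLpNorm_sqrt_le (measurable_defect lam hf hpc hhc l) ?_ ?_ hq
  · refine Measure.ae_smul_measure ?_ _
    filter_upwards [ae_restrict_mem measurableSet_ball, ae_restrict_of_ae hlow] with u hu hl
    exact defect_le_defectMass lam hp hh hkl hl (mem_ball.1 hu).le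
  · rw [lintegral_smul_measure, smul_eq_mul]
    unfold defectMass
    gcongr 2 ^ (k * d) * ?_
    have hsub : ball z (2 * (1 / 2) ^ k) ⊆ ball z (3 * (1 / 2) ^ k) := by
      refine ball_subset_ball ?_
      have : (0 : ℝ) < (1 / 2) ^ k := by positivity
      linarith
    have hle : ∀ u, defect lam f p h l u ≤ wideDefect lam f p h l u := fun u =>
      defect_le_wideDefect lam hp hh l (by rw [dist_self]; positivity)
    exact (lintegral_mono_set hsub).trans (lintegral_mono hle)

end RegionNorm

/-- The geometric ratio `2^{d(1/2 - 1/q) - 1}` which controls the sum over scales. -/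
def scaleRatio (d : ℕ) (q : ℝ≥0∞) : ℝ≥0∞ := 2 ^ (d * (1 / 2 - q.toReal⁻¹) - 1 : ℝ)

theorem half_pow_mul_rpow_le {d : ℕ} {q : ℝ≥0∞} (hq : 2 ≤ q) {C : ℝ≥0∞} (hC : 1 ≤ C) (j : ℕ) :
    2⁻¹ ^ j * (C * 2 ^ (j * d)) ^ (1 / 2 - q.toReal⁻¹ : ℝ) ≤ C * scaleRatio d q ^ j := by
  have hα : 0 ≤ (1 / 2 - q.toReal⁻¹ : ℝ) := by
    by_cases hqt : q = ⊤
    · simp [hqt]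
    · have hq2 : 2 ≤ q.toReal := by simpa using ENNReal.toReal_mono hqt hq
      rw [sub_nonneg, inv_le_comm₀ (by linarith) (by norm_num)]; norm_num; exact hq2
  have hα1 : (1 / 2 - q.toReal⁻¹ : ℝ) ≤ 1 := by
    have : 0 ≤ q.toReal⁻¹ := by positivity
    linarith
  set α := (1 / 2 - q.toReal⁻¹ : ℝ) with hαd
  have h2 : (2 : ℝ≥0∞) ≠ 0 := by norm_num
  have h2' : (2 : ℝ≥0∞) ≠ ⊤ := by norm_num
  rw [ENNReal.mul_rpow_of_nonneg _ _ hα]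
  have e : (2⁻¹ : ℝ≥0∞) ^ j * (2 ^ (j * d)) ^ α = scaleRatio d q ^ j := by
    unfold scaleRatio
    rw [← hαd]
    rw [← ENNReal.rpow_natCast, ← ENNReal.rpow_natCast, ← ENNReal.rpow_natCast,
      ← ENNReal.rpow_mul, ← ENNReal.rpow_mul, ENNReal.inv_rpow, ← ENNReal.rpow_neg,
      ← ENNReal.rpow_add _ _ h2 h2']
    congr 1
    push_cast
    ring
  calc _ = C ^ α * (2⁻¹ ^ j * (2 ^ (j * d)) ^ α) := by ring
    _ ≤ C ^ (1 : ℝ) * (2⁻¹ ^ j * (2 ^ (j * d)) ^ α) := by gcongr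
    _ = _ := by rw [e, ENNReal.rpow_one]

section RegionPlane

variable {G : Type*} [NormedAddCommGroup G] [NormedSpace ℝ G] [FiniteDimensional ℝ G]
  [MeasurableSpace G] [BorelSpace G]
variable {H : Type*} [NormedAddCommGroup H] [InnerProductSpace ℝ H] [CompleteSpace H]
variable {X : Type*} [MetricSpace X] [MeasurableSpace X] [BorelSpace X]
variable (lam : Measure G) [lam.IsAddHaarMeasure]

/-- The total scale-invariant error at the point `z` and scale `2⁻ᵏ`. -/
def scaleError (μ : Measure X) (d : ℕ) (q : ℝ≥0∞) (f : G → H) (p : X → G) (h : X → ℝ) (N k : ℕ)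
    (z : X) : ℝ≥0∞ :=
  sqOsc lam 2 k f (p z) +
    ∑ l ∈ Finset.Ico k (N + 1), scaleRatio d q ^ (l - k) * defectMass lam μ d f p h l k z

theorem eLpNorm_affine_error_le {μ : Measure X} {d : ℕ} {q : ℝ≥0∞} (hq : 2 ≤ q)
    {C B D : ℝ≥0∞} (hC : 1 ≤ C) (hB : 1 ≤ B) {f : G → H} (hf : Continuous f)
    {p : X → G} {h : X → ℝ}
    (hpc : Continuous p) (hhc : Continuous h)
    (hp : ∀ u v, ‖p u - p v‖ ≤ dist u v) (hh : ∀ u v, h u ≤ h v + dist u v) {k N : ℕ}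
    {z : X}
    (hlow : ∀ l, k ≤ l → ∀ᵐ u ∂μ, 1 ≤ C * 2 ^ ((l + 2) * d) * μ (ball u ((1 / 2) ^ (l + 2))))
    (hup : 2 ^ (k * d) * μ (ball z (2 * (1 / 2) ^ k)) ≤ B) {Y : X → H}
    (hY : ∀ᵐ u ∂μ, u ∈ ball z (2 * (1 / 2) ^ k) → ‖Y u‖ₑ ≤
      D * (sqOsc lam 2 k f (p z) ^ (1 / 2 : ℝ) +
        ∑ l ∈ Finset.Ico k (N + 1), 2⁻¹ ^ (l - k) * defect lam f p h l u ^ (1 / 2 : ℝ))) :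
    eLpNorm Y q ((2 : ℝ≥0∞) ^ (k * d) • μ.restrict (ball z (2 * (1 / 2) ^ k))) ^ 2 ≤
      (D * (B + C * 4 ^ d)) ^ 2 * (2 * (1 + (1 - scaleRatio d q)⁻¹)) *
        scaleError lam μ d q f p h N k z := by
  set ν := (2 : ℝ≥0∞) ^ (k * d) • μ.restrict (ball z (2 * (1 / 2) ^ k)) with hν
  have hq1 : 1 ≤ q := le_trans (by norm_num) hq
  set τ := scaleRatio d q
  set a := sqOsc lam 2 k f (p z) ^ (1 / 2 : ℝ) with ha
  have hmeas : ∀ l, Measurable fun u => defect lam f p h l u ^ (1 / 2 : ℝ) := fun l =>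
    (measurable_defect lam hf hpc hhc l).pow_const _
  have hms : ∀ l, AEStronglyMeasurable
      (fun u => (2⁻¹ : ℝ≥0∞) ^ (l - k) * defect lam f p h l u ^ (1 / 2 : ℝ)) ν := fun l =>
    ((hmeas l).const_mul _).aestronglyMeasurable
  have hconst : eLpNorm (fun _ : X => a) q ν ≤ a * B := by
    by_cases h0 : ν = 0
    · simp [h0]
    rw [eLpNorm_const _ (by positivity) h0, enorm_eq_self]
    gcongr
    have : ν univ ≤ B := by
      rw [hν, Measure.smul_apply, Measure.restrict_apply_univ, smul_eq_mul]; exact hup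
    calc ν univ ^ (1 / q.toReal) ≤ B ^ (1 / q.toReal) := by gcongr
      _ ≤ B ^ (1 : ℝ) := by
          refine ENNReal.rpow_le_rpow_of_exponent_le hB ?_
          by_cases hqt : q = ⊤
          · simp [hqt]
          · have hq2 : 1 ≤ q.toReal := by simpa using ENNReal.toReal_mono hqt hq1
            rw [div_le_one (by linarith)]; exact hq2
      _ = B := ENNReal.rpow_one _
  have hterm : ∀ l ∈ Finset.Ico k (N + 1),
      eLpNorm (fun u => (2⁻¹ : ℝ≥0∞) ^ (l - k) * defect lam f p h l u ^ (1 / 2 : ℝ)) q ν ≤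
      C * 4 ^ d * (τ ^ (l - k) * defectMass lam μ d f p h l k z ^ (1 / 2 : ℝ)) := by
    intro l hl
    have hkl := (Finset.mem_Ico.1 hl).1
    refine (eLpNorm_le_mul_eLpNorm_of_ae_le_mul'' (c := (2⁻¹ : ℝ≥0∞) ^ (l - k)) q
      (hmeas l).aestronglyMeasurable (Filter.Eventually.of_forall fun u => le_of_eq rfl)).trans ?_
    calc _ ≤ (2⁻¹ : ℝ≥0∞) ^ (l - k) *
          ((C * 4 ^ d * 2 ^ ((l - k) * d)) ^ (1 / 2 - q.toReal⁻¹ : ℝ) *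
            defectMass lam μ d f p h l k z ^ (1 / 2 : ℝ)) := by
          gcongr
          exact eLpNorm_defect_le lam hf hpc hhc hp hh hkl (hlow l hkl) hq
      _ = (2⁻¹ : ℝ≥0∞) ^ (l - k) *
          ((C * 4 ^ d * 2 ^ ((l - k) * d)) ^ (1 / 2 - q.toReal⁻¹ : ℝ)) *
            defectMass lam μ d f p h l k z ^ (1 / 2 : ℝ) := by ring
      _ ≤ C * 4 ^ d * τ ^ (l - k) * defectMass lam μ d f p h l k z ^ (1 / 2 : ℝ) := by
          gcongr ?_ * defectMass lam μ d f p h l k z ^ (1 / 2 : ℝ)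
          refine half_pow_mul_rpow_le hq ?_ _
          calc (1 : ℝ≥0∞) = 1 * 1 := by norm_num
            _ ≤ C * 4 ^ d := by
              gcongr
              exact one_le_pow_of_one_le' (by norm_num) d
      _ = _ := by ring
  have hmain : eLpNorm Y q ν ≤ D * (B + C * 4 ^ d) * (a + ∑ l ∈ Finset.Ico k (N + 1),
      τ ^ (l - k) * defectMass lam μ d f p h l k z ^ (1 / 2 : ℝ)) := by
    have hY' : ∀ᵐ u ∂ν, ‖Y u‖ₑ ≤ D * ‖((fun _ : X => a) + ∑ l ∈ Finset.Ico k (N + 1),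
        (fun u => (2⁻¹ : ℝ≥0∞) ^ (l - k) * defect lam f p h l u ^ (1 / 2 : ℝ))) u‖ₑ := by
      refine Measure.ae_smul_measure ?_ _
      filter_upwards [ae_restrict_mem measurableSet_ball, ae_restrict_of_ae hY] with u hu hy
      rw [enorm_eq_self, Pi.add_apply, Finset.sum_apply]
      exact hy hu
    have hsm : AEStronglyMeasurable (∑ l ∈ Finset.Ico k (N + 1),
        (fun u => (2⁻¹ : ℝ≥0∞) ^ (l - k) * defect lam f p h l u ^ (1 / 2 : ℝ))) ν :=
      Finset.aestronglyMeasurable_sum _ fun l _ => hms l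
    refine (eLpNorm_le_mul_eLpNorm_of_ae_le_mul'' q
      (aestronglyMeasurable_const.add hsm) hY').trans ?_
    rw [mul_assoc]
    gcongr
    refine (eLpNorm_add_le aestronglyMeasurable_const hsm hq1).trans ?_
    calc _ ≤ a * B + ∑ l ∈ Finset.Ico k (N + 1),
            C * 4 ^ d * (τ ^ (l - k) * defectMass lam μ d f p h l k z ^ (1 / 2 : ℝ)) :=
          add_le_add hconst ((eLpNorm_sum_le (fun l _ => hms l) hq1).trans
            (Finset.sum_le_sum hterm))
      _ ≤ _ := by
          rw [← Finset.mul_sum, mul_add, mul_comm a B]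
          gcongr
          · exact le_self_add
          · exact le_add_self
  have hsq : ∀ x : ℝ≥0∞, (x ^ (1 / 2 : ℝ)) ^ 2 = x := fun x => by
    rw [← ENNReal.rpow_natCast, ← ENNReal.rpow_mul]; norm_num
  have hgeo : ∑ l ∈ Finset.Ico k (N + 1), τ ^ (l - k) ≤ (1 - τ)⁻¹ := by
    rw [Finset.sum_Ico_eq_sum_range]
    simp only [add_tsub_cancel_left]
    rw [← ENNReal.tsum_geometric]
    exact ENNReal.sum_le_tsum _
  have hadd : ∀ x y : ℝ≥0∞, (x + y) ^ 2 ≤ 2 * (x ^ 2 + y ^ 2) := fun x y => by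
    have := ENNReal.rpow_add_le_mul_rpow_add_rpow x y (p := 2) (by norm_num)
    norm_num at this
    exact this
  calc eLpNorm Y q ν ^ 2 ≤ _ := pow_le_pow_left' hmain 2
    _ = (D * (B + C * 4 ^ d)) ^ 2 * (a + ∑ l ∈ Finset.Ico k (N + 1),
      τ ^ (l - k) * defectMass lam μ d f p h l k z ^ (1 / 2 : ℝ)) ^ 2 := mul_pow _ _ _
    _ ≤ (D * (B + C * 4 ^ d)) ^ 2 * (2 * (1 * a ^ 2 + (1 - τ)⁻¹ * ∑ l ∈ Finset.Ico k (N + 1),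
      τ ^ (l - k) * defectMass lam μ d f p h l k z)) := by
        gcongr
        refine (hadd _ _).trans ?_
        rw [one_mul]
        gcongr
        refine (sq_sum_weighted_le _ _ _).trans ?_
        simp only [hsq]
        gcongr
    _ ≤ (D * (B + C * 4 ^ d)) ^ 2 * (2 * ((1 + (1 - τ)⁻¹) * a ^ 2 +
        (1 + (1 - τ)⁻¹) * ∑ l ∈ Finset.Ico k (N + 1),
      τ ^ (l - k) * defectMass lam μ d f p h l k z)) := by
        gcongr
        · exact le_self_add
        · exact le_add_self
    _ = _ := by
        rw [ha, hsq, ← mul_add]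
        unfold scaleError
        ring

end RegionPlane

section Smearing

variable {G : Type*} [NormedAddCommGroup G] [NormedSpace ℝ G] [FiniteDimensional ℝ G]
  [MeasurableSpace G] [BorelSpace G]
variable {X : Type*} [MetricSpace X] [SecondCountableTopology X] [MeasurableSpace X] [BorelSpace X]
variable (lam : Measure G) [lam.IsAddHaarMeasure]

/-- If the fibres of `p` over balls of radius `t` carry little mass in `A`, integrals over `A` of
functions of `p` are controlled by integrals on the target. -/
theorem lintegral_comp_le_of_fibre_le {μ : Measure X} [SFinite μ] {p : X → G} (hp : Continuous p)
    {A : Set X} {t : ℝ} {B : ℝ≥0∞}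
    (hfib : ∀ x, μ {u | u ∈ A ∧ dist x (p u) < t} ≤ B) {φ ψ : G → ℝ≥0∞} (hψ : Measurable ψ)
    (hφψ : ∀ x y, dist x y < t → φ y ≤ ψ x) :
    lam (ball 0 t) * ∫⁻ u in A, φ (p u) ∂μ ≤ B * ∫⁻ x, ψ x ∂lam := by
  have hmeasset : MeasurableSet {z : X × G | dist z.2 (p z.1) < t} :=
    measurableSet_lt (by fun_prop) measurable_const
  have hmeas : Measurable (fun z : X × G =>
      {z : X × G | dist z.2 (p z.1) < t}.indicator (fun z => ψ z.2) z) :=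
    (hψ.comp measurable_snd).indicator hmeasset
  calc lam (ball 0 t) * ∫⁻ u in A, φ (p u) ∂μ
      ≤ ∫⁻ u in A, lam (ball 0 t) * φ (p u) ∂μ := lintegral_const_mul_le _ _
    _ ≤ ∫⁻ u in A, ∫⁻ x, {z : X × G | dist z.2 (p z.1) < t}.indicator
          (fun z => ψ z.2) (u, x) ∂lam ∂μ := by
        refine lintegral_mono fun u => ?_
        calc lam (ball 0 t) * φ (p u) = ∫⁻ _ in ball (p u) t, φ (p u) ∂lam := by
              rw [setLIntegral_const, Measure.addHaar_ball_center lam (p u), mul_comm]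
          _ ≤ ∫⁻ x in ball (p u) t, ψ x ∂lam :=
              setLIntegral_mono' measurableSet_ball fun x hx => hφψ x _ hx
          _ = _ := by
              rw [← lintegral_indicator measurableSet_ball]
              rfl
    _ = ∫⁻ x, ∫⁻ u in A, {z : X × G | dist z.2 (p z.1) < t}.indicator
          (fun z => ψ z.2) (u, x) ∂μ ∂lam := lintegral_lintegral_swap hmeas.aemeasurable
    _ ≤ ∫⁻ x, B * ψ x ∂lam := by
        refine lintegral_mono fun x => ?_
        have hms : MeasurableSet {u | dist x (p u) < t} :=
          measurableSet_lt (by fun_prop) measurable_const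
        calc _ = ∫⁻ u in A, {u | dist x (p u) < t}.indicator (fun _ => ψ x) u ∂μ := rfl
          _ = ψ x * μ ({u | dist x (p u) < t} ∩ A) := by
              rw [lintegral_indicator_const hms, Measure.restrict_apply hms]
          _ ≤ B * ψ x := by
              rw [mul_comm]
              gcongr
              refine le_trans (measure_mono ?_) (hfib x)
              rintro u ⟨h1, h2⟩
              exact ⟨h2, h1⟩
    _ = _ := lintegral_const_mul _ hψ

theorem measurable_lintegral_ball {μ : Measure X} [SFinite μ] {F : X → ℝ≥0∞} (hF : Measurable F)
    (s : ℝ) : Measurable fun z => ∫⁻ u in ball z s, F u ∂μ := by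
  have hmeasset : MeasurableSet {z : X × X | dist z.2 z.1 < s} :=
    measurableSet_lt (by fun_prop) measurable_const
  have hmeas : Measurable (fun z : X × X =>
      {z : X × X | dist z.2 z.1 < s}.indicator (fun z => F z.2) z) :=
    (hF.comp measurable_snd).indicator hmeasset
  have := hmeas.lintegral_prod_right' (ν := μ)
  convert this using 2 with z
  rw [← lintegral_indicator measurableSet_ball]
  rfl

/-- Averaging over small balls and integrating. -/
theorem lintegral_lintegral_ball_le {μ : Measure X} [SFinite μ] {F : X → ℝ≥0∞} (hF : Measurable F)
    {x : X} {R s : ℝ} {B : ℝ≥0∞} (hB : ∀ᵐ u ∂μ, μ (ball u s) ≤ B) :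
    ∫⁻ z in ball x R, ∫⁻ u in ball z s, F u ∂μ ∂μ ≤ B * ∫⁻ u in ball x (R + s), F u ∂μ := by
  have hmeasset : MeasurableSet {z : X × X | dist z.2 z.1 < s} :=
    measurableSet_lt (by fun_prop) measurable_const
  have hmeas : Measurable (fun z : X × X =>
      {z : X × X | dist z.2 z.1 < s}.indicator (fun z => F z.2) z) :=
    (hF.comp measurable_snd).indicator hmeasset
  calc _ = ∫⁻ z in ball x R, ∫⁻ u, {z : X × X | dist z.2 z.1 < s}.indicator
          (fun z => F z.2) (z, u) ∂μ ∂μ := by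
        refine lintegral_congr fun z => ?_
        rw [← lintegral_indicator measurableSet_ball]
        rfl
    _ = ∫⁻ u, ∫⁻ z in ball x R, {z : X × X | dist z.2 z.1 < s}.indicator
          (fun z => F z.2) (z, u) ∂μ ∂μ := lintegral_lintegral_swap hmeas.aemeasurable
    _ ≤ ∫⁻ u, B * (ball x (R + s)).indicator F u ∂μ := by
        refine lintegral_mono_ae ?_
        filter_upwards [hB] with u hu
        have hms : MeasurableSet {z | dist u z < s} :=
          measurableSet_lt (by fun_prop) measurable_const
        have e : ∫⁻ z in ball x R, {z : X × X | dist z.2 z.1 < s}.indicator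
            (fun z => F z.2) (z, u) ∂μ = F u * μ ({z | dist u z < s} ∩ ball x R) := by
          calc _ = ∫⁻ z in ball x R, {z | dist u z < s}.indicator (fun _ => F u) z ∂μ := rfl
            _ = _ := by rw [lintegral_indicator_const hms, Measure.restrict_apply hms]
        rw [e]
        by_cases hux : u ∈ ball x (R + s)
        · rw [indicator_of_mem hux, mul_comm]
          gcongr
          refine le_trans (measure_mono ?_) hu
          rintro z ⟨h1, -⟩
          rw [mem_ball, dist_comm]; exact h1
        · have : {z | dist u z < s} ∩ ball x R = ∅ := by
            ext z
            simp only [mem_inter_iff, mem_ofPred_eq, mem_ball, mem_empty_iff_false, iff_false,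
              not_and, not_lt]
            intro h1
            rw [mem_ball, not_lt] at hux
            linarith [dist_triangle u z x]
          rw [this, measure_empty, mul_zero]
          exact zero_le
    _ = B * ∫⁻ u in ball x (R + s), F u ∂μ := by
        rw [lintegral_const_mul _ (hF.indicator measurableSet_ball),
          lintegral_indicator measurableSet_ball]

end Smearing

theorem sum_indicator_dyadic_le (t : ℝ) (m N : ℕ) :
    ∑ l ∈ Finset.Ico m N, {s : ℝ | (1 / 2) ^ (l + 2) < s ∧ s < 5 * (1 / 2) ^ l}.indicator
      (1 : ℝ → ℝ≥0∞) t ≤ 5 := by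
  classical
  have e : ∀ l, {s : ℝ | (1 / 2) ^ (l + 2) < s ∧ s < 5 * (1 / 2) ^ l}.indicator
      (1 : ℝ → ℝ≥0∞) t = if (1 / 2) ^ (l + 2) < t ∧ t < 5 * (1 / 2) ^ l then 1 else 0 := by
    intro l
    simp [indicator_apply]
  simp only [e]
  rw [Finset.sum_boole]
  set S := {l ∈ Finset.Ico m N | (1 / 2) ^ (l + 2) < t ∧ t < 5 * (1 / 2) ^ l} with hS
  rcases S.eq_empty_or_nonempty with h | h
  · simp [h]
  · set a := S.min' h
    have ha := S.min'_mem h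
    have hsub : S ⊆ Finset.Ico a (a + 5) := by
      intro l hl
      rw [Finset.mem_Ico]
      refine ⟨S.min'_le l hl, ?_⟩
      by_contra hcon
      push Not at hcon
      have h1 := (Finset.mem_filter.1 hl).2.2
      have h2 := (Finset.mem_filter.1 ha).2.1
      have h3 : (1 / 2 : ℝ) ^ l ≤ (1 / 2) ^ (a + 5) :=
        pow_le_pow_of_le_one (by norm_num) (by norm_num) hcon
      have h4 : (0 : ℝ) < (1 / 2) ^ a := by positivity
      change (1 / 2 : ℝ) ^ (a + 2) < t at h2
      rw [pow_add] at h2 h3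
      norm_num at h2 h3
      linarith
    have := Finset.card_le_card hsub
    rw [Nat.card_Ico, add_tsub_cancel_left] at this
    exact_mod_cast this

section RegionSum

variable {G : Type*} [NormedAddCommGroup G] [NormedSpace ℝ G] [FiniteDimensional ℝ G]
  [MeasurableSpace G] [BorelSpace G]
variable {H : Type*} [NormedAddCommGroup H] [InnerProductSpace ℝ H] [CompleteSpace H]
variable {X : Type*} [MetricSpace X] [SecondCountableTopology X] [MeasurableSpace X] [BorelSpace X]
variable (lam : Measure G) [lam.IsAddHaarMeasure]

/-- Data describing a set `E` near `x₀` at scale `2⁻ᵐ` as a Lipschitz graph up to the error `h`. -/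
structure GraphApprox (E : Set X) (x₀ : X) (m : ℕ) (K : ℝ) (f : G → H) (p : X → G) (y : X → H)
    (h : X → ℝ) : Prop where
  nonneg : 0 ≤ K
  lipschitz : ∀ a b, ‖f a - f b‖ ≤ K * ‖a - b‖
  eq_zero : ∀ a, 64 * (1 / 2) ^ m < ‖a‖ → f a = 0
  proj_le : ∀ u v, ‖p u - p v‖ ≤ dist u v
  height_le : ∀ u v, h u ≤ h v + dist u v
  dist_le : ∀ u v, dist u v ≤ ‖p u - p v‖ + ‖y u - y v‖
  approx : ∀ u ∈ E, u ∈ ball x₀ (8 * (1 / 2) ^ m) → ‖y u - f (p u)‖ ≤ K * h u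

namespace GraphApprox

variable {E : Set X} {x₀ : X} {m : ℕ} {K : ℝ} {f : G → H} {p : X → G} {y : X → H} {h : X → ℝ}

theorem continuous_fun (hg : GraphApprox E x₀ m K f p y h) : Continuous f := by
  refine (LipschitzWith.of_dist_le_mul (K := K.toNNReal) fun a b => ?_).continuous
  rw [dist_eq_norm, dist_eq_norm, Real.coe_toNNReal _ hg.nonneg]; exact hg.lipschitz a b

theorem continuous_proj (hg : GraphApprox E x₀ m K f p y h) : Continuous p := by
  refine (LipschitzWith.of_dist_le_mul (K := 1) fun a b => ?_).continuous
  rw [dist_eq_norm, NNReal.coe_one, one_mul]; exact hg.proj_le a b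

theorem continuous_height (hg : GraphApprox E x₀ m K f p y h) : Continuous h := by
  refine (LipschitzWith.of_dist_le_mul (K := 1) fun a b => ?_).continuous
  rw [Real.dist_eq, NNReal.coe_one, one_mul, abs_le]
  have h1 := hg.height_le a b
  have h2 := hg.height_le b a
  rw [dist_comm] at h2
  constructor <;> linarith

theorem measure_fibre_le (hg : GraphApprox E x₀ m K f p y h) {μ : Measure X}
    (hE : ∀ᵐ u ∂μ, u ∈ E) {M t : ℝ} (hM : 2 + 6 * K ≤ M) (ht : 0 < t) {B : ℝ≥0∞}
    (hB : ∀ u ∈ E, μ (ball u (M * t)) ≤ B) (a : G) :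
    μ {u | u ∈ ball x₀ (5 * (1 / 2) ^ m) ∩ {u | h u ≤ 2 * t} ∧ dist a (p u) < t} ≤ B := by
  set S := {u | u ∈ ball x₀ (5 * (1 / 2) ^ m) ∩ {u | h u ≤ 2 * t} ∧ dist a (p u) < t}
  have hm : (0 : ℝ) < (1 / 2) ^ m := by positivity
  rcases (S ∩ E).eq_empty_or_nonempty with h0 | ⟨v, hv, hvE⟩
  · have : μ S ≤ μ Eᶜ := by
      refine measure_mono fun u hu huE => ?_
      have : u ∈ S ∩ E := ⟨hu, huE⟩
      rw [h0] at this
      exact this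
    rw [show μ Eᶜ = 0 from hE] at this
    exact this.trans zero_le
  · have hsub : S ∩ E ⊆ ball v (M * t) := by
      rintro u ⟨⟨⟨hu1, hu2⟩, hu3⟩, huE⟩
      obtain ⟨⟨hv1, hv2⟩, hv3⟩ := hv
      have hbig : ∀ w, w ∈ ball x₀ (5 * (1 / 2) ^ m) → w ∈ ball x₀ (8 * (1 / 2) ^ m) :=
        fun w hw => ball_subset_ball (by linarith) hw
      have e1 := hg.approx u huE (hbig u hu1)
      have e2 := hg.approx v hvE (hbig v hv1)
      have e3 : ‖p u - p v‖ < 2 * t := by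
        rw [← dist_eq_norm]
        linarith [dist_triangle_left (p u) (p v) a]
      have e4 := hg.lipschitz (p u) (p v)
      have e5 : ‖y u - y v‖ ≤ ‖y u - f (p u)‖ + ‖f (p u) - f (p v)‖ + ‖y v - f (p v)‖ := by
        have : y u - y v = (y u - f (p u)) + (f (p u) - f (p v)) - (y v - f (p v)) := by abel
        rw [this]
        exact (norm_sub_le _ _).trans (add_le_add (norm_add_le _ _) le_rfl)
      have hK := hg.nonneg
      have e6 : K * h u ≤ K * (2 * t) := mul_le_mul_of_nonneg_left hu2 hK
      have e7 : K * h v ≤ K * (2 * t) := mul_le_mul_of_nonneg_left hv2 hK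
      have e8 : K * ‖p u - p v‖ ≤ K * (2 * t) := mul_le_mul_of_nonneg_left e3.le hK
      have e9 : (2 + 6 * K) * t ≤ M * t := by gcongr
      rw [mem_ball]
      linarith [hg.dist_le u v]
    calc μ S = μ (S ∩ E) := (measure_inter_conull' (by
          refine measure_mono_null ?_ (show μ Eᶜ = 0 from hE)
          exact fun u hu => hu.2)).symm
      _ ≤ μ (ball v (M * t)) := measure_mono hsub
      _ ≤ B := hB v hvE

theorem lintegral_sqOsc_comp_le (hg : GraphApprox E x₀ m K f p y h) {μ : Measure X} [SFinite μ]
    (hE : ∀ᵐ u ∂μ, u ∈ E) {M : ℝ} (hM : 2 + 6 * K ≤ M) {d : ℕ} (hd : d = Module.finrank ℝ G)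
    {B : ℝ≥0∞} {l : ℕ} (hB : ∀ u ∈ E, μ (ball u (M * (1 / 2) ^ l)) ≤ B * 2⁻¹ ^ (l * d)) :
    ∫⁻ u in ball x₀ (5 * (1 / 2) ^ m) ∩ {u | h u ≤ 2 * (1 / 2) ^ l}, sqOsc lam 3 l f (p u) ∂μ ≤
      (lam (ball 0 1))⁻¹ * B * ∫⁻ a, sqOsc lam 4 l f a ∂lam := by
  have ht : (0 : ℝ) < (1 / 2) ^ l := by positivity
  have key := lintegral_comp_le_of_fibre_le lam hg.continuous_proj
    (fun a => hg.measure_fibre_le hE hM ht hB a) (measurable_sqOsc lam hg.continuous_fun 4 l)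
    (φ := sqOsc lam 3 l f) (fun a b hab => by
      have := sqOsc_le_sqOsc_of_near lam (f := f) 3 l (p := b) (p' := a)
        (by rw [← dist_eq_norm, dist_comm]; exact hab.le)
      norm_num at this ⊢
      exact this)
  rw [Measure.addHaar_ball_of_pos lam _ ht, ← hd, ← pow_mul, ofReal_half_pow] at key
  have hne0 : lam (ball (0 : G) 1) ≠ 0 := (measure_ball_pos lam _ one_pos).ne'
  have hnetop : lam (ball (0 : G) 1) ≠ ⊤ := measure_ball_lt_top.ne
  have hc0 : (2⁻¹ : ℝ≥0∞) ^ (l * d) ≠ 0 := by simp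
  have hct : (2⁻¹ : ℝ≥0∞) ^ (l * d) ≠ ⊤ := ENNReal.pow_ne_top (by simp)
  set I := ∫⁻ u in ball x₀ (5 * (1 / 2) ^ m) ∩ {u | h u ≤ 2 * (1 / 2) ^ l}, sqOsc lam 3 l f (p u) ∂μ
  set J := ∫⁻ a, sqOsc lam 4 l f a ∂lam
  have key2 : (2⁻¹ : ℝ≥0∞) ^ (l * d) * (lam (ball 0 1) * I) ≤ 2⁻¹ ^ (l * d) * (B * J) := by
    calc _ = 2⁻¹ ^ (l * d) * lam (ball 0 1) * I := by ring
      _ ≤ _ := key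
      _ = _ := by ring
  rw [ENNReal.mul_le_mul_iff_right hc0 hct] at key2
  calc I = (lam (ball 0 1))⁻¹ * (lam (ball 0 1) * I) := by
        rw [← mul_assoc, ENNReal.inv_mul_cancel hne0 hnetop, one_mul]
    _ ≤ (lam (ball 0 1))⁻¹ * (B * J) := by gcongr
    _ = _ := by ring

theorem sum_lintegral_wideDefect_le (hg : GraphApprox E x₀ m K f p y h) {μ : Measure X} [SFinite μ]
    (hE : ∀ᵐ u ∂μ, u ∈ E) (hx₀ : x₀ ∈ E) {M : ℝ} (hM : 2 + 6 * K ≤ M) (hM5 : 5 ≤ M) {d : ℕ}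
    (hd : d = Module.finrank ℝ G) {B : ℝ≥0∞}
    (hB : ∀ u ∈ E, ∀ l, m ≤ l → μ (ball u (M * (1 / 2) ^ l)) ≤ B * 2⁻¹ ^ (l * d)) (N : ℕ) :
    ∑ l ∈ Finset.Ico m N, ∫⁻ u in ball x₀ (5 * (1 / 2) ^ m), wideDefect lam f p h l u ∂μ ≤
      ((lam (ball 0 1))⁻¹ * B * (lam (ball 0 4) ^ 2 * (8 * ENNReal.ofReal ((K * 4) ^ 2)) *
        lam (closedBall 0 64)) + 5 * B) * 2⁻¹ ^ (m * d) := by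
  have hhc := hg.continuous_height
  have hm : (0 : ℝ) < (1 / 2) ^ m := by positivity
  have hms : ∀ l, MeasurableSet {u | (1 / 2) ^ (l + 2) < h u ∧ h u < 5 * (1 / 2) ^ l} := fun l =>
    (measurableSet_lt measurable_const hhc.measurable).inter
      (measurableSet_lt hhc.measurable measurable_const)
  have hms' : ∀ l, MeasurableSet {u | h u ≤ 2 * (1 / 2) ^ l} := fun l =>
    measurableSet_le hhc.measurable measurable_const
  have hball : μ (ball x₀ (5 * (1 / 2) ^ m)) ≤ B * 2⁻¹ ^ (m * d) :=
    (measure_mono (ball_subset_ball (by gcongr))).trans (hB x₀ hx₀ m le_rfl)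
  have e : ∀ l, ∫⁻ u in ball x₀ (5 * (1 / 2) ^ m), wideDefect lam f p h l u ∂μ =
      ∫⁻ u in ball x₀ (5 * (1 / 2) ^ m) ∩ {u | h u ≤ 2 * (1 / 2) ^ l}, sqOsc lam 3 l f (p u) ∂μ +
      ∫⁻ u in ball x₀ (5 * (1 / 2) ^ m),
        {s : ℝ | (1 / 2) ^ (l + 2) < s ∧ s < 5 * (1 / 2) ^ l}.indicator 1 (h u) ∂μ := by
    intro l
    unfold wideDefect
    rw [lintegral_add_right _ (measurable_one.indicator (hms l)), lintegral_indicator (hms' l),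
      Measure.restrict_restrict (hms' l), inter_comm]
    rfl
  simp only [e]
  rw [Finset.sum_add_distrib, add_mul]
  refine add_le_add ?_ ?_
  · calc _ ≤ ∑ l ∈ Finset.Ico m N, (lam (ball 0 1))⁻¹ * B * ∫⁻ a, sqOsc lam 4 l f a ∂lam :=
          Finset.sum_le_sum fun l hl => hg.lintegral_sqOsc_comp_le lam hE hM hd
            fun u hu => hB u hu l (Finset.mem_Ico.1 hl).1
      _ ≤ (lam (ball 0 1))⁻¹ * B * (lam (ball 0 4) ^ 2 * (8 * ENNReal.ofReal ((K * 4) ^ 2)) *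
          lam (closedBall 0 (64 * (1 / 2) ^ m))) := by
          rw [← Finset.mul_sum]
          gcongr
          exact sum_lintegral_sqOsc_le lam hg.nonneg hg.lipschitz hg.eq_zero m N
      _ = _ := by
          rw [mul_comm (64 : ℝ), Measure.addHaar_closedBall_mul lam _ hm.le (by norm_num), ← hd,
            ← pow_mul, ofReal_half_pow]
          ring
  · rw [← lintegral_finsetSum]
    swap
    · intro l _
      exact measurable_one.indicator (hms l)
    calc _ ≤ ∫⁻ _ in ball x₀ (5 * (1 / 2) ^ m), 5 ∂μ :=
          lintegral_mono fun u => sum_indicator_dyadic_le (h u) m N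
      _ ≤ 5 * (B * 2⁻¹ ^ (m * d)) := by
          rw [setLIntegral_const]
          gcongr
      _ = _ := by ring

/-- The Carleson estimate for the scale errors in the region where `h` is small. -/
theorem sum_lintegral_scaleError_le (hg : GraphApprox E x₀ m K f p y h) {μ : Measure X} [SFinite μ]
    (hE : ∀ᵐ u ∂μ, u ∈ E) (hx₀ : x₀ ∈ E) {M : ℝ} (hM : 2 + 6 * K ≤ M) (hM5 : 5 ≤ M) {d : ℕ}
    (hd : d = Module.finrank ℝ G) {B : ℝ≥0∞}
    (hB : ∀ u ∈ E, ∀ l, m ≤ l → μ (ball u (M * (1 / 2) ^ l)) ≤ B * 2⁻¹ ^ (l * d)) (q : ℝ≥0∞)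
    (N : ℕ) :
    ∑ k ∈ Finset.Ico m N, ∫⁻ z in ball x₀ (2 * (1 / 2) ^ m) ∩ {z | h z ≤ (1 / 2) ^ k},
      scaleError lam μ d q f p h N k z ∂μ ≤
      (1 + B * (1 - scaleRatio d q)⁻¹) *
      ((lam (ball 0 1))⁻¹ * B * (lam (ball 0 4) ^ 2 * (8 * ENNReal.ofReal ((K * 4) ^ 2)) *
        lam (closedBall 0 64)) + 5 * B) * 2⁻¹ ^ (m * d) := by
  have hhc := hg.continuous_height
  have hpc := hg.continuous_proj
  have hfc := hg.continuous_fun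
  set τ := scaleRatio d q
  set a : ℕ → ℝ≥0∞ := fun l =>
    ∫⁻ u in ball x₀ (5 * (1 / 2) ^ m), wideDefect lam f p h l u ∂μ with ha
  have hmass : ∀ k, m ≤ k → ∀ l,
      ∫⁻ z in ball x₀ (2 * (1 / 2) ^ m), defectMass lam μ d f p h l k z ∂μ ≤ B * a l := by
    intro k hk l
    unfold defectMass
    rw [lintegral_const_mul _ (measurable_lintegral_ball (measurable_wideDefect lam hfc hpc hhc l) _)]
    have hk' : (1 / 2 : ℝ) ^ k ≤ (1 / 2) ^ m :=
      pow_le_pow_of_le_one (by norm_num) (by norm_num) hk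
    calc _ ≤ 2 ^ (k * d) * (B * 2⁻¹ ^ (k * d) *
          ∫⁻ u in ball x₀ (2 * (1 / 2) ^ m + 3 * (1 / 2) ^ k), wideDefect lam f p h l u ∂μ) := by
          gcongr
          refine lintegral_lintegral_ball_le (measurable_wideDefect lam hfc hpc hhc l) ?_
          filter_upwards [hE] with u hu
          refine (measure_mono (ball_subset_ball ?_)).trans (hB u hu k hk)
          gcongr
          linarith
      _ = (2 * 2⁻¹) ^ (k * d) * (B * ∫⁻ u in ball x₀ (2 * (1 / 2) ^ m + 3 * (1 / 2) ^ k),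
            wideDefect lam f p h l u ∂μ) := by
          rw [mul_pow]; ring
      _ ≤ B * a l := by
          rw [ENNReal.mul_inv_cancel (by norm_num) (by norm_num), one_pow, one_mul]
          gcongr B * ?_
          exact lintegral_mono_set (ball_subset_ball (by linarith))
  have hone : ∀ k ∈ Finset.Ico m N,
      ∫⁻ z in ball x₀ (2 * (1 / 2) ^ m) ∩ {z | h z ≤ (1 / 2) ^ k},
        scaleError lam μ d q f p h N k z ∂μ ≤
      a k + ∑ l ∈ Finset.Ico k (N + 1), τ ^ (l - k) * (B * a l) := by
    intro k hk
    have hmk := (Finset.mem_Ico.1 hk).1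
    have hms : ∀ l, Measurable fun z => τ ^ (l - k) * defectMass lam μ d f p h l k z := fun l =>
      ((measurable_lintegral_ball (measurable_wideDefect lam hfc hpc hhc l) _).const_mul _).const_mul _
    unfold scaleError
    rw [lintegral_add_right _ (Finset.measurable_sum _ fun l _ => hms l),
      lintegral_finsetSum _ fun l _ => hms l]
    refine add_le_add ?_ (Finset.sum_le_sum fun l _ => ?_)
    · have hk0 : (0 : ℝ) < (1 / 2) ^ k := by positivity
      have hm0 : (0 : ℝ) < (1 / 2) ^ m := by positivity
      calc _ ≤ ∫⁻ z in ball x₀ (2 * (1 / 2) ^ m) ∩ {z | h z ≤ (1 / 2) ^ k},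
            wideDefect lam f p h k z ∂μ := by
            refine setLIntegral_mono' (measurableSet_ball.inter
              (measurableSet_le hhc.measurable measurable_const)) fun z hz => ?_
            refine le_trans ?_ (defect_le_wideDefect lam hg.proj_le hg.height_le k (u := z) (v := z)
              (by rw [dist_self]; positivity))
            unfold defect
            rw [indicator_of_mem (by exact hz.2)]
            exact le_self_add
        _ ≤ a k := by
            refine lintegral_mono_set (inter_subset_left.trans (ball_subset_ball ?_))
            linarith
    · have hmd : Measurable (defectMass lam μ d f p h l k) :=
        (measurable_lintegral_ball (measurable_wideDefect lam hfc hpc hhc l) _).const_mul _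
      rw [lintegral_const_mul _ hmd]
      gcongr
      exact (lintegral_mono_set inter_subset_left).trans (hmass k hmk l)
  have hswap : ∑ k ∈ Finset.Ico m N, ∑ l ∈ Finset.Ico k (N + 1), τ ^ (l - k) * (B * a l) ≤
      ∑ l ∈ Finset.Ico m (N + 1), (1 - τ)⁻¹ * (B * a l) := by
    calc _ ≤ ∑ k ∈ Finset.Ico m (N + 1), ∑ l ∈ Finset.Ico k (N + 1), τ ^ (l - k) * (B * a l) :=
          Finset.sum_le_sum_of_subset (Finset.Ico_subset_Ico_right (by omega))
      _ = ∑ l ∈ Finset.Ico m (N + 1), ∑ k ∈ Finset.Ico m (l + 1), τ ^ (l - k) * (B * a l) := by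
          refine Finset.sum_comm' fun k l => ?_
          simp only [Finset.mem_Ico]
          omega
      _ ≤ _ := by
          refine Finset.sum_le_sum fun l hl => ?_
          rw [← Finset.sum_mul]
          gcongr
          have hml := (Finset.mem_Ico.1 hl).1
          rw [← ENNReal.tsum_geometric]
          calc ∑ k ∈ Finset.Ico m (l + 1), τ ^ (l - k)
              = ∑ j ∈ Finset.range (l + 1 - m), τ ^ j := by
                rw [Finset.sum_Ico_eq_sum_range, ← Finset.sum_range_reflect]
                refine Finset.sum_congr rfl fun j hj => ?_
                rw [Finset.mem_range] at hj
                congr 1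
                omega
            _ ≤ _ := ENNReal.sum_le_tsum _
  calc _ ≤ ∑ k ∈ Finset.Ico m N, (a k + ∑ l ∈ Finset.Ico k (N + 1), τ ^ (l - k) * (B * a l)) :=
        Finset.sum_le_sum hone
    _ ≤ ∑ l ∈ Finset.Ico m (N + 1), a l + ∑ l ∈ Finset.Ico m (N + 1), (1 - τ)⁻¹ * (B * a l) := by
        rw [Finset.sum_add_distrib]
        exact add_le_add (Finset.sum_le_sum_of_subset (Finset.Ico_subset_Ico_right (by omega))) hswap
    _ = (1 + B * (1 - τ)⁻¹) * ∑ l ∈ Finset.Ico m (N + 1), a l := by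
        rw [← Finset.mul_sum, ← Finset.mul_sum]; ring
    _ ≤ _ := by
        rw [mul_assoc]
        gcongr
        exact hg.sum_lintegral_wideDefect_le lam hE hx₀ hM hM5 hd hB (N + 1)

end GraphApprox

end RegionSum

section RegionPackage

variable {G : Type*} [NormedAddCommGroup G] [NormedSpace ℝ G] [FiniteDimensional ℝ G]
  [MeasurableSpace G] [BorelSpace G]
variable {H : Type*} [NormedAddCommGroup H] [InnerProductSpace ℝ H] [CompleteSpace H]
variable {X : Type*} [MetricSpace X] [SecondCountableTopology X] [MeasurableSpace X] [BorelSpace X]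
/-- Near points where `h` is small the set is close, in a square summable sense, to affine graphs. -/
theorem exists_affine_error_carleson (d : ℕ) (hd : d = Module.finrank ℝ G) (q : ℝ≥0∞) (hq : 2 ≤ q)
    (hτ : scaleRatio d q < 1) (K M : ℝ) (hK : 0 ≤ K) (hM : 2 + 6 * K ≤ M) (hM5 : 5 ≤ M) (B : ℝ≥0∞)
    (hB1 : 1 ≤ B) (hBt : B ≠ ⊤) :
    ∃ C : ℝ≥0∞, C ≠ ⊤ ∧ ∀ (μ : Measure X) [SFinite μ] (E : Set X) (x₀ : X) (m N : ℕ)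
      (f : G → H) (p : X → G) (y : X → H) (h : X → ℝ), GraphApprox E x₀ m K f p y h →
      (∀ᵐ u ∂μ, u ∈ E) → x₀ ∈ E → (∀ u, (1 / 2) ^ N ≤ h u) →
      (∀ u ∈ E, ∀ l, m ≤ l → 1 ≤ B * 2 ^ (l * d) * μ (ball u ((1 / 2) ^ l))) →
      (∀ u ∈ E, ∀ l, m ≤ l → μ (ball u (M * (1 / 2) ^ l)) ≤ B * 2⁻¹ ^ (l * d)) →
      ∃ W : ℕ → X → ℝ≥0∞,
        (∀ k ∈ Finset.Ico m N, ∀ z ∈ E, z ∈ ball x₀ (2 * (1 / 2) ^ m) → h z ≤ (1 / 2) ^ k →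
          ∃ (c : H) (L : G →ₗ[ℝ] H),
          eLpNorm (fun u => (2 : ℝ) ^ k • (y u - c - L (p u - p z))) q
            ((2 : ℝ≥0∞) ^ (k * d) • μ.restrict (ball z (2 * (1 / 2) ^ k))) ^ 2 ≤ W k z) ∧
        ∑ k ∈ Finset.Ico m N, ∫⁻ z in ball x₀ (2 * (1 / 2) ^ m) ∩ {z | h z ≤ (1 / 2) ^ k},
          W k z ∂μ ≤ C * 2⁻¹ ^ (m * d) := by
  have ⟨lam, hlam⟩ : ∃ lam : Measure G, lam.IsAddHaarMeasure := ⟨Measure.addHaar, inferInstance⟩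
  obtain ⟨C₁, hC₁, happ⟩ := exists_dyadic_approximation (H := H) lam
  set D := C₁ ^ (1 / 2 : ℝ) + ENNReal.ofReal (12 * K) with hD
  set C₂ := (D * (B + B * 4 ^ d)) ^ 2 * (2 * (1 + (1 - scaleRatio d q)⁻¹)) with hC₂
  set C₃ := (1 + B * (1 - scaleRatio d q)⁻¹) *
      ((lam (ball 0 1))⁻¹ * B * (lam (ball 0 4) ^ 2 * (8 * ENNReal.ofReal ((K * 4) ^ 2)) *
        lam (closedBall 0 64)) + 5 * B) with hC₃
  have hDt : D ≠ ⊤ := by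
    rw [hD]
    exact ENNReal.add_ne_top.2 ⟨ENNReal.rpow_ne_top_of_nonneg (by norm_num) hC₁, ENNReal.ofReal_ne_top⟩
  have hinv : (1 - scaleRatio d q)⁻¹ ≠ ⊤ := ENNReal.inv_ne_top.2 (tsub_pos_of_lt hτ).ne'
  have hlinv : (lam (ball (0 : G) 1))⁻¹ ≠ ⊤ :=
    ENNReal.inv_ne_top.2 (measure_ball_pos lam _ one_pos).ne'
  have hl4 : lam (ball (0 : G) 4) ≠ ⊤ := measure_ball_lt_top.ne
  have hl64 : lam (closedBall (0 : G) 64) ≠ ⊤ := measure_closedBall_lt_top.ne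
  have hC₂t : C₂ ≠ ⊤ := by rw [hC₂]; finiteness
  have hC₃t : C₃ ≠ ⊤ := by rw [hC₃]; finiteness
  refine ⟨C₂ * C₃, ENNReal.mul_ne_top hC₂t hC₃t, ?_⟩
  intro μ _ E x₀ m N f p y h hg hE hx₀ hN hlow hup
  obtain ⟨g, hgL, hgd, hgf⟩ := happ f K hK hg.lipschitz
  refine ⟨fun k z => C₂ * scaleError lam μ d q f p h N k z, ?_, ?_⟩
  · intro k hk z hz hzx hhz
    obtain ⟨L, hL⟩ := hgL k (p z)
    have hmk := (Finset.mem_Ico.1 hk).1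
    refine ⟨g k (p z), L, ?_⟩
    refine eLpNorm_affine_error_le lam hq hB1 hB1 hg.continuous_fun hg.continuous_proj
      hg.continuous_height hg.proj_le hg.height_le (D := D) ?_ ?_ ?_
    · intro l hl
      filter_upwards [hE] with u hu
      exact hlow u hu (l + 2) (by omega)
    · calc _ ≤ 2 ^ (k * d) * (B * 2⁻¹ ^ (k * d)) := by
            gcongr
            refine (measure_mono (ball_subset_ball ?_)).trans (hup z hz k hmk)
            gcongr
            linarith
        _ = (2 * 2⁻¹) ^ (k * d) * B := by rw [mul_pow]; ring
        _ = B := by rw [ENNReal.mul_inv_cancel (by norm_num) (by norm_num), one_pow, one_mul]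
    · filter_upwards [hE] with u hu hub
      refine enorm_affine_error_le lam hK hgd hgf hg.proj_le hg.height_le hL hhz
        (mem_ball.1 hub).le (hN u) (Finset.mem_Ico.1 hk).2.le (hg.approx u hu ?_)
      rw [mem_ball] at hub hzx ⊢
      have hk' : (1 / 2 : ℝ) ^ k ≤ (1 / 2) ^ m :=
        pow_le_pow_of_le_one (by norm_num) (by norm_num) hmk
      linarith [dist_triangle u z x₀, (by positivity : (0 : ℝ) < (1 / 2) ^ m)]
  · calc _ = C₂ * ∑ k ∈ Finset.Ico m N,
          ∫⁻ z in ball x₀ (2 * (1 / 2) ^ m) ∩ {z | h z ≤ (1 / 2) ^ k},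
            scaleError lam μ d q f p h N k z ∂μ := by
          rw [Finset.mul_sum]
          exact Finset.sum_congr rfl fun k _ => lintegral_const_mul' _ _ hC₂t
      _ ≤ C₂ * (C₃ * 2⁻¹ ^ (m * d)) := by
          gcongr
          exact hg.sum_lintegral_scaleError_le lam hE hx₀ hM hM5 hd hup q N
      _ = _ := by ring

end RegionPackage

section JohnNirenberg

variable {X : Type*}

/-- The tail `∑_{k ≥ m} F k z`. -/
def tailSum (F : ℕ → X → ℝ≥0∞) (m : ℕ) (z : X) : ℝ≥0∞ := ∑' i, F (m + i) z

theorem tailSum_eq_sum_add (F : ℕ → X → ℝ≥0∞) (m i : ℕ) (z : X) :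
    tailSum F m z = ∑ j ∈ Finset.range i, F (m + j) z + tailSum F (m + i) z := by
  unfold tailSum
  rw [← ENNReal.summable.sum_add_tsum_nat_add' (f := fun j => F (m + j) z) (k := i)]
  congr 1
  exact tsum_congr fun j => by rw [add_assoc, add_comm i j]

theorem sum_range_le_mul {F : ℕ → X → ℝ≥0∞} {b : ℝ≥0∞} (hF : ∀ k z, F k z ≤ b) (m i : ℕ) (z : X) :
    ∑ j ∈ Finset.range i, F (m + j) z ≤ i * b := by
  refine (Finset.sum_le_card_nsmul _ _ b fun j _ => hF _ _).trans ?_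
  simp

theorem tailSum_le_add {F : ℕ → X → ℝ≥0∞} {b : ℝ≥0∞} (hF : ∀ k z, F k z ≤ b) (m i : ℕ) (z : X) :
    tailSum F m z ≤ i * b + tailSum F (m + i) z := by
  rw [tailSum_eq_sum_add F m i z]
  gcongr
  exact sum_range_le_mul hF m i z

theorem measurable_tailSum [MeasurableSpace X] {F : ℕ → X → ℝ≥0∞} (hF : ∀ k, Measurable (F k))
    (m : ℕ) : Measurable (tailSum F m) :=
  Measurable.tsum fun i => hF (m + i)

variable [MetricSpace X]

theorem sum_range_le_add_of_dist_le {F : ℕ → X → ℝ≥0∞} {b : ℝ≥0∞}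
    (hL : ∀ k z w, F k z ≤ F k w + b * ENNReal.ofReal (2 ^ k * dist z w)) (m i : ℕ) {z w : X}
    (hzw : dist z w ≤ (1 / 2) ^ (m + i)) :
    ∑ j ∈ Finset.range i, F (m + j) z ≤ ∑ j ∈ Finset.range i, F (m + j) w + b := by
  have h1 : ∀ j ∈ Finset.range i, F (m + j) z ≤ F (m + j) w + b * ENNReal.ofReal (2 ^ j / 2 ^ i) := by
    intro j _
    refine (hL (m + j) z w).trans ?_
    gcongr
    calc (2 : ℝ) ^ (m + j) * dist z w ≤ 2 ^ (m + j) * (1 / 2) ^ (m + i) := by gcongr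
      _ = 2 ^ j / 2 ^ i := by
        rw [pow_add, pow_add, one_div, inv_pow, inv_pow]; field_simp
  refine (Finset.sum_le_sum h1).trans ?_
  rw [Finset.sum_add_distrib, ← Finset.mul_sum, ← ENNReal.ofReal_sum_of_nonneg fun _ _ => by positivity,
    ← Finset.sum_div]
  gcongr
  refine (mul_le_mul_right (ENNReal.ofReal_le_one.2 ?_) b).trans (mul_one b).le
  rw [div_le_one (by positivity), geom_sum_eq (by norm_num)]
  norm_num

/-- Stopping time: where the tail sum exceeds a threshold, it does so with controlled excess on a
whole ball. -/
theorem exists_stopping_scale {F : ℕ → X → ℝ≥0∞} {b : ℝ≥0∞}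
    (hF : ∀ k z, F k z ≤ b)
    (hL : ∀ k z w, F k z ≤ F k w + b * ENNReal.ofReal (2 ^ k * dist z w)) {m j : ℕ} {A' : ℝ≥0∞}
    (hA' : 4 * b ≤ A') {z : X} (hz : (j + 1 : ℕ) * A' < tailSum F m z) :
    ∃ i, j + 1 ≤ i ∧ ∀ w, dist z w ≤ (1 / 2) ^ (m + i) →
      j * A' < tailSum F m w ∧
      tailSum F m w ≤ j * A' + 4 * b + tailSum F (m + i) w := by
  classical
  have hT : j * A' + 2 * b < tailSum F m z := by
    refine lt_of_le_of_lt ?_ hz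
    push_cast
    rw [add_mul, one_mul]
    gcongr
    exact le_trans (by gcongr; norm_num) hA'
  have hex : ∃ i, j * A' + 2 * b < ∑ l ∈ Finset.range i, F (m + l) z := by
    unfold tailSum at hT
    rw [ENNReal.tsum_eq_iSup_nat] at hT
    exact lt_iSup_iff.1 hT
  set i := Nat.find hex with hi
  have hi1 : j * A' + 2 * b < ∑ l ∈ Finset.range i, F (m + l) z := Nat.find_spec hex
  have hipos : i ≠ 0 := by
    rintro h0
    rw [h0] at hi1
    simp at hi1
  have hi2 : ∑ l ∈ Finset.range i, F (m + l) z ≤ j * A' + 3 * b := by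
    obtain ⟨i', hi'⟩ := Nat.exists_eq_succ_of_ne_zero hipos
    have := Nat.find_min hex (m := i') (by omega)
    rw [hi', Finset.sum_range_succ]
    calc _ ≤ (j * A' + 2 * b) + b := add_le_add (not_lt.1 this) (hF _ _)
      _ = _ := by ring
  refine ⟨i, ?_, ?_⟩
  · by_contra hlt
    push Not at hlt
    have h3 := hi1.trans_le (sum_range_le_mul hF m i z)
    have h4 : (i : ℝ≥0∞) * b ≤ j * A' + 2 * b := by
      calc (i : ℝ≥0∞) * b ≤ (j : ℝ≥0∞) * b := by gcongr; omega
        _ ≤ j * A' := by gcongr; exact le_trans (le_mul_of_one_le_left' (by norm_num)) hA'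
        _ ≤ _ := le_self_add
    exact absurd h3 (not_lt.2 h4)
  · intro w hw
    have hw' : dist w z ≤ (1 / 2) ^ (m + i) := by rwa [dist_comm]
    have a1 := sum_range_le_add_of_dist_le hL m i hw
    have a2 := sum_range_le_add_of_dist_le hL m i hw'
    constructor
    · have h5 := hi1.trans_le a1
      have h6 : j * A' + b < ∑ l ∈ Finset.range i, F (m + l) w := by
        refine lt_of_add_lt_add_right (a := b) ?_
        rwa [add_assoc, ← two_mul]
      rw [tailSum_eq_sum_add F m i w]
      exact (le_self_add.trans_lt h6).trans_le le_self_add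
    · rw [tailSum_eq_sum_add F m i w]
      gcongr
      calc _ ≤ (j * A' + 3 * b) + b := a2.trans (by gcongr)
        _ = _ := by ring

end JohnNirenberg

section JohnNirenbergIntegral

variable {X : Type*} [MetricSpace X] [SecondCountableTopology X] [MeasurableSpace X] [BorelSpace X]

/-- The level sets in the iteration of the John-Nirenberg argument. -/
def levelSet (E : Set X) (F : ℕ → X → ℝ≥0∞) (A' : ℝ≥0∞) (x : X) (m j : ℕ) : Set X :=
  E ∩ (ball x ((1 / 2) ^ m * (1 + (1 / 2) ^ j)) ∩ {z | j * A' < tailSum F m z})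

theorem measurableSet_levelSet {E : Set X} (hE : MeasurableSet E) {F : ℕ → X → ℝ≥0∞}
    (hF : ∀ k, Measurable (F k)) (A' : ℝ≥0∞) (x : X) (m j : ℕ) :
    MeasurableSet (levelSet E F A' x m j) :=
  hE.inter (measurableSet_ball.inter (measurableSet_lt measurable_const (measurable_tailSum hF m)))

theorem levelSet_succ_subset (E : Set X) (F : ℕ → X → ℝ≥0∞) (A' : ℝ≥0∞) (x : X) (m j : ℕ) :
    levelSet E F A' x m (j + 1) ⊆ levelSet E F A' x m j := by
  rintro z ⟨h1, h2, h3⟩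
  refine ⟨h1, ball_subset_ball ?_ h2, mem_ofPred_eq ▸ lt_of_le_of_lt ?_ (mem_ofPred_eq ▸ h3)⟩
  · gcongr (1 / 2) ^ m * (1 + ?_)
    exact pow_le_pow_of_le_one (by norm_num) (by norm_num) (Nat.le_succ j)
  · gcongr; exact Nat.le_succ j

theorem measure_levelSet_succ_le {μ : Measure X} {E : Set X} (hE : MeasurableSet E)
    (hμE : ∀ᵐ u ∂μ, u ∈ E) {F : ℕ → X → ℝ≥0∞} (hFm : ∀ k, Measurable (F k)) {b : ℝ≥0∞}
    (hF : ∀ k z, F k z ≤ b)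
    (hL : ∀ k z w, F k z ≤ F k w + b * ENNReal.ofReal (2 ^ k * dist z w)) {d m : ℕ}
    {A θ B : ℝ≥0∞}
    (hgood : ∀ u ∈ E, ∀ l, m ≤ l →
      θ * 2⁻¹ ^ (l * d) ≤ μ (ball u ((1 / 2) ^ l) ∩ {z | tailSum F l z ≤ A}))
    (hup : ∀ u ∈ E, ∀ l, m ≤ l → μ (ball u (6 * (1 / 2) ^ l)) ≤ B * 2⁻¹ ^ (l * d)) (x : X) (j : ℕ) :
    θ * μ (levelSet E F (4 * b + A) x m (j + 1)) ≤
      B * μ (levelSet E F (4 * b + A) x m j \ levelSet E F (4 * b + A) x m (j + 1)) := by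
  classical
  set A' := 4 * b + A with hA'
  have h_scale : ∀ z ∈ levelSet E F A' x m (j + 1), ∃ i, j + 1 ≤ i ∧ ∀ w, dist z w ≤ (1 / 2) ^ (m + i) →
      j * A' < tailSum F m w ∧ tailSum F m w ≤ j * A' + 4 * b + tailSum F (m + i) w := fun z hz =>
    exists_stopping_scale hF hL le_self_add hz.2.2
  choose! i hi1 hi2 using h_scale
  obtain ⟨u, hut, hdisj, hcov⟩ := Vitali.exists_disjoint_subfamily_covering_enlargement_closedBall
    (levelSet E F A' x m (j + 1)) (fun z => z) (fun z => (1 / 2 : ℝ) ^ (m + i z)) 1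
    (fun a _ => pow_le_one₀ (by norm_num) (by norm_num)) 5 (by norm_num)
  have hcount : u.Countable := by
    refine hdisj.countable_of_nonempty_interior fun a _ => ?_
    exact ⟨a, ball_subset_interior_closedBall (mem_ball_self (by positivity))⟩
  have h1 : μ (levelSet E F A' x m (j + 1)) ≤ ∑' a : u, B * 2⁻¹ ^ ((m + i a) * d) := by
    calc μ (levelSet E F A' x m (j + 1))
        ≤ μ (⋃ a ∈ u, ball a (6 * (1 / 2 : ℝ) ^ (m + i a))) := by
          refine measure_mono fun z hz => ?_
          obtain ⟨a, ha, hsub⟩ := hcov z hz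
          refine mem_biUnion ha ?_
          refine closedBall_subset_ball ?_ (hsub (mem_closedBall_self (by positivity)))
          have : (0 : ℝ) < (1 / 2) ^ (m + i a) := by positivity
          linarith
      _ ≤ ∑' a : u, μ (ball (a : X) (6 * (1 / 2 : ℝ) ^ (m + i a))) := measure_biUnion_le μ hcount _
      _ ≤ _ := ENNReal.tsum_le_tsum fun a => hup a (hut a.2).1 _ (Nat.le_add_right _ _)
  have h2 : ∑' a : u, θ * 2⁻¹ ^ ((m + i a) * d) ≤
      μ (levelSet E F A' x m j \ levelSet E F A' x m (j + 1)) := by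
    set s : X → Set X := fun a => E ∩ (ball a ((1 / 2 : ℝ) ^ (m + i a)) ∩ {z | tailSum F (m + i a) z ≤ A})
      with hs
    have hsm : ∀ a, MeasurableSet (s a) := fun a => hE.inter (measurableSet_ball.inter
      (measurableSet_le (measurable_tailSum hFm _) measurable_const))
    calc ∑' a : u, θ * 2⁻¹ ^ ((m + i a) * d) ≤ ∑' a : u, μ (s a) := by
          refine ENNReal.tsum_le_tsum fun a => ?_
          refine (hgood a (hut a.2).1 _ (Nat.le_add_right _ _)).trans (le_of_eq ?_)
          refine measure_congr ?_
          filter_upwards [hμE] with z hz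
          simp only [hs, eq_iff_iff]
          exact ⟨fun h => ⟨hz, h⟩, fun h => h.2⟩
      _ = μ (⋃ a ∈ u, s a) := by
          refine (measure_biUnion hcount ?_ fun a _ => hsm a).symm
          intro a ha c hc hac
          exact (hdisj ha hc hac).mono (fun z hz => ball_subset_closedBall hz.2.1)
            (fun z hz => ball_subset_closedBall hz.2.1)
      _ ≤ _ := by
          refine measure_mono (iUnion₂_subset fun a ha z hz => ?_)
          have hzd : dist a z ≤ (1 / 2 : ℝ) ^ (m + i a) := by
            rw [dist_comm]; exact (mem_ball.1 hz.2.1).le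
          obtain ⟨h3, h4⟩ := hi2 a (hut ha) z hzd
          refine ⟨⟨hz.1, ?_, h3⟩, fun hz' => ?_⟩
          · have h5 : dist a x < (1 / 2) ^ m * (1 + (1 / 2) ^ (j + 1)) := (hut ha).2.1
            have h6 : (1 / 2 : ℝ) ^ (m + i a) ≤ (1 / 2) ^ m * (1 / 2) ^ (j + 1) := by
              rw [pow_add]
              gcongr (1 / 2) ^ m * ?_
              exact pow_le_pow_of_le_one (by norm_num) (by norm_num) (hi1 a (hut ha))
            have h7 : (1 / 2 : ℝ) ^ m * (1 / 2) ^ j = 2 * ((1 / 2) ^ m * (1 / 2) ^ (j + 1)) := by ring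
            rw [mem_ball]
            have := dist_triangle z a x
            rw [dist_comm z a] at this
            nlinarith
          · have h8 : ((j + 1 : ℕ) : ℝ≥0∞) * A' < tailSum F m z := hz'.2.2
            refine absurd h8 (not_lt.2 (h4.trans ?_))
            push_cast
            rw [add_mul, one_mul, hA', add_assoc]
            gcongr
            exact hz.2.2
  calc θ * μ (levelSet E F A' x m (j + 1)) ≤ θ * ∑' a : u, B * 2⁻¹ ^ ((m + i a) * d) := by gcongr
    _ = B * ∑' a : u, θ * 2⁻¹ ^ ((m + i a) * d) := by
      rw [ENNReal.tsum_mul_left, ENNReal.tsum_mul_left, mul_left_comm]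
    _ ≤ _ := by gcongr

/-- If `J` is bounded on a fixed proportion of every small ball then it is integrable, with
uniform Carleson-type bounds. -/
theorem lintegral_tailSum_le_of_good {μ : Measure X} {E : Set X} (hE : MeasurableSet E)
    (hμE : ∀ᵐ u ∂μ, u ∈ E) {F : ℕ → X → ℝ≥0∞} (hFm : ∀ k, Measurable (F k)) {b : ℝ≥0∞}
    (hb0 : b ≠ 0) (hbt : b ≠ ⊤) (hF : ∀ k z, F k z ≤ b)
    (hL : ∀ k z w, F k z ≤ F k w + b * ENNReal.ofReal (2 ^ k * dist z w)) {d m : ℕ}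
    {A θ B : ℝ≥0∞} (hAt : A ≠ ⊤) (hθ0 : θ ≠ 0) (hθt : θ ≠ ⊤) (hBt : B ≠ ⊤)
    (hgood : ∀ u ∈ E, ∀ l, m ≤ l →
      θ * 2⁻¹ ^ (l * d) ≤ μ (ball u ((1 / 2) ^ l) ∩ {z | tailSum F l z ≤ A}))
    (hup : ∀ u ∈ E, ∀ l, m ≤ l → μ (ball u (6 * (1 / 2) ^ l)) ≤ B * 2⁻¹ ^ (l * d)) {x : X}
    (hx : x ∈ E) :
    ∫⁻ z in ball x ((1 / 2) ^ m), tailSum F m z ∂μ ≤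
      (4 * b + A) * ((1 - B / (θ + B))⁻¹ * B) * 2⁻¹ ^ (m * d) := by
  set A' := 4 * b + A with hA'
  have hA't : A' ≠ ⊤ := by rw [hA']; finiteness
  have hA'0 : A' ≠ 0 := by
    rw [hA']; simp [hb0]
  set Ω := levelSet E F A' x m with hΩ
  have hΩm : ∀ j, MeasurableSet (Ω j) := measurableSet_levelSet hE hFm A' x m
  have h0 : μ (Ω 0) ≤ B * 2⁻¹ ^ (m * d) := by
    refine (measure_mono ?_).trans (hup x hx m le_rfl)
    rintro z ⟨_, h, _⟩
    refine ball_subset_ball ?_ h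
    have : (0 : ℝ) < (1 / 2) ^ m := by positivity
    simp only [pow_zero]; linarith
  have hθB0 : θ + B ≠ 0 := by simp [hθ0]
  have hθBt : θ + B ≠ ⊤ := by finiteness
  have hstep : ∀ j, μ (Ω (j + 1)) ≤ B / (θ + B) * μ (Ω j) := by
    intro j
    have h1 := measure_levelSet_succ_le hE hμE hFm hF hL hgood hup x j
    rw [ENNReal.div_eq_inv_mul, mul_assoc, mul_comm, ← div_eq_mul_inv,
      ENNReal.le_div_iff_mul_le (Or.inl hθB0) (Or.inl hθBt), mul_comm, add_mul]
    calc _ ≤ B * μ (Ω j \ Ω (j + 1)) + B * μ (Ω (j + 1)) := by gcongr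
      _ = B * μ (Ω j) := by
        rw [← mul_add, add_comm, ← measure_inter_add_sdiff (Ω j) (hΩm (j + 1)),
          inter_eq_right.2 (levelSet_succ_subset E F A' x m j)]
  have hgeo : ∀ j, μ (Ω j) ≤ (B / (θ + B)) ^ j * (B * 2⁻¹ ^ (m * d)) := by
    intro j
    induction j with
    | zero => simpa using h0
    | succ j ih =>
      refine (hstep j).trans ?_
      rw [pow_succ', mul_assoc]
      gcongr
  have hpt : ∀ z ∈ E, z ∈ ball x ((1 / 2) ^ m) →
      tailSum F m z ≤ A' * ∑' j, (Ω j).indicator 1 z := by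
    intro z hzE hz
    have hmem : ∀ j : ℕ, j * A' < tailSum F m z → (Ω j).indicator (1 : X → ℝ≥0∞) z = 1 := by
      intro j hj
      have hmj : z ∈ Ω j := ⟨hzE, ball_subset_ball ?_ hz, hj⟩
      · exact indicator_of_mem hmj _
      exact le_mul_of_one_le_right (by positivity) (le_add_of_nonneg_right (by positivity))
    by_cases hex : ∃ n : ℕ, tailSum F m z ≤ n * A'
    · classical
      refine (Nat.find_spec hex).trans ?_
      rw [mul_comm]
      gcongr A' * ?_
      calc ((Nat.find hex : ℕ) : ℝ≥0∞) = ∑ j ∈ Finset.range (Nat.find hex), (Ω j).indicator 1 z := by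
            rw [Finset.sum_congr rfl fun j hj => hmem j
              (not_le.1 (Nat.find_min hex (Finset.mem_range.1 hj)))]
            simp
        _ ≤ _ := ENNReal.sum_le_tsum _
    · push Not at hex
      rw [tsum_congr fun j => hmem j (hex j)]
      rw [ENNReal.tsum_const_eq_top_of_ne_zero one_ne_zero, ENNReal.mul_top hA'0]
      exact le_top
  calc ∫⁻ z in ball x ((1 / 2) ^ m), tailSum F m z ∂μ
      ≤ ∫⁻ z in ball x ((1 / 2) ^ m), A' * ∑' j, (Ω j).indicator 1 z ∂μ := by
        refine lintegral_mono_ae ?_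
        filter_upwards [ae_restrict_of_ae hμE, ae_restrict_mem measurableSet_ball] with z h1 h2
        exact hpt z h1 h2
    _ ≤ ∫⁻ z, A' * ∑' j, (Ω j).indicator 1 z ∂μ := setLIntegral_le_lintegral _ _
    _ = A' * ∑' j, μ (Ω j) := by
        rw [lintegral_const_mul' _ _ hA't, lintegral_tsum fun j =>
          (measurable_one.indicator (hΩm j)).aemeasurable]
        simp_rw [lintegral_indicator_one (hΩm _)]
    _ ≤ A' * ∑' j : ℕ, (B / (θ + B)) ^ j * (B * 2⁻¹ ^ (m * d)) := by
        gcongr with j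
        exact hgeo j
    _ = _ := by rw [ENNReal.tsum_mul_right, ENNReal.tsum_geometric]; ring

end JohnNirenbergIntegral

section Projection

variable {n d : ℕ}

/-- Orthogonal projection onto the range of the isometric embedding `ι`, read in `ℝᵈ`. -/
def hProj (ι : V d →ₗᵢ[ℝ] V n) : V n →L[ℝ] V d :=
  ContinuousLinearMap.adjoint ι.toContinuousLinearMap

/-- Orthogonal projection onto the complement of the range of `ι`. -/
def vProj (ι : V d →ₗᵢ[ℝ] V n) : V n →L[ℝ] V n :=
  ContinuousLinearMap.id ℝ (V n) - ι.toContinuousLinearMap.comp (hProj ι)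

theorem vProj_apply (ι : V d →ₗᵢ[ℝ] V n) (v : V n) : vProj ι v = v - ι (hProj ι v) := rfl

theorem hProj_embed (ι : V d →ₗᵢ[ℝ] V n) (p : V d) : hProj ι (ι p) = p := by
  refine ext_inner_right ℝ fun w => ?_
  rw [hProj, ContinuousLinearMap.adjoint_inner_left]
  exact ι.inner_map_map p w

theorem vProj_embed (ι : V d →ₗᵢ[ℝ] V n) (p : V d) : vProj ι (ι p) = 0 := by
  rw [vProj_apply, hProj_embed, sub_self]

theorem hProj_vProj (ι : V d →ₗᵢ[ℝ] V n) (v : V n) : hProj ι (vProj ι v) = 0 := by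
  rw [vProj_apply, map_sub, hProj_embed, sub_self]

theorem norm_sq_eq_hProj_add_vProj (ι : V d →ₗᵢ[ℝ] V n) (v : V n) :
    ‖v‖ ^ 2 = ‖hProj ι v‖ ^ 2 + ‖vProj ι v‖ ^ 2 := by
  have h0 : inner ℝ (ι (hProj ι v)) (vProj ι v) = 0 := by
    have : inner ℝ (hProj ι v) (hProj ι (vProj ι v)) = inner ℝ (ι (hProj ι v)) (vProj ι v) := by
      conv_lhs => rw [hProj]
      exact ContinuousLinearMap.adjoint_inner_right _ _ _
    rw [← this, hProj_vProj, inner_zero_right]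
  have h1 : v = ι (hProj ι v) + vProj ι v := by rw [vProj_apply]; abel
  conv_lhs => rw [h1]
  have := norm_add_sq_eq_norm_sq_add_norm_sq_of_inner_eq_zero _ _ h0
  rw [← sq, ← sq, ← sq, ι.norm_map] at this
  exact this

theorem norm_hProj_le (ι : V d →ₗᵢ[ℝ] V n) (v : V n) : ‖hProj ι v‖ ≤ ‖v‖ := by
  have := norm_sq_eq_hProj_add_vProj ι v
  exact abs_le_of_sq_le_sq' (by nlinarith [sq_nonneg ‖vProj ι v‖]) (norm_nonneg _) |>.2

theorem norm_vProj_le (ι : V d →ₗᵢ[ℝ] V n) (v : V n) : ‖vProj ι v‖ ≤ ‖v‖ := by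
  have := norm_sq_eq_hProj_add_vProj ι v
  exact abs_le_of_sq_le_sq' (by nlinarith [sq_nonneg ‖hProj ι v‖]) (norm_nonneg _) |>.2

theorem norm_le_hProj_add_vProj (ι : V d →ₗᵢ[ℝ] V n) (v : V n) :
    ‖v‖ ≤ ‖hProj ι v‖ + ‖vProj ι v‖ := by
  have := norm_sq_eq_hProj_add_vProj ι v
  refine abs_le_of_sq_le_sq' ?_ (by positivity) |>.2
  nlinarith [norm_nonneg (hProj ι v), norm_nonneg (vProj ι v)]

theorem norm_vProj_le_of_norm_le {ι : V d →ₗᵢ[ℝ] V n} {v : V n} {δ : ℝ} (hδ : δ ≤ 1 / 2)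
    (hδ0 : 0 ≤ δ) (h : ‖vProj ι v‖ ≤ δ * ‖v‖) : ‖vProj ι v‖ ≤ 2 * δ * ‖hProj ι v‖ := by
  have := norm_le_hProj_add_vProj ι v
  nlinarith [norm_nonneg (hProj ι v), norm_nonneg (vProj ι v), norm_nonneg v]

theorem norm_le_two_mul_norm_hProj {ι : V d →ₗᵢ[ℝ] V n} {v : V n} {δ : ℝ} (hδ : δ ≤ 1 / 2)
    (h : ‖vProj ι v‖ ≤ δ * ‖v‖) : ‖v‖ ≤ 2 * ‖hProj ι v‖ := by
  have := norm_le_hProj_add_vProj ι v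
  nlinarith [norm_nonneg (hProj ι v), norm_nonneg (vProj ι v), norm_nonneg v]

/-- A `d`-dimensional subspace with small slope projects onto `ℝᵈ`. -/
theorem exists_mem_hProj_eq {ι : V d →ₗᵢ[ℝ] V n} {D : Submodule ℝ (V n)}
    (hD : Module.finrank ℝ D = d) {δ : ℝ} (hδ : δ ≤ 1 / 2)
    (htilt : ∀ q ∈ D, ‖vProj ι q‖ ≤ δ * ‖q‖) (p : V d) :
    ∃ q ∈ D, hProj ι q = p ∧ ‖q‖ ≤ 2 * ‖p‖ := by
  set T : D →ₗ[ℝ] V d := (hProj ι).toLinearMap.comp D.subtype with hT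
  have hinj : Function.Injective T := by
    rw [← LinearMap.ker_eq_bot, LinearMap.ker_eq_bot']
    intro q hq
    have h1 := norm_le_two_mul_norm_hProj hδ (htilt q q.2)
    have h2 : hProj ι (q : V n) = 0 := hq
    rw [h2, norm_zero, mul_zero] at h1
    exact Subtype.ext (norm_le_zero_iff.1 h1)
  have hsurj : Function.Surjective T :=
    (LinearMap.injective_iff_surjective_of_finrank_eq_finrank (by rw [hD]; simp)).1 hinj
  obtain ⟨q, hq⟩ := hsurj p
  have hq' : hProj ι (q : V n) = p := hq
  exact ⟨q, q.2, hq', hq' ▸ norm_le_two_mul_norm_hProj hδ (htilt q q.2)⟩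

/-- Two-sided flatness of `E` with unnormalized constants. -/
def IsFlat (n d : ℕ) (ε : ℝ) (E : Set (V n)) : Prop :=
  ∀ x ∈ E, ∀ t : ℝ, 0 < t → t ≤ 1 → ∃ D : Submodule ℝ (V n), Module.finrank ℝ D = d ∧
    (∀ y ∈ E, ‖y - x‖ < t → ∃ q ∈ D, ‖y - x - q‖ ≤ ε * t) ∧
    (∀ q ∈ D, ‖q‖ < t → ∃ y ∈ E, ‖y - (x + q)‖ ≤ ε * t)

/-- If chords of length comparable to `t` have small slope, so does the approximating plane. -/
theorem norm_vProj_le_of_chords {ι : V d →ₗᵢ[ℝ] V n} {D : Submodule ℝ (V n)} {E : Set (V n)}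
    {x : V n} {t ε : ℝ} (ht : 0 < t) (hε : ε ≤ 1 / 100)
    (hD : ∀ q ∈ D, ‖q‖ < t → ∃ y ∈ E, ‖y - (x + q)‖ ≤ ε * t)
    (hE : ∀ y ∈ E, t / 4 ≤ ‖y - x‖ → ‖y - x‖ < t → ‖vProj ι (y - x)‖ ≤ 1 / 10 * ‖y - x‖) :
    ∀ q ∈ D, ‖vProj ι q‖ ≤ 1 / 5 * ‖q‖ := by
  intro q hq
  rcases eq_or_ne q 0 with rfl | hq0
  · simp
  have hqn : 0 < ‖q‖ := norm_pos_iff.2 hq0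
  set c := t / 2 / ‖q‖ with hc
  have hc0 : 0 < c := by positivity
  have hcq : ‖c • q‖ = t / 2 := by
    rw [norm_smul, Real.norm_of_nonneg hc0.le, hc]; field_simp
  obtain ⟨y, hy, hyq⟩ := hD (c • q) (D.smul_mem c hq) (by rw [hcq]; linarith)
  have hdiff : y - (x + c • q) = (y - x) - c • q := by abel
  rw [hdiff] at hyq
  have h1 : ‖y - x‖ ≤ t / 2 + ε * t := by
    have := norm_le_norm_add_norm_sub' (y - x) (c • q)
    linarith
  have h2 : t / 2 - ε * t ≤ ‖y - x‖ := by
    have := norm_le_norm_add_norm_sub' (c • q) (y - x)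
    rw [norm_sub_rev (c • q)] at this
    linarith
  have h3 := hE y hy (by nlinarith) (by nlinarith)
  have h4 : ‖vProj ι (c • q)‖ ≤ ‖vProj ι (y - x)‖ + ε * t := by
    have h5 := norm_le_norm_add_norm_sub' (vProj ι (c • q)) (vProj ι (y - x))
    rw [← map_sub] at h5
    have h6 := norm_vProj_le ι (c • q - (y - x))
    rw [norm_sub_rev] at h6
    linarith
  have h7 : ‖vProj ι (c • q)‖ ≤ 1 / 5 * (t / 2) := by nlinarith
  rw [← hcq, map_smul, norm_smul, norm_smul, Real.norm_of_nonneg hc0.le] at h7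
  have : c * ‖vProj ι q‖ ≤ c * (1 / 5 * ‖q‖) := by linarith
  exact le_of_mul_le_mul_left this hc0

end Projection

section Gap

variable {n d : ℕ}

/-- A chord of `E` near `x₀` of slope more than `1 / 10`. -/
structure IsBadPair (ι : V d →ₗᵢ[ℝ] V n) (E : Set (V n)) (x₀ : V n) (R : ℝ) (a b : V n) : Prop where
  left_mem : a ∈ E
  right_mem : b ∈ E
  left_lt : ‖a - x₀‖ < 10 * R
  right_lt : ‖b - x₀‖ < 10 * R
  steep : 1 / 10 * ‖a - b‖ < ‖vProj ι (a - b)‖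

theorem IsBadPair.symm {ι : V d →ₗᵢ[ℝ] V n} {E : Set (V n)} {x₀ : V n} {R : ℝ} {a b : V n}
    (h : IsBadPair ι E x₀ R a b) : IsBadPair ι E x₀ R b a := by
  refine ⟨h.right_mem, h.left_mem, h.right_lt, h.left_lt, ?_⟩
  have := h.steep
  rwa [← neg_sub b a, map_neg, norm_neg, norm_neg] at this

theorem IsBadPair.norm_pos {ι : V d →ₗᵢ[ℝ] V n} {E : Set (V n)} {x₀ : V n} {R : ℝ} {a b : V n}
    (h : IsBadPair ι E x₀ R a b) : 0 < ‖a - b‖ := by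
  have h1 := h.steep
  have h2 := norm_vProj_le ι (a - b)
  by_contra h0
  have h3 : ‖a - b‖ = 0 := le_antisymm (not_lt.1 h0) (norm_nonneg _)
  rw [h3] at h1 h2
  linarith

/-- The scale at which `E` stops being a Lipschitz graph over the point `p`. -/
def gap (ι : V d →ₗᵢ[ℝ] V n) (E : Set (V n)) (x₀ : V n) (R : ℝ) (p : V d) : ℝ :=
  sSup (insert 0 {t | ∃ a b, IsBadPair ι E x₀ R a b ∧ t = ‖a - b‖ - ‖p - hProj ι (a - x₀)‖})

variable {ι : V d →ₗᵢ[ℝ] V n} {E : Set (V n)} {x₀ : V n} {R : ℝ}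

theorem bddAbove_gap (p : V d) : BddAbove
    (insert 0 {t | ∃ a b, IsBadPair ι E x₀ R a b ∧ t = ‖a - b‖ - ‖p - hProj ι (a - x₀)‖}) := by
  refine ⟨max 0 (20 * R), ?_⟩
  rintro t (rfl | ⟨a, b, h, rfl⟩)
  · exact le_max_left _ _
  · refine le_trans ?_ (le_max_right _ _)
    have h1 := norm_sub_le_norm_sub_add_norm_sub a x₀ b
    rw [norm_sub_rev x₀ b] at h1
    linarith [h.left_lt, h.right_lt, norm_nonneg (p - hProj ι (a - x₀))]

theorem gap_nonneg (p : V d) : 0 ≤ gap ι E x₀ R p :=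
  le_csSup (bddAbove_gap p) (mem_insert _ _)

theorem IsBadPair.le_gap {a b : V n} (h : IsBadPair ι E x₀ R a b) (p : V d) :
    ‖a - b‖ - ‖p - hProj ι (a - x₀)‖ ≤ gap ι E x₀ R p :=
  le_csSup (bddAbove_gap p) (mem_insert_of_mem _ ⟨a, b, h, rfl⟩)

theorem exists_isBadPair_of_lt_gap {p : V d} {t : ℝ} (ht : 0 ≤ t) (h : t < gap ι E x₀ R p) :
    ∃ a b, IsBadPair ι E x₀ R a b ∧ t < ‖a - b‖ - ‖p - hProj ι (a - x₀)‖ := by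
  obtain ⟨s, hs, hts⟩ := exists_lt_of_lt_csSup (insert_nonempty _ _) h
  rcases hs with rfl | ⟨a, b, hab, rfl⟩
  · exact absurd hts (not_lt.2 ht)
  · exact ⟨a, b, hab, hts⟩

theorem gap_le {p : V d} {t : ℝ} (ht : 0 ≤ t)
    (h : ∀ a b, IsBadPair ι E x₀ R a b → ‖a - b‖ - ‖p - hProj ι (a - x₀)‖ ≤ t) :
    gap ι E x₀ R p ≤ t := by
  refine csSup_le (insert_nonempty _ _) ?_
  rintro s (rfl | ⟨a, b, hab, rfl⟩)
  · exact ht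
  · exact h a b hab

theorem gap_le_add (p p' : V d) : gap ι E x₀ R p ≤ gap ι E x₀ R p' + ‖p - p'‖ := by
  refine gap_le (add_nonneg (gap_nonneg p') (norm_nonneg _)) fun a b hab => ?_
  have h1 := hab.le_gap p'
  have h2 := norm_sub_le_norm_sub_add_norm_sub p' p (hProj ι (a - x₀))
  rw [norm_sub_rev p' p] at h2
  linarith

theorem continuous_gap : Continuous (gap ι E x₀ R) := by
  refine (LipschitzWith.of_le_add fun p p' => ?_).continuous
  rw [dist_eq_norm]
  exact gap_le_add p p'

/-- The isometric embedding `ι` parametrizes an approximating plane of `E` at `x₀`. -/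
structure IsFrame (ι : V d →ₗᵢ[ℝ] V n) (E : Set (V n)) (ε : ℝ) (x₀ : V n) (R : ℝ) : Prop where
  mem : x₀ ∈ E
  pos : 0 < R
  le_one : 64 * R ≤ 1
  vProj_le : ∀ y ∈ E, ‖y - x₀‖ < 64 * R → ‖vProj ι (y - x₀)‖ ≤ 64 * ε * R
  exists_near : ∀ p : V d, ‖p‖ < 64 * R → ∃ y ∈ E, ‖y - (x₀ + ι p)‖ ≤ 64 * ε * R

theorem IsFlat.exists_isFrame {ε : ℝ} (hE : IsFlat n d ε E) (hx₀ : x₀ ∈ E) (hR : 0 < R)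
    (hR1 : 64 * R ≤ 1) : ∃ ι : V d →ₗᵢ[ℝ] V n, IsFrame ι E ε x₀ R := by
  obtain ⟨D, hD, h1, h2⟩ := hE x₀ hx₀ (64 * R) (by positivity) hR1
  set e := ((stdOrthonormalBasis ℝ D).reindex (finCongr hD)).repr.symm with he
  set ι : V d →ₗᵢ[ℝ] V n := D.subtypeₗᵢ.comp e.toLinearIsometry with hι
  have hmem : ∀ p, ι p ∈ D := fun p => (e p).2
  have hrange : ∀ q ∈ D, ∃ p, ι p = q := fun q hq =>
    ⟨e.symm ⟨q, hq⟩, by simp [hι]⟩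
  refine ⟨ι, hx₀, hR, hR1, ?_, ?_⟩
  · intro y hy hyx
    obtain ⟨q, hq, hyq⟩ := h1 y hy hyx
    obtain ⟨p, rfl⟩ := hrange q hq
    have : vProj ι (y - x₀) = vProj ι (y - x₀ - ι p) := by
      rw [map_sub _ (y - x₀) (ι p), vProj_embed, sub_zero]
    rw [this]
    refine (norm_vProj_le ι _).trans (hyq.trans (le_of_eq (by ring)))
  · intro p hp
    obtain ⟨y, hy, hyq⟩ := h2 (ι p) (hmem p) (by rwa [ι.norm_map])
    exact ⟨y, hy, hyq.trans (le_of_eq (by ring))⟩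

theorem IsFrame.norm_sub_le {ε : ℝ} (h : IsFrame ι E ε x₀ R) {a b : V n}
    (hab : IsBadPair ι E x₀ R a b) : ‖a - b‖ ≤ 1280 * ε * R := by
  have hR := h.pos
  have h1 := h.vProj_le a hab.left_mem (by linarith [hab.left_lt])
  have h2 := h.vProj_le b hab.right_mem (by linarith [hab.right_lt])
  have h3 : vProj ι (a - b) = vProj ι (a - x₀) - vProj ι (b - x₀) := by
    rw [← map_sub]; congr 1; abel
  have h4 := hab.steep
  rw [h3] at h4
  have := _root_.norm_sub_le (vProj ι (a - x₀)) (vProj ι (b - x₀))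
  linarith

theorem IsFrame.gap_le {ε : ℝ} (hε : 0 ≤ ε) (h : IsFrame ι E ε x₀ R) (p : V d) :
    gap ι E x₀ R p ≤ 1280 * ε * R := by
  have := h.pos
  refine _root_.gap_le (by positivity) fun a b hab => ?_
  linarith [h.norm_sub_le hab, norm_nonneg (p - hProj ι (a - x₀))]

/-- Over every point `p` the set `E` passes at a distance small compared with any scale above
`gap p`. -/
theorem exists_near_of_gap_le {ε c : ℝ} (hE : IsFlat n d ε E) (h : IsFrame ι E ε x₀ R)
    (hε0 : 0 ≤ ε) (hc : c ≤ 1 / 16) (hεc : 64 * ε ≤ c / 2) {p : V d} (hp : ‖p‖ ≤ R)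
    (i : ℕ) (hi : gap ι E x₀ R p ≤ (1 / 2) ^ i * R) :
    ∃ y ∈ E, ‖hProj ι (y - x₀) - p‖ ≤ c * ((1 / 2) ^ i * R) ∧ ‖y - x₀‖ ≤ ‖p‖ + 2 * c * R := by
  have hR := h.pos
  have hR1 := h.le_one
  have hc0 : 0 ≤ c := by linarith
  induction i with
  | zero =>
    obtain ⟨y, hy, hyp⟩ := h.exists_near p (by linarith)
    have e1 : y - x₀ = (y - (x₀ + ι p)) + ι p := by abel
    refine ⟨y, hy, ?_, ?_⟩
    · rw [e1, map_add, hProj_embed, add_sub_cancel_right, pow_zero, one_mul]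
      refine (norm_hProj_le ι _).trans (hyp.trans ?_)
      gcongr; linarith
    · rw [e1]
      refine (norm_add_le _ _).trans ?_
      rw [ι.norm_map]
      nlinarith
  | succ i ih =>
    set t := (1 / 2 : ℝ) ^ i * R with ht
    have ht' : (1 / 2 : ℝ) ^ (i + 1) * R = t / 2 := by rw [ht, pow_succ]; ring
    rw [ht'] at hi ⊢
    have ht0 : 0 < t := by positivity
    have htR : t ≤ R := mul_le_of_le_one_left hR.le (pow_le_one₀ (by norm_num) (by norm_num))
    obtain ⟨y, hy, hyp, hyx⟩ := ih (by linarith)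
    have hyx2 : ‖y - x₀‖ ≤ 2 * R := by nlinarith
    obtain ⟨D, hD, -, hD2⟩ := hE y hy (4 * t) (by positivity) (by linarith)
    have htilt := norm_vProj_le_of_chords (ι := ι) (by positivity : 0 < 4 * t) (by linarith) hD2 (by
      intro v hv hv1 hv2
      by_contra hcon
      have hvx : ‖v - x₀‖ ≤ 6 * R := by
        have := norm_sub_le_norm_sub_add_norm_sub v y x₀
        linarith
      have hbad : IsBadPair ι E x₀ R v y :=
        ⟨hv, hy, by linarith, by linarith, not_le.1 hcon⟩
      have h5 := hbad.symm.le_gap p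
      rw [norm_sub_rev p, norm_sub_rev y v] at h5
      nlinarith)
    obtain ⟨q, hq, hqp, hqn⟩ := exists_mem_hProj_eq hD (by norm_num) htilt (p - hProj ι (y - x₀))
    rw [norm_sub_rev] at hqn
    obtain ⟨y', hy', hyy⟩ := hD2 q hq (by nlinarith)
    have e1 : y' - x₀ = (y' - (y + q)) + (y - x₀) + q := by abel
    have h6 : ‖hProj ι (y' - x₀) - p‖ ≤ c * (t / 2) := by
      have : hProj ι (y' - x₀) - p = hProj ι (y' - (y + q)) := by
        rw [e1, map_add, map_add, hqp]; abel
      rw [this]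
      refine (norm_hProj_le ι _).trans (hyy.trans ?_)
      nlinarith
    refine ⟨y', hy', h6, ?_⟩
    have h7 : ‖y' - x₀‖ ≤ 4 * R := by
      rw [e1]
      have := norm_add₃_le (a := y' - (y + q)) (b := y - x₀) (c := q)
      nlinarith
    have h8 := h.vProj_le y' hy' (by linarith)
    have h9 := norm_le_hProj_add_vProj ι (y' - x₀)
    have h10 := norm_le_norm_add_norm_sub p (hProj ι (y' - x₀))
    have h11 := norm_le_norm_add_norm_sub' (hProj ι (y' - x₀)) p
    nlinarith

theorem exists_near_of_gap_pos {ε c : ℝ} (hE : IsFlat n d ε E) (h : IsFrame ι E ε x₀ R)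
    (hε0 : 0 ≤ ε) (hc : c ≤ 1 / 16) (hεc : 64 * ε ≤ c / 2) {p : V d} (hp : ‖p‖ ≤ R)
    (hg : 0 < gap ι E x₀ R p) :
    ∃ y ∈ E, ‖hProj ι (y - x₀) - p‖ ≤ 2 * c * gap ι E x₀ R p ∧ ‖y - x₀‖ ≤ ‖p‖ + 2 * c * R := by
  have hR := h.pos
  have hgR : gap ι E x₀ R p ≤ R := by
    refine (h.gap_le hε0 p).trans ?_
    nlinarith
  obtain ⟨i, hi1, hi2⟩ := exists_nat_pow_near_of_lt_one (x := gap ι E x₀ R p / R) (y := 1 / 2)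
    (by positivity) ((div_le_one hR).2 hgR) (by norm_num) (by norm_num)
  rw [lt_div_iff₀ hR] at hi1
  rw [div_le_iff₀ hR] at hi2
  obtain ⟨y, hy, h1, h2⟩ := exists_near_of_gap_le hE h hε0 hc hεc hp i hi2
  refine ⟨y, hy, h1.trans ?_, h2⟩
  have : (1 / 2 : ℝ) ^ i * R = 2 * ((1 / 2) ^ (i + 1) * R) := by rw [pow_succ]; ring
  rw [this]
  have hc0 : 0 ≤ c := by linarith
  nlinarith

theorem exists_over_of_gap_eq_zero {ε c : ℝ} (hE : IsFlat n d ε E) (hEc : IsClosed E)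
    (h : IsFrame ι E ε x₀ R)
    (hε0 : 0 ≤ ε) (hc : c ≤ 1 / 16) (hεc : 64 * ε ≤ c / 2) {p : V d} (hp : ‖p‖ ≤ R)
    (hg : gap ι E x₀ R p = 0) :
    ∃ y ∈ E, hProj ι (y - x₀) = p ∧ ‖y - x₀‖ ≤ ‖p‖ + 2 * c * R := by
  have hR := h.pos
  choose y hy h1 h2 using fun i : ℕ => exists_near_of_gap_le hE h hε0 hc hεc hp i
    (by rw [hg]; positivity)
  have hcomp : IsCompact (E ∩ closedBall x₀ (‖p‖ + 2 * c * R)) :=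
    (isCompact_closedBall _ _).inter_left hEc
  obtain ⟨z, hz, φ, hφ, hlim⟩ := hcomp.tendsto_subseq (x := y) fun i =>
    ⟨hy i, by rw [mem_closedBall, dist_eq_norm]; exact h2 i⟩
  refine ⟨z, hz.1, ?_, by rw [← dist_eq_norm]; exact hz.2⟩
  have l1 : Filter.Tendsto (fun i => hProj ι (y (φ i) - x₀)) Filter.atTop (nhds (hProj ι (z - x₀))) :=
    ((hProj ι).continuous.tendsto _).comp (hlim.sub_const x₀)
  have l2 : Filter.Tendsto (fun i => hProj ι (y (φ i) - x₀)) Filter.atTop (nhds p) := by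
    rw [tendsto_iff_norm_sub_tendsto_zero]
    refine squeeze_zero (fun _ => norm_nonneg _) (fun i => h1 (φ i)) ?_
    have : Filter.Tendsto (fun i : ℕ => c * ((1 / 2 : ℝ) ^ i * R)) Filter.atTop (nhds (c * (0 * R))) :=
      ((tendsto_pow_atTop_nhds_zero_of_lt_one (by norm_num) (by norm_num)).mul_const R).const_mul c
    rw [zero_mul, mul_zero] at this
    exact this.comp hφ.tendsto_atTop
  exact tendsto_nhds_unique l1 l2

end Gap

section Core

variable {n d : ℕ} {ι : V d →ₗᵢ[ℝ] V n} {E : Set (V n)} {x₀ : V n} {R : ℝ}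

/-- Points over which a steep chord occurs precisely at the scale `gap`. -/
def coreSet (ι : V d →ₗᵢ[ℝ] V n) (E : Set (V n)) (x₀ : V n) (R κ : ℝ) : Set (V d) :=
  {p | ∃ a b, IsBadPair ι E x₀ R a b ∧ ‖p - hProj ι (a - x₀)‖ < κ * ‖a - b‖ ∧
    gap ι E x₀ R (hProj ι (a - x₀)) ≤ 2 * ‖a - b‖}

theorem isOpen_coreSet (κ : ℝ) : IsOpen (coreSet ι E x₀ R κ) := by
  have : coreSet ι E x₀ R κ = ⋃ a, ⋃ b, ⋃ (_ : IsBadPair ι E x₀ R a b ∧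
      gap ι E x₀ R (hProj ι (a - x₀)) ≤ 2 * ‖a - b‖), ball (hProj ι (a - x₀)) (κ * ‖a - b‖) := by
    ext p
    simp only [coreSet, mem_ofPred_eq, mem_iUnion, mem_ball, dist_eq_norm, exists_prop]
    constructor
    · rintro ⟨a, b, h1, h2, h3⟩; exact ⟨a, b, ⟨h1, h3⟩, h2⟩
    · rintro ⟨a, b, ⟨h1, h3⟩, h2⟩; exact ⟨a, b, h1, h2, h3⟩
  rw [this]
  exact isOpen_iUnion fun a => isOpen_iUnion fun b => isOpen_iUnion fun _ => isOpen_ball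

theorem exists_core_pair {p : V d} (hp : 0 < gap ι E x₀ R p) :
    ∃ a b, IsBadPair ι E x₀ R a b ∧ ‖p - hProj ι (a - x₀)‖ ≤ 8 * ‖a - b‖ ∧
      gap ι E x₀ R (hProj ι (a - x₀)) ≤ 2 * ‖a - b‖ := by
  set S : Set ℝ := {L | ∃ a b, IsBadPair ι E x₀ R a b ∧ ‖p - hProj ι (a - x₀)‖ ≤ 8 * ‖a - b‖ ∧
    L = ‖a - b‖} with hS
  obtain ⟨a₀, b₀, hab₀, h0⟩ := exists_isBadPair_of_lt_gap le_rfl hp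
  have hpos := hab₀.norm_pos
  have hmem₀ : ‖a₀ - b₀‖ ∈ S := ⟨a₀, b₀, hab₀, by linarith, rfl⟩
  have hbdd : BddAbove S := by
    refine ⟨20 * R, ?_⟩
    rintro L ⟨a, b, h, -, rfl⟩
    have h1 := norm_sub_le_norm_sub_add_norm_sub a x₀ b
    rw [norm_sub_rev x₀ b] at h1
    linarith [h.left_lt, h.right_lt]
  have hsup : 0 < sSup S := hpos.trans_le (le_csSup hbdd hmem₀)
  obtain ⟨L, ⟨a, b, hab, hpa, rfl⟩, hL⟩ := exists_lt_of_lt_csSup ⟨_, hmem₀⟩ (half_lt_self hsup)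
  refine ⟨a, b, hab, hpa, ?_⟩
  refine gap_le (by positivity) fun a' b' hab' => ?_
  by_contra hcon
  push Not at hcon
  have h1 := norm_nonneg (hProj ι (a - x₀) - hProj ι (a' - x₀))
  have h2 := norm_sub_le_norm_sub_add_norm_sub p (hProj ι (a - x₀)) (hProj ι (a' - x₀))
  have h3 : ‖a' - b'‖ ∈ S := ⟨a', b', hab', by linarith [norm_nonneg (a - b)], rfl⟩
  have h4 := le_csSup hbdd h3
  linarith

/-- The core occupies a fixed proportion of the set where `gap` is positive. -/
theorem measure_gap_pos_le (lam : Measure (V d)) [lam.IsAddHaarMeasure] {ε ρ₁ ρ₂ : ℝ}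
    (h : IsFrame ι E ε x₀ R) (hρ : ρ₁ + 10 * (1280 * ε * R) ≤ ρ₂) :
    lam (ball 0 ρ₁ ∩ {p | 0 < gap ι E x₀ R p}) ≤
      ENNReal.ofReal (160 ^ d) * lam (ball 0 ρ₂ ∩ coreSet ι E x₀ R (1 / 4)) := by
  classical
  set P := ball (0 : V d) ρ₁ ∩ {p | 0 < gap ι E x₀ R p} with hP
  choose! a b hab hpa hga using fun p (hp : p ∈ P) => exists_core_pair hp.2
  obtain ⟨u, hut, hdisj, hcov⟩ := Vitali.exists_disjoint_subfamily_covering_enlargement_closedBall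
    P (fun p => hProj ι (a p - x₀)) (fun p => 8 * ‖a p - b p‖) (8 * (1280 * ε * R))
    (fun p hp => by have := h.norm_sub_le (hab p hp); linarith) 5 (by norm_num)
  have hposu : ∀ p ∈ P, 0 < ‖a p - b p‖ := fun p hp => (hab p hp).norm_pos
  have hcount : u.Countable := by
    refine hdisj.countable_of_nonempty_interior fun p hp => ?_
    exact ⟨_, ball_subset_interior_closedBall (mem_ball_self (by
      have := hposu p (hut hp); positivity))⟩
  have hscale : ∀ p ∈ P, lam (closedBall (hProj ι (a p - x₀)) (5 * (8 * ‖a p - b p‖))) =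
      ENNReal.ofReal (160 ^ d) * lam (ball (hProj ι (a p - x₀)) (‖a p - b p‖ / 4)) := by
    intro p hp
    have := hposu p hp
    rw [Measure.addHaar_closedBall lam _ (by positivity : 0 ≤ 5 * (8 * ‖a p - b p‖)),
      Measure.addHaar_ball_of_pos lam _ (by positivity : 0 < ‖a p - b p‖ / 4),
      ← mul_assoc (ENNReal.ofReal _) (ENNReal.ofReal _), ← ENNReal.ofReal_mul (by positivity)]
    congr 2
    simp only [finrank_euclideanSpace, Fintype.card_fin]
    rw [← mul_pow]; congr 1; ring
  calc lam P ≤ lam (⋃ p ∈ u, closedBall (hProj ι (a p - x₀)) (5 * (8 * ‖a p - b p‖))) := by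
        refine measure_mono fun p hp => ?_
        obtain ⟨p', hp', hsub⟩ := hcov p hp
        refine mem_biUnion hp' (hsub ?_)
        rw [mem_closedBall, dist_eq_norm]
        exact hpa p hp
    _ ≤ ∑' p : u, lam (closedBall (hProj ι (a p - x₀)) (5 * (8 * ‖a p - b p‖))) :=
        measure_biUnion_le lam hcount _
    _ = ENNReal.ofReal (160 ^ d) * ∑' p : u, lam (ball (hProj ι (a p - x₀)) (‖a p - b p‖ / 4)) := by
        rw [← ENNReal.tsum_mul_left]
        exact tsum_congr fun p => hscale p (hut p.2)
    _ = ENNReal.ofReal (160 ^ d) *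
          lam (⋃ p ∈ u, ball (hProj ι (a p - x₀)) (‖a p - b p‖ / 4)) := by
        rw [measure_biUnion hcount ?_ fun p _ => measurableSet_ball]
        intro p hp p' hp' hne
        refine (hdisj hp hp' hne).mono ?_ ?_
        · refine ball_subset_closedBall.trans (closedBall_subset_closedBall ?_)
          linarith [norm_nonneg (a p - b p)]
        · refine ball_subset_closedBall.trans (closedBall_subset_closedBall ?_)
          linarith [norm_nonneg (a p' - b p')]
    _ ≤ _ := by
        gcongr ENNReal.ofReal (160 ^ d) * ?_
        refine measure_mono (iUnion₂_subset fun p hp z hz => ?_)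
        rw [mem_ball, dist_eq_norm] at hz
        refine ⟨?_, a p, b p, hab p (hut hp), by linarith, hga p (hut hp)⟩
        rw [mem_ball_zero_iff]
        have h1 : ‖p‖ < ρ₁ := mem_ball_zero_iff.1 (hut hp).1
        have h2 := hpa p (hut hp)
        have h3 := h.norm_sub_le (hab p (hut hp))
        have h4 := norm_le_norm_add_norm_sub' z p
        have h5 := norm_sub_le_norm_sub_add_norm_sub z (hProj ι (a p - x₀)) p
        rw [norm_sub_rev (hProj ι (a p - x₀)) p] at h5
        have h6 := norm_nonneg (a p - b p)
        linarith

end Core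

section Hole

variable {n d : ℕ} {ι : V d →ₗᵢ[ℝ] V n} {E : Set (V n)} {x₀ : V n} {R : ℝ}

/-- Chords from `w` longer than `gap` have small slope. -/
theorem norm_vProj_le_of_gap_lt {w v : V n} (hw : w ∈ E) (hv : v ∈ E) (hwx : ‖w - x₀‖ < 10 * R)
    (hvx : ‖v - x₀‖ < 10 * R) (h : gap ι E x₀ R (hProj ι (w - x₀)) < ‖v - w‖) :
    ‖vProj ι (v - w)‖ ≤ 1 / 10 * ‖v - w‖ := by
  by_contra hcon
  have hbad : IsBadPair ι E x₀ R v w := ⟨hv, hw, hvx, hwx, not_le.1 hcon⟩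
  have := hbad.symm.le_gap (hProj ι (w - x₀))
  rw [sub_self, norm_zero, norm_sub_rev] at this
  linarith

/-- Over a core point the approximating plane is tilted by a definite amount. -/
theorem exists_tilted_direction {ε : ℝ} (hE : IsFlat n d ε E) (h : IsFrame ι E ε x₀ R)
    (hε0 : 0 ≤ ε) (hε : ε ≤ 1 / 100000) {w : V n} (hw : w ∈ E) (hwx : ‖w - x₀‖ < R)
    (hcore : hProj ι (w - x₀) ∈ coreSet ι E x₀ R (1 / 2)) :
    ∃ (D : Submodule ℝ (V n)) (u : V n), u ∈ D ∧ ‖hProj ι u‖ = 1 ∧ 1 / 20 ≤ ‖vProj ι u‖ ∧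
      (∀ q ∈ D, ‖vProj ι q‖ ≤ 1 / 5 * ‖q‖) ∧
      ∀ y ∈ E, ‖y - w‖ < 8 * gap ι E x₀ R (hProj ι (w - x₀)) →
        ∃ q ∈ D, ‖y - w - q‖ ≤ ε * (8 * gap ι E x₀ R (hProj ι (w - x₀))) := by
  obtain ⟨a, b, hab, hpa, hga⟩ := hcore
  have hR := h.pos
  have hR1 := h.le_one
  set G := gap ι E x₀ R (hProj ι (w - x₀)) with hG
  set L := ‖a - b‖ with hL
  have hL0 : 0 < L := hab.norm_pos
  have hG1 : L / 2 ≤ G := by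
    have := hab.le_gap (hProj ι (w - x₀))
    linarith
  have hG2 : G ≤ 5 / 2 * L := by
    have := gap_le_add (ι := ι) (E := E) (x₀ := x₀) (R := R) (hProj ι (w - x₀)) (hProj ι (a - x₀))
    linarith
  have hG0 : 0 < G := by linarith
  have hGR : G ≤ R / 16 := by
    have := h.gap_le hε0 (hProj ι (w - x₀))
    nlinarith
  obtain ⟨D, hD, hD1, hD2⟩ := hE w hw (8 * G) (by positivity) (by linarith)
  have hwx' : ‖w - x₀‖ < 10 * R := by linarith
  have hnear : ∀ v, ‖v - w‖ < 8 * G → ‖v - x₀‖ < 10 * R := fun v hv => by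
    have := norm_sub_le_norm_sub_add_norm_sub v w x₀
    linarith
  have htilt := norm_vProj_le_of_chords (ι := ι) (by positivity : 0 < 8 * G) (by linarith) hD2 (by
      intro v hv hv1 hv2
      exact norm_vProj_le_of_gap_lt hw hv hwx' (hnear v hv2) (by rw [← hG]; linarith))
  have haw : ‖a - w‖ ≤ 2 * G := by
    by_cases hlt : G < ‖a - w‖
    · have h1 := norm_vProj_le_of_gap_lt hw hab.left_mem hwx' hab.left_lt hlt
      have h2 := norm_le_two_mul_norm_hProj (by norm_num) h1
      have h3 : hProj ι (a - w) = hProj ι (a - x₀) - hProj ι (w - x₀) := by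
        rw [← map_sub]; congr 1; abel
      rw [h3, norm_sub_rev (hProj ι (a - x₀))] at h2
      linarith
    · linarith
  have hbw : ‖b - w‖ ≤ 4 * G := by
    have := norm_sub_le_norm_sub_add_norm_sub b a w
    rw [norm_sub_rev b a] at this
    linarith
  obtain ⟨qa, hqa, hqa1⟩ := hD1 a hab.left_mem (by linarith)
  obtain ⟨qb, hqb, hqb1⟩ := hD1 b hab.right_mem (by linarith)
  set q := qa - qb with hq
  have hqD : q ∈ D := D.sub_mem hqa hqb
  have hqab : ‖(a - b) - q‖ ≤ 16 * ε * G := by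
    have : (a - b) - q = (a - w - qa) - (b - w - qb) := by rw [hq]; abel
    rw [this]
    have := norm_sub_le (a - w - qa) (b - w - qb)
    linarith
  have hqn : ‖q‖ ≤ 1.1 * L := by
    have := norm_le_norm_add_norm_sub (a - b) q
    nlinarith
  have hvq : ‖q‖ / 20 ≤ ‖vProj ι q‖ := by
    have h1 := hab.steep
    have h2 := norm_le_norm_add_norm_sub' (vProj ι (a - b)) (vProj ι q)
    rw [← map_sub] at h2
    have h3 := norm_vProj_le ι (a - b - q)
    nlinarith
  have hqpos : 0 < ‖q‖ := by
    have := norm_le_norm_add_norm_sub' (a - b) q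
    nlinarith
  have hhq : 0 < ‖hProj ι q‖ := by
    have := norm_le_two_mul_norm_hProj (by norm_num) (htilt q hqD)
    linarith
  refine ⟨D, ‖hProj ι q‖⁻¹ • q, D.smul_mem _ hqD, ?_, ?_, htilt, hD1⟩
  · rw [map_smul, norm_smul, norm_inv, norm_norm, inv_mul_cancel₀ hhq.ne']
  · rw [map_smul, norm_smul, norm_inv, norm_norm, inv_mul_eq_div, le_div_iff₀ hhq]
    have := norm_hProj_le ι q
    linarith

/-- Over a core point the projection of `E ∩ B(w, s)` misses a definite part of `B(w, s)`. -/
theorem exists_hole {ε τ : ℝ} (hE : IsFlat n d ε E) (h : IsFrame ι E ε x₀ R)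
    (hε0 : 0 ≤ ε) (hτ0 : 0 < τ) (hτ : τ ≤ 1 / 100000) (hετ : ε ≤ τ / 10000000) {w : V n} (hw : w ∈ E)
    (hwx : ‖w - x₀‖ < R)
    (hcore : hProj ι (w - x₀) ∈ coreSet ι E x₀ R (1 / 2)) :
    ∃ c : V d, ‖c - hProj ι (w - x₀)‖ ≤
        (1 - 1 / 10000) * (τ * gap ι E x₀ R (hProj ι (w - x₀))) ∧
      ∀ p, ∀ y ∈ E, ‖hProj ι (y - x₀) - p‖ < τ * (τ * gap ι E x₀ R p) →
        ‖w - y‖ < τ * gap ι E x₀ R p →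
        1 / 40000 * (τ * gap ι E x₀ R (hProj ι (w - x₀))) ≤ ‖p - c‖ := by
  obtain ⟨D, u, huD, hu1, hu2, htilt, hflat⟩ := exists_tilted_direction hE h hε0 (by linarith) hw hwx hcore
  set G := gap ι E x₀ R (hProj ι (w - x₀)) with hG
  set σ := τ * G with hσ
  have hG0 : 0 ≤ G := gap_nonneg _
  have hσ0 : 0 ≤ σ := by positivity
  refine ⟨hProj ι (w - x₀) + ((1 - 1 / 10000) * σ) • hProj ι u, ?_, ?_⟩
  · rw [add_sub_cancel_left, norm_smul, hu1, mul_one, Real.norm_of_nonneg (by positivity)]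
  · intro p y hy hyp hwy
    by_contra hcon
    push Not at hcon
    set g := gap ι E x₀ R p with hg
    have hg0 : 0 ≤ g := gap_nonneg _
    have e0 : hProj ι (y - x₀) - hProj ι (w - x₀) = hProj ι (y - w) := by
      rw [← map_sub]; congr 1; abel
    have hpw : ‖p - hProj ι (w - x₀)‖ ≤ 2 * τ * g := by
      have h1 := norm_sub_le_norm_sub_add_norm_sub p (hProj ι (y - x₀)) (hProj ι (w - x₀))
      rw [e0, norm_sub_rev p (hProj ι (y - x₀))] at h1
      have h2 := norm_hProj_le ι (y - w)
      rw [norm_sub_rev y w] at h2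
      nlinarith [mul_nonneg hτ0.le hg0]
    have hgG : g ≤ (1 + 4 * τ) * G := by
      have h1 := gap_le_add (ι := ι) (E := E) (x₀ := x₀) (R := R) p (hProj ι (w - x₀))
      have h2 : g * (1 - 2 * τ) ≤ G := by linarith
      have h3 : (1 - 2 * τ) * (1 + 4 * τ) ≥ 1 := by nlinarith
      nlinarith
    have hs : τ * g ≤ (1 + 4 * τ) * σ := by rw [hσ]; nlinarith
    have hσpos : 0 < σ := by
      rcases hσ0.lt_or_eq with h0 | h0
      · exact h0
      · rw [← h0] at hcon
        rw [← h0] at hs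
        exfalso
        linarith [norm_nonneg (p - (hProj ι (w - x₀) + ((1 - 1 / 10000) * (0 : ℝ)) • hProj ι u))]
    obtain ⟨q, hqD, hq⟩ := hflat y hy (by rw [norm_sub_rev]; nlinarith)
    have herr : ‖y - w - q‖ ≤ σ / 1000000 := by
      refine hq.trans ?_
      rw [hσ]
      nlinarith
    set q' := q - ((1 - 1 / 10000) * σ) • u with hq'
    have hq'D : q' ∈ D := D.sub_mem hqD (D.smul_mem _ huD)
    have hπq' : ‖hProj ι q'‖ ≤ σ / 20000 := by
      have e1 : hProj ι q' = (hProj ι (y - x₀) - p) +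
          (p - (hProj ι (w - x₀) + ((1 - 1 / 10000) * σ) • hProj ι u)) - hProj ι (y - w - q) := by
        rw [hq', map_sub _ (y - w) q, ← e0, map_sub, map_smul]; abel
      rw [e1]
      have h1 := norm_sub_le ((hProj ι (y - x₀) - p) +
          (p - (hProj ι (w - x₀) + ((1 - 1 / 10000) * σ) • hProj ι u))) (hProj ι (y - w - q))
      have h2 := norm_add_le (hProj ι (y - x₀) - p)
          (p - (hProj ι (w - x₀) + ((1 - 1 / 10000) * σ) • hProj ι u))
      have h3 := norm_hProj_le ι (y - w - q)
      have h4 : τ * (τ * g) ≤ σ / 100000 * 1.1 := by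
        have h5 : τ * g ≤ 1.1 * σ := by nlinarith
        have h6 : τ * (τ * g) ≤ 1 / 100000 * (1.1 * σ) :=
          mul_le_mul hτ h5 (by positivity) (by norm_num)
        linarith
      linarith
    have hvq' : ‖vProj ι q'‖ ≤ σ / 40000 := by
      have := norm_vProj_le_of_norm_le (by norm_num) (by norm_num) (htilt q' hq'D)
      linarith
    have e2 : q = q' + ((1 - 1 / 10000) * σ) • u := by rw [hq']; abel
    have hvq : σ / 25 ≤ ‖vProj ι q‖ := by
      have h1 := norm_le_norm_add_norm_sub' (((1 - 1 / 10000) * σ) • vProj ι u) (vProj ι q)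
      have h2 : ((1 - 1 / 10000) * σ) • vProj ι u - vProj ι q = - vProj ι q' := by
        rw [hq', map_sub, map_smul]; abel
      rw [h2, norm_neg, norm_smul, Real.norm_of_nonneg (by positivity)] at h1
      nlinarith
    have hπq : (1 - 2 / 10000) * σ ≤ ‖hProj ι q‖ := by
      have h1 := norm_le_norm_add_norm_sub' (((1 - 1 / 10000) * σ) • hProj ι u) (hProj ι q)
      have h2 : ((1 - 1 / 10000) * σ) • hProj ι u - hProj ι q = - hProj ι q' := by
        rw [hq', map_sub, map_smul]; abel
      rw [h2, norm_neg, norm_smul, hu1, Real.norm_of_nonneg (by positivity)] at h1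
      nlinarith
    have hqn : ‖q‖ ≤ (1 + 1 / 10000) * σ := by
      have h1 := norm_le_norm_add_norm_sub (y - w) q
      rw [norm_sub_rev y w] at h1
      nlinarith
    have hfin := norm_sq_eq_hProj_add_vProj ι q
    have h1 : ‖q‖ ^ 2 ≤ ((1 + 1 / 10000) * σ) ^ 2 := by gcongr
    have h2 : ((1 - 2 / 10000) * σ) ^ 2 ≤ ‖hProj ι q‖ ^ 2 := by
      gcongr
    have h3 : (σ / 25) ^ 2 ≤ ‖vProj ι q‖ ^ 2 := by gcongr
    nlinarith [mul_pos hσpos hσpos]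

end Hole

section GraphExistence

variable {n d : ℕ} {ι : V d →ₗᵢ[ℝ] V n} {E : Set (V n)} {x₀ : V n} {R : ℝ}

theorem norm_le_of_forall_coord_le {v : V n} {t : ℝ} (h : ∀ j, |v j| ≤ t) : ‖v‖ ≤ n * t := by
  have h1 : v = ∑ j, PiLp.single 2 j (v j) := by
    ext i
    rw [WithLp.ofLp_sum, Finset.sum_apply]
    simp
  rw [h1]
  refine (norm_sum_le _ _).trans ((Finset.sum_le_sum fun j _ => ?_).trans_eq
    (by rw [Finset.sum_const, Finset.card_univ, Fintype.card_fin, nsmul_eq_mul] : _ = (n : ℝ) * t))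
  rw [PiLp.norm_single]
  exact h j

theorem abs_coord_le_norm (v : V n) (j : Fin n) : |v j| ≤ ‖v‖ := by
  rw [← Real.norm_eq_abs]
  exact PiLp.norm_apply_le v j

/-- Extension of an almost Lipschitz height function from a set `S` to the whole plane. -/
theorem exists_lipschitz_extension {X U : Type*} [NormedAddCommGroup U] {S : Set X} (hS : S.Nonempty)
    (p : X → U) (y g : X → ℝ) {c : U → ℝ} (hc0 : ∀ a, 0 ≤ c a) (hc : LipschitzWith 1 c)
    {b : ℝ} (hb : ∀ u ∈ S, b ≤ y u) (hg : ∀ u, 0 ≤ g u)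
    (h : ∀ u ∈ S, ∀ w ∈ S, y u ≤ y w + ‖p u - p w‖ + g w) :
    ∃ f : U → ℝ, LipschitzWith 1 f ∧ (∀ a, |f a| ≤ c a) ∧
      ∀ u ∈ S, |y u| ≤ c (p u) → |y u - f (p u)| ≤ g u := by
  have := hS.to_subtype
  set f₀ : U → ℝ := fun a => ⨅ w : S, (y w + ‖a - p w‖ + g w) with hf₀
  have hbdd : ∀ a, BddBelow (range fun w : S => y w + ‖a - p w‖ + g w) := fun a => by
    refine ⟨b, ?_⟩
    rintro _ ⟨w, rfl⟩
    have h1 := hb w w.2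
    have h2 := hg w
    have h3 := norm_nonneg (a - p w)
    show b ≤ y w + ‖a - p w‖ + g w
    linarith
  have hlip : LipschitzWith 1 f₀ := by
    refine LipschitzWith.of_le_add fun a a' => ?_
    rw [← sub_le_iff_le_add]
    refine le_ciInf fun w => ?_
    rw [sub_le_iff_le_add]
    refine (ciInf_le (hbdd a) w).trans ?_
    have := norm_sub_le_norm_sub_add_norm_sub a a' (p w)
    rw [dist_eq_norm]
    linarith
  have hneg : LipschitzWith 1 fun a => -c a := hc.neg
  have hmm := (hlip.min hc).max hneg
  rw [max_self, max_self] at hmm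
  refine ⟨fun a => max (min (f₀ a) (c a)) (-c a), hmm, fun a => ?_, fun u hu hyu => ?_⟩
  · have := hc0 a
    rw [abs_le]
    exact ⟨le_max_right _ _, max_le (min_le_right _ _) (by linarith)⟩
  · have h1 : f₀ (p u) ≤ y u + g u := by
      refine (ciInf_le (hbdd (p u)) ⟨u, hu⟩).trans ?_
      simp
    have h2 : y u ≤ f₀ (p u) := le_ciInf fun w => h u hu w w.2
    obtain ⟨h3, h4⟩ := abs_le.1 hyu
    have h5 := hg u
    have h6 : y u ≤ min (f₀ (p u)) (c (p u)) := le_min h2 h4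
    have h7 : min (f₀ (p u)) (c (p u)) ≤ f₀ (p u) := min_le_left _ _
    show |y u - max (min (f₀ (p u)) (c (p u))) (-c (p u))| ≤ g u
    rw [max_eq_left (by linarith), abs_le]
    constructor <;> linarith

theorem norm_vProj_sub_le_add_gap {u w : V n} (hu : u ∈ E) (hw : w ∈ E) (hux : ‖u - x₀‖ < 10 * R)
    (hwx : ‖w - x₀‖ < 10 * R) :
    ‖vProj ι (u - w)‖ ≤ ‖hProj ι (u - x₀) - hProj ι (w - x₀)‖ + gap ι E x₀ R (hProj ι (w - x₀)) := by
  have e : hProj ι (u - x₀) - hProj ι (w - x₀) = hProj ι (u - w) := by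
    rw [← map_sub]; congr 1; abel
  by_cases h : gap ι E x₀ R (hProj ι (w - x₀)) < ‖u - w‖
  · have h1 := norm_vProj_le_of_norm_le (by norm_num) (by norm_num)
      (norm_vProj_le_of_gap_lt hw hu hwx hux h)
    rw [e]
    linarith [norm_nonneg (hProj ι (u - w)), gap_nonneg (ι := ι) (E := E) (x₀ := x₀) (R := R)
      (hProj ι (w - x₀))]
  · linarith [norm_vProj_le ι (u - w), norm_nonneg (hProj ι (u - x₀) - hProj ι (w - x₀))]

theorem exists_graphApprox {m : ℕ} (hx₀ : x₀ ∈ E) (N : ℕ) :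
    ∃ f : V d → V n, GraphApprox E x₀ m n f (fun u => hProj ι (u - x₀)) (fun u => vProj ι (u - x₀))
      (fun u => max (gap ι E x₀ ((1 / 2) ^ m) (hProj ι (u - x₀))) ((1 / 2) ^ N)) := by
  set R : ℝ := (1 / 2) ^ m with hR
  have hR0 : 0 < R := by positivity
  set S : Set (V n) := {u | u ∈ E ∧ ‖u - x₀‖ < 10 * R} with hS
  have hSne : S.Nonempty := ⟨x₀, hx₀, by rw [sub_self, norm_zero]; positivity⟩
  set c : V d → ℝ := fun a => max 0 (64 * R - ‖a‖) with hcdef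
  have hc : LipschitzWith 1 c := by
    refine LipschitzWith.of_le_add fun a a' => ?_
    have := norm_sub_norm_le a' a
    rw [norm_sub_rev, ← dist_eq_norm] at this
    refine max_le (add_nonneg (le_max_left _ _) dist_nonneg) ?_
    linarith [le_max_right 0 (64 * R - ‖a'‖)]
  have hex : ∀ j : Fin n, ∃ f : V d → ℝ, LipschitzWith 1 f ∧ (∀ a, |f a| ≤ c a) ∧
      ∀ u ∈ S, |vProj ι (u - x₀) j| ≤ c (hProj ι (u - x₀)) →
        |vProj ι (u - x₀) j - f (hProj ι (u - x₀))| ≤ gap ι E x₀ R (hProj ι (u - x₀)) := by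
    intro j
    refine exists_lipschitz_extension hSne (fun u => hProj ι (u - x₀))
      (fun u => vProj ι (u - x₀) j) (fun u => gap ι E x₀ R (hProj ι (u - x₀)))
      (fun a => le_max_left _ _) hc (b := -(10 * R)) ?_ (fun u => gap_nonneg _) ?_
    · intro u hu
      have h1 := (abs_coord_le_norm (vProj ι (u - x₀)) j).trans (norm_vProj_le ι _)
      exact (abs_le.1 (h1.trans hu.2.le)).1
    · intro u hu w hw
      have h1 := norm_vProj_sub_le_add_gap (ι := ι) hu.1 hw.1 hu.2 hw.2
      have h2 := le_of_abs_le ((abs_coord_le_norm (vProj ι (u - w)) j).trans h1)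
      have h3 : vProj ι (u - w) j = vProj ι (u - x₀) j - vProj ι (w - x₀) j := by
        have : vProj ι (u - w) = vProj ι (u - x₀) - vProj ι (w - x₀) := by
          rw [← map_sub]; congr 1; abel
        rw [this]; rfl
      rw [h3] at h2
      show vProj ι (u - x₀) j ≤ vProj ι (w - x₀) j + _ + _
      linarith
  choose f hf1 hf2 hf3 using hex
  refine ⟨fun a => WithLp.toLp 2 fun j => f j a, Nat.cast_nonneg n, ?_, ?_, ?_, ?_, ?_, ?_⟩
  · intro a b
    refine norm_le_of_forall_coord_le fun j => ?_
    have := (hf1 j).dist_le_mul a b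
    rwa [NNReal.coe_one, one_mul, dist_eq_norm, dist_eq_norm] at this
  · intro a ha
    ext j
    have h1 := hf2 j a
    have h2 : c a = 0 := max_eq_left (by linarith)
    rw [h2] at h1
    exact abs_nonpos_iff.1 h1
  · intro u v
    rw [← map_sub, sub_sub_sub_cancel_right, dist_eq_norm]
    exact norm_hProj_le ι _
  · intro u v
    have h1 := gap_le_add (ι := ι) (E := E) (x₀ := x₀) (R := R) (hProj ι (u - x₀)) (hProj ι (v - x₀))
    rw [← map_sub, sub_sub_sub_cancel_right] at h1
    have h2 := norm_hProj_le ι (u - v)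
    rw [dist_eq_norm]
    refine max_le ?_ ?_
    · linarith [le_max_left (gap ι E x₀ R (hProj ι (v - x₀))) ((1 / 2) ^ N)]
    · linarith [le_max_right (gap ι E x₀ R (hProj ι (v - x₀))) ((1 / 2) ^ N), norm_nonneg (u - v)]
  · intro u v
    rw [← map_sub, ← map_sub, sub_sub_sub_cancel_right, dist_eq_norm]
    exact norm_le_hProj_add_vProj ι _
  · intro u hu hux
    rw [mem_ball, dist_eq_norm] at hux
    refine norm_le_of_forall_coord_le fun j => ?_
    refine le_trans (hf3 j u ⟨hu, by linarith⟩ ?_) (le_max_left _ _)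
    have h1 := (abs_coord_le_norm (vProj ι (u - x₀)) j).trans (norm_vProj_le ι _)
    have h2 := norm_hProj_le ι (u - x₀)
    refine le_trans ?_ (le_max_right _ _)
    linarith

end GraphExistence

section Beta

variable {n d : ℕ}

/-- The restriction of Hausdorff measure to `E`. -/
def surf (n d : ℕ) (E : Set (V n)) : Measure (V n) := (μH[(d : ℝ)] : Measure (V n)).restrict E

/-- Local Ahlfors regularity. -/
structure IsADRegular (n d : ℕ) (C₀ : ℝ) (E : Set (V n)) : Prop where
  isClosed : IsClosed E
  le_measure : ∀ x ∈ E, ∀ r : ℝ, 0 < r → r ≤ 1 → ENNReal.ofReal (C₀⁻¹ * r ^ d) ≤ surf n d E (ball x r)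
  measure_le : ∀ x ∈ E, ∀ r : ℝ, 0 < r → r ≤ 1 → surf n d E (ball x r) ≤ ENNReal.ofReal (C₀ * r ^ d)

theorem surf_restrict (E : Set (V n)) {s : Set (V n)} (hs : MeasurableSet s) :
    (surf n d E).restrict s = (μH[(d : ℝ)] : Measure (V n)).restrict (E ∩ s) := by
  rw [surf, Measure.restrict_restrict hs, inter_comm]

variable {E : Set (V n)} {C₀ : ℝ}

/-- The Jones numbers are controlled by the normalized `L^q` norm of the distance to any plane
meeting the ball. -/
theorem betaE_le_eLpNorm (hE : IsADRegular n d C₀ E) (hC₀ : 1 ≤ C₀) {q : ℝ≥0∞} (hq : 1 ≤ q) {w : V n}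
    {t : ℝ} (ht : 0 < t) (P : Set (V n)) (hP : IsAffinePlane n d P) (hPw : (P ∩ ball w t).Nonempty) :
    betaE n d q E w t ≤ eLpNorm (fun u => t⁻¹ * infDist u P) q
      ((ENNReal.ofReal (t ^ d))⁻¹ • (surf n d E).restrict (ball w t)) := by
  have htd : ENNReal.ofReal (t ^ d) ≠ 0 := (ENNReal.ofReal_pos.2 (by positivity)).ne'
  have hq0 : q ≠ 0 := (one_pos.trans_le hq).ne'
  unfold betaE
  split_ifs with hqt
  · subst hqt
    refine (iInf₂_le P ⟨hP, hPw⟩).trans ?_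
    set ν := (ENNReal.ofReal (t ^ d))⁻¹ • (surf n d E).restrict (ball w t) with hν
    rw [eLpNorm_exponent_top]
    by_contra hcon
    push Not at hcon
    set e := eLpNormEssSup (fun u => t⁻¹ * infDist u P) ν with he
    have het : e ≠ ⊤ := hcon.ne_top
    have hsup : (⨆ y ∈ E ∩ ball w t, infDist y P) ≤ t * e.toReal := by
      refine Real.iSup_le (fun y => Real.iSup_le (fun hy => ?_) (by positivity)) (by positivity)
      by_contra hlt
      push Not at hlt
      have hopen : IsOpen ({u | t * e.toReal < infDist u P} ∩ ball w t) :=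
        (isOpen_lt continuous_const (continuous_infDist_pt P)).inter isOpen_ball
      obtain ⟨ρ, hρ, hsub⟩ := Metric.isOpen_iff.1 hopen y ⟨hlt, hy.2⟩
      have hae : ∀ᵐ u ∂ν, ‖t⁻¹ * infDist u P‖ₑ ≤ e := ae_le_eLpNormEssSup
      rw [hν, Measure.ae_ennreal_smul_measure_iff (ENNReal.inv_ne_zero.2 ENNReal.ofReal_ne_top),
        ae_restrict_iff' measurableSet_ball] at hae
      have hzero : surf n d E (ball y (min ρ 1)) = 0 := by
        refine measure_mono_null (fun u hu => ?_) (ae_iff.1 hae)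
        have hu' := hsub (ball_subset_ball (min_le_left _ _) hu)
        simp only [mem_ofPred_eq, Classical.not_imp, not_le]
        refine ⟨hu'.2, ?_⟩
        have h1 : t * e.toReal < infDist u P := hu'.1
        rw [Real.enorm_of_nonneg (mul_nonneg (by positivity) infDist_nonneg),
          ENNReal.lt_ofReal_iff_toReal_lt het, inv_mul_eq_div, lt_div_iff₀ ht]
        linarith
      have hpos := hE.le_measure y hy.1 (min ρ 1) (by positivity) (min_le_right _ _)
      rw [hzero] at hpos
      have : 0 < C₀⁻¹ * (min ρ 1) ^ d := by positivity
      exact absurd (ENNReal.ofReal_pos.2 this) (not_lt.2 hpos)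
    refine absurd hcon (not_lt.2 ?_)
    rw [← ENNReal.ofReal_toReal het]
    refine ENNReal.ofReal_le_ofReal ?_
    rw [inv_mul_eq_div, div_le_iff₀ ht]
    linarith
  · refine (iInf₂_le P ⟨hP, hPw⟩).trans (le_of_eq ?_)
    rw [eLpNorm_eq_lintegral_rpow_enorm_toReal hq0 hqt, lintegral_smul_measure,
      surf_restrict E measurableSet_ball, smul_eq_mul, ENNReal.div_eq_inv_mul]
    congr 2
    refine lintegral_congr fun u => ?_
    rw [Real.enorm_of_nonneg (mul_nonneg (by positivity) infDist_nonneg),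
      ENNReal.ofReal_rpow_of_nonneg (mul_nonneg (by positivity) infDist_nonneg) ENNReal.toReal_nonneg,
      div_eq_inv_mul]

theorem normalized_measure_le (hE : IsADRegular n d C₀ E) (hC₀ : 1 ≤ C₀) {w : V n} (hw : w ∈ E) {t : ℝ}
    (ht : 0 < t) (ht1 : t ≤ 1) :
    ((ENNReal.ofReal (t ^ d))⁻¹ • (surf n d E).restrict (ball w t)) univ ≤ ENNReal.ofReal C₀ := by
  rw [Measure.smul_apply, Measure.restrict_apply_univ, smul_eq_mul]
  refine (mul_le_mul_right (hE.measure_le w hw t ht ht1) _).trans (le_of_eq ?_)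
  rw [ENNReal.ofReal_mul (by positivity), mul_comm, mul_assoc, ENNReal.mul_inv_cancel
    (ENNReal.ofReal_pos.2 (by positivity)).ne' ENNReal.ofReal_ne_top, mul_one]

theorem exists_isAffinePlane_mem {D : Submodule ℝ (V n)} (hD : Module.finrank ℝ D = d) (w : V n) :
    ∃ P, IsAffinePlane n d P ∧ w ∈ P :=
  ⟨_, ⟨AffineSubspace.mk' w D, rfl, by rw [AffineSubspace.direction_mk', hD],
    ⟨w, AffineSubspace.self_mem_mk' w D⟩⟩, AffineSubspace.self_mem_mk' w D⟩

theorem rpow_le_self_of_one_le {a : ℝ≥0∞} (ha : 1 ≤ a) {s : ℝ} (hs : s ≤ 1) : a ^ s ≤ a := by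
  simpa using ENNReal.rpow_le_rpow_of_exponent_le ha hs

theorem toReal_inv_le_one {q : ℝ≥0∞} (hq : 1 ≤ q) : q.toReal⁻¹ ≤ 1 := by
  rcases eq_or_ne q ⊤ with rfl | h
  · simp
  · exact inv_le_one_of_one_le₀ ((ENNReal.ofReal_le_iff_le_toReal h).1 (by simpa using hq))

theorem betaE_le (hE : IsADRegular n d C₀ E) (hC₀ : 1 ≤ C₀) {q : ℝ≥0∞} (hq : 1 ≤ q)
    (hD : ∃ D : Submodule ℝ (V n), Module.finrank ℝ D = d) {w : V n} (hw : w ∈ E)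
    {t : ℝ} (ht : 0 < t) (ht1 : t ≤ 1) : betaE n d q E w t ≤ ENNReal.ofReal C₀ := by
  obtain ⟨D, hD⟩ := hD
  obtain ⟨P, hP, hwP⟩ := exists_isAffinePlane_mem hD w
  refine (betaE_le_eLpNorm hE hC₀ hq ht P hP ⟨w, hwP, mem_ball_self ht⟩).trans ?_
  refine (eLpNorm_le_of_ae_bound (C := 1) ?_).trans ?_
  · refine Measure.ae_smul_measure ?_ _
    filter_upwards [ae_restrict_mem measurableSet_ball] with u hu
    rw [Real.norm_of_nonneg (mul_nonneg (by positivity) infDist_nonneg), inv_mul_eq_div, div_le_one ht]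
    exact (infDist_le_dist_of_mem hwP).trans (mem_ball.1 hu).le
  · rw [ENNReal.ofReal_one, mul_one]
    refine (ENNReal.rpow_le_rpow (normalized_measure_le hE hC₀ hw ht ht1) (by positivity)).trans ?_
    exact rpow_le_self_of_one_le (ENNReal.one_le_ofReal.2 hC₀) (toReal_inv_le_one hq)

/-- As `betaE_le_eLpNorm`, for planes that may miss the ball. -/
theorem betaE_le_mul_eLpNorm (hE : IsADRegular n d C₀ E) (hC₀ : 1 ≤ C₀) {q : ℝ≥0∞} (hq : 1 ≤ q)
    (hD : ∃ D : Submodule ℝ (V n), Module.finrank ℝ D = d) {w : V n} (hw : w ∈ E)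
    {t : ℝ} (ht : 0 < t) (ht1 : t ≤ 1) (P : Set (V n)) (hP : IsAffinePlane n d P) :
    betaE n d q E w t ≤ ENNReal.ofReal (C₀ ^ 2 * 2 ^ (d + 1)) *
      eLpNorm (fun u => t⁻¹ * infDist u P) q
      ((ENNReal.ofReal (t ^ d))⁻¹ • (surf n d E).restrict (ball w t)) := by
  have hone : (1 : ℝ) ≤ C₀ ^ 2 * 2 ^ (d + 1) :=
    one_le_mul_of_one_le_of_one_le (one_le_pow₀ hC₀) (one_le_pow₀ (by norm_num))
  by_cases hPw : (P ∩ ball w t).Nonempty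
  · refine (betaE_le_eLpNorm hE hC₀ hq ht P hP hPw).trans ?_
    exact le_mul_of_one_le_left zero_le (ENNReal.one_le_ofReal.2 hone)
  · refine (betaE_le hE hC₀ hq hD hw ht ht1).trans ?_
    set ν := (ENNReal.ofReal (t ^ d))⁻¹ • (surf n d E).restrict (ball w t) with hν
    have hPne : P.Nonempty := by obtain ⟨Q, rfl, -, h⟩ := hP; exact h
    have htd : (0 : ℝ) < t ^ d := by positivity
    have hνs : ENNReal.ofReal (C₀⁻¹ * (1 / 2) ^ d) ≤ ν (ball w (t / 2)) := by
      rw [hν, Measure.smul_apply, Measure.restrict_apply measurableSet_ball, smul_eq_mul,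
        inter_eq_left.2 (ball_subset_ball (by linarith))]
      refine le_trans ?_ (mul_le_mul_right (hE.le_measure w hw (t / 2) (by positivity) (by linarith)) _)
      rw [← ENNReal.ofReal_inv_of_pos htd, ← ENNReal.ofReal_mul (by positivity)]
      refine ENNReal.ofReal_le_ofReal (le_of_eq ?_)
      rw [div_pow, div_pow, one_pow]; field_simp
    have hνpos : ν (ball w (t / 2)) ≠ 0 :=
      ((ENNReal.ofReal_pos.2 (by positivity)).trans_le hνs).ne'
    have hlow : ENNReal.ofReal (1 / 2 * (C₀⁻¹ * (1 / 2) ^ d)) ≤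
        eLpNorm (fun u => t⁻¹ * infDist u P) q ν := by
      calc ENNReal.ofReal (1 / 2 * (C₀⁻¹ * (1 / 2) ^ d))
          ≤ ‖(1 / 2 : ℝ)‖ₑ * ν (ball w (t / 2)) ^ (1 / q.toReal) := by
            rw [ENNReal.ofReal_mul (by norm_num), Real.enorm_of_nonneg (by norm_num)]
            gcongr ENNReal.ofReal (1 / 2) * ?_
            refine le_trans ?_ (ENNReal.rpow_le_rpow hνs (by positivity))
            have h1 : ENNReal.ofReal (C₀⁻¹ * (1 / 2) ^ d) ≤ 1 := by
              rw [ENNReal.ofReal_le_one]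
              exact mul_le_one₀ (inv_le_one_of_one_le₀ hC₀) (by positivity)
                (pow_le_one₀ (by norm_num) (by norm_num))
            have h2 := ENNReal.rpow_le_rpow_of_exponent_ge h1
              (by rw [one_div]; exact toReal_inv_le_one hq : 1 / q.toReal ≤ 1)
            rwa [ENNReal.rpow_one] at h2
        _ = eLpNorm ((ball w (t / 2)).indicator fun _ => (1 / 2 : ℝ)) q ν :=
            (eLpNorm_indicator_const' measurableSet_ball hνpos (one_pos.trans_le hq).ne').symm
        _ ≤ _ := by
            refine eLpNorm_mono_real fun u => ?_
            by_cases hu : u ∈ ball w (t / 2)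
            · rw [indicator_of_mem hu, Real.norm_of_nonneg (by norm_num), inv_mul_eq_div,
                le_div_iff₀ ht]
              refine (le_infDist hPne).2 fun {v} hv => ?_
              by_contra hcon
              refine hPw ⟨v, hv, ?_⟩
              rw [mem_ball] at hu ⊢
              have := dist_triangle v u w
              rw [dist_comm v u] at this
              linarith
            · rw [indicator_of_notMem hu, norm_zero]
              exact mul_nonneg (by positivity) infDist_nonneg
    refine le_trans ?_ (mul_le_mul_right hlow _)
    rw [← ENNReal.ofReal_mul (by positivity)]
    refine ENNReal.ofReal_le_ofReal (le_of_eq ?_)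
    rw [one_div, inv_pow]
    field_simp
    ring

end Beta

section JonesFunction

variable {n d : ℕ} {E : Set (V n)} {C₀ : ℝ}

/-- The constant comparing Jones numbers at comparable balls. -/
def betaConst (d : ℕ) (C₀ : ℝ) : ℝ≥0∞ :=
  (ENNReal.ofReal (C₀ ^ 2 * 2 ^ (d + 1)) * (2 ^ (d + 1) * ENNReal.ofReal C₀)) ^ 2

theorem betaConst_ne_top (d : ℕ) (C₀ : ℝ) : betaConst d C₀ ≠ ⊤ := by
  unfold betaConst; finiteness

theorem betaE_sq_le (hE : IsADRegular n d C₀ E) (hC₀ : 1 ≤ C₀) {q q' : ℝ≥0∞} (hq : 1 ≤ q)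
    (hqq : q ≤ q') (hD : ∃ D : Submodule ℝ (V n), Module.finrank ℝ D = d) {w z : V n} (hw : w ∈ E)
    {k : ℕ} (hwz : dist w z < (1 / 2) ^ k) {t : ℝ} (ht : t ∈ Ioc ((1 / 2 : ℝ) ^ (k + 1)) ((1 / 2) ^ k))
    (P : Set (V n)) (hP : IsAffinePlane n d P) :
    betaE n d q E w t ^ 2 ≤ betaConst d C₀ *
      eLpNorm (fun u => (2 : ℝ) ^ k * infDist u P) q'
        ((2 : ℝ≥0∞) ^ (k * d) • (surf n d E).restrict (ball z (2 * (1 / 2) ^ k))) ^ 2 := by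
  have hk1 : (1 / 2 : ℝ) ^ k ≤ 1 := pow_le_one₀ (by norm_num) (by norm_num)
  have ht0 : 0 < t := lt_trans (by positivity) ht.1
  have ht1 : t ≤ 1 := ht.2.trans hk1
  have hC₁ : 1 ≤ ENNReal.ofReal C₀ := ENNReal.one_le_ofReal.2 hC₀
  have htinv : t⁻¹ ≤ 2 * 2 ^ k := by
    rw [← pow_succ']
    refine (inv_anti₀ (by positivity) ht.1.le).trans (le_of_eq ?_)
    rw [one_div, inv_pow, inv_inv]
  set ν := (ENNReal.ofReal (t ^ d))⁻¹ • (surf n d E).restrict (ball w t) with hν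
  set ν' := (2 : ℝ≥0∞) ^ (k * d) • (surf n d E).restrict (ball z (2 * (1 / 2) ^ k)) with hν'
  have hcomp : ν ≤ (2 : ℝ≥0∞) ^ d • ν' := by
    rw [hν, hν', smul_smul]
    refine Measure.le_iff.2 fun s hs => ?_
    rw [Measure.smul_apply, Measure.smul_apply, smul_eq_mul, smul_eq_mul]
    gcongr ?_ * ?_
    · rw [← ENNReal.ofReal_inv_of_pos (by positivity)]
      have : (2 : ℝ≥0∞) ^ d * 2 ^ (k * d) = ENNReal.ofReal ((2 * 2 ^ k) ^ d) := by
        rw [mul_pow, ← pow_mul, ENNReal.ofReal_mul (by positivity), ENNReal.ofReal_pow (by norm_num),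
          ENNReal.ofReal_pow (by norm_num), ENNReal.ofReal_ofNat]
      rw [this, ← inv_pow]
      exact ENNReal.ofReal_le_ofReal (pow_le_pow_left₀ (by positivity) htinv d)
    · exact Measure.restrict_mono (ball_subset_ball' (by linarith [ht.2])) le_rfl s
  have hmeas : ∀ c : ℝ, AEStronglyMeasurable (fun u => c * infDist u P) ν := fun c =>
    (continuous_const.mul (continuous_infDist_pt P)).aestronglyMeasurable
  have h1 : eLpNorm (fun u => t⁻¹ * infDist u P) q ν ≤
      eLpNorm (fun u => t⁻¹ * infDist u P) q' ν * ENNReal.ofReal C₀ := by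
    refine (eLpNorm_le_eLpNorm_mul_rpow_measure_univ hqq (hmeas _)).trans ?_
    gcongr
    have hexp : 0 ≤ 1 / q.toReal - 1 / q'.toReal := by
      rcases eq_or_ne q' ⊤ with rfl | h'
      · simp
      · rw [sub_nonneg]
        refine one_div_le_one_div_of_le ?_ (ENNReal.toReal_mono h' hqq)
        exact ENNReal.toReal_pos (one_pos.trans_le hq).ne' (hqq.trans_lt h'.lt_top).ne
    refine (ENNReal.rpow_le_rpow (normalized_measure_le hE hC₀ hw ht0 ht1) hexp).trans ?_
    refine rpow_le_self_of_one_le hC₁ ?_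
    have := toReal_inv_le_one hq
    rw [one_div, one_div]
    linarith [inv_nonneg.2 (ENNReal.toReal_nonneg (a := q'))]
  have h2 : eLpNorm (fun u => t⁻¹ * infDist u P) q' ν ≤
      2 ^ (d + 1) * eLpNorm (fun u => (2 : ℝ) ^ k * infDist u P) q' ν' := by
    calc eLpNorm (fun u => t⁻¹ * infDist u P) q' ν
        ≤ eLpNorm (fun u => t⁻¹ * infDist u P) q' ((2 : ℝ≥0∞) ^ d • ν') := eLpNorm_mono_measure _ hcomp
      _ ≤ eLpNorm ((2 : ℝ) • fun u => (2 : ℝ) ^ k * infDist u P) q' ((2 : ℝ≥0∞) ^ d • ν') := by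
          refine eLpNorm_mono_real fun u => ?_
          rw [Real.norm_of_nonneg (mul_nonneg (by positivity) infDist_nonneg)]
          show t⁻¹ * infDist u P ≤ 2 * (2 ^ k * infDist u P)
          rw [← mul_assoc]
          exact mul_le_mul_of_nonneg_right htinv infDist_nonneg
      _ ≤ 2 * (2 ^ d * eLpNorm (fun u => (2 : ℝ) ^ k * infDist u P) q' ν') := by
          rw [eLpNorm_const_smul, eLpNorm_smul_measure_of_ne_zero (by positivity), smul_eq_mul,
            Real.enorm_of_nonneg (by norm_num), ENNReal.ofReal_ofNat]
          gcongr
          refine rpow_le_self_of_one_le (one_le_pow₀ (by norm_num)) ?_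
          rw [one_div, ENNReal.toReal_inv]
          exact toReal_inv_le_one (hq.trans hqq)
      _ = _ := by rw [pow_succ]; ring
  have h3 := betaE_le_mul_eLpNorm hE hC₀ hq hD hw ht0 ht1 P hP
  rw [betaConst, ← mul_pow]
  gcongr
  refine h3.trans ?_
  calc _ ≤ ENNReal.ofReal (C₀ ^ 2 * 2 ^ (d + 1)) * ((2 ^ (d + 1) *
        eLpNorm (fun u => (2 : ℝ) ^ k * infDist u P) q' ν') * ENNReal.ofReal C₀) := by
        gcongr ENNReal.ofReal (C₀ ^ 2 * 2 ^ (d + 1)) * ?_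
        exact h1.trans (mul_le_mul_left h2 _)
    _ = _ := by ring

/-- The largest squared Jones number at `w` over the scales in `(2⁻ᵏ⁻¹, 2⁻ᵏ]`. -/
def scaleBeta (n d : ℕ) (q : ℝ≥0∞) (E : Set (V n)) (k : ℕ) (w : V n) : ℝ≥0∞ :=
  ⨆ t ∈ Ioc ((1 / 2 : ℝ) ^ (k + 1)) ((1 / 2) ^ k), betaE n d q E w t ^ 2

/-- A Lipschitz majorant of the squared Jones numbers at scale `2⁻ᵏ`. -/
def jonesFun (n d : ℕ) (q : ℝ≥0∞) (E : Set (V n)) (k : ℕ) (z : V n) : ℝ≥0∞ :=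
  ⨆ w ∈ E, scaleBeta n d q E k w * ENNReal.ofReal (1 - 2 ^ k * dist z w)

theorem scaleBeta_le (hE : IsADRegular n d C₀ E) (hC₀ : 1 ≤ C₀) {q : ℝ≥0∞} (hq : 1 ≤ q)
    (hD : ∃ D : Submodule ℝ (V n), Module.finrank ℝ D = d) {w : V n} (hw : w ∈ E) (k : ℕ) :
    scaleBeta n d q E k w ≤ ENNReal.ofReal C₀ ^ 2 := by
  refine iSup₂_le fun t ht => ?_
  gcongr
  exact betaE_le hE hC₀ hq hD hw (lt_trans (by positivity) ht.1)
    (ht.2.trans (pow_le_one₀ (by norm_num) (by norm_num)))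

theorem jonesFun_le (hE : IsADRegular n d C₀ E) (hC₀ : 1 ≤ C₀) {q : ℝ≥0∞} (hq : 1 ≤ q)
    (hD : ∃ D : Submodule ℝ (V n), Module.finrank ℝ D = d) (k : ℕ) (z : V n) :
    jonesFun n d q E k z ≤ ENNReal.ofReal C₀ ^ 2 := by
  refine iSup₂_le fun w hw => ?_
  refine (mul_le_mul' (scaleBeta_le hE hC₀ hq hD hw k) (ENNReal.ofReal_le_one.2 ?_)).trans_eq (mul_one _)
  have : 0 ≤ (2 : ℝ) ^ k * dist z w := by positivity
  linarith

theorem measurable_jonesFun (hE : IsADRegular n d C₀ E) (hC₀ : 1 ≤ C₀) {q : ℝ≥0∞} (hq : 1 ≤ q)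
    (hD : ∃ D : Submodule ℝ (V n), Module.finrank ℝ D = d) (k : ℕ) :
    Measurable (jonesFun n d q E k) := by
  refine (lowerSemicontinuous_biSup fun w hw => Continuous.lowerSemicontinuous ?_).measurable
  refine (ENNReal.continuous_const_mul ?_).comp (ENNReal.continuous_ofReal.comp (by fun_prop))
  exact ((scaleBeta_le hE hC₀ hq hD hw k).trans_lt (by finiteness)).ne

theorem jonesFun_le_add (hE : IsADRegular n d C₀ E) (hC₀ : 1 ≤ C₀) {q : ℝ≥0∞} (hq : 1 ≤ q)
    (hD : ∃ D : Submodule ℝ (V n), Module.finrank ℝ D = d) (k : ℕ) (z w : V n) :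
    jonesFun n d q E k z ≤
      jonesFun n d q E k w + ENNReal.ofReal C₀ ^ 2 * ENNReal.ofReal (2 ^ k * dist z w) := by
  refine iSup₂_le fun v hv => ?_
  calc _ ≤ scaleBeta n d q E k v *
        (ENNReal.ofReal (1 - 2 ^ k * dist w v) + ENNReal.ofReal (2 ^ k * dist z w)) := by
        gcongr
        refine le_trans (ENNReal.ofReal_le_ofReal ?_) ENNReal.ofReal_add_le
        have h1 := mul_le_mul_of_nonneg_left (dist_triangle w z v) (by positivity : (0 : ℝ) ≤ 2 ^ k)
        rw [dist_comm w z, mul_add] at h1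
        linarith
    _ = scaleBeta n d q E k v * ENNReal.ofReal (1 - 2 ^ k * dist w v) +
        scaleBeta n d q E k v * ENNReal.ofReal (2 ^ k * dist z w) := mul_add _ _ _
    _ ≤ _ := add_le_add (le_iSup₂_of_le v hv le_rfl)
        (mul_le_mul_left (scaleBeta_le hE hC₀ hq hD hv k) _)

theorem betaE_sq_le_jonesFun {q : ℝ≥0∞} {w : V n} (hw : w ∈ E) {k : ℕ} {t : ℝ}
    (ht : t ∈ Ioc ((1 / 2 : ℝ) ^ (k + 1)) ((1 / 2) ^ k)) :
    betaE n d q E w t ^ 2 ≤ jonesFun n d q E k w := by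
  refine le_iSup₂_of_le w hw ?_
  rw [dist_self, mul_zero, sub_zero, ENNReal.ofReal_one, mul_one]
  exact le_iSup₂_of_le t ht le_rfl

theorem jonesFun_le_eLpNorm (hE : IsADRegular n d C₀ E) (hC₀ : 1 ≤ C₀) {q q' : ℝ≥0∞} (hq : 1 ≤ q)
    (hqq : q ≤ q') (hD : ∃ D : Submodule ℝ (V n), Module.finrank ℝ D = d) (z : V n) (k : ℕ)
    (P : Set (V n)) (hP : IsAffinePlane n d P) :
    jonesFun n d q E k z ≤ betaConst d C₀ *
      eLpNorm (fun u => (2 : ℝ) ^ k * infDist u P) q'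
        ((2 : ℝ≥0∞) ^ (k * d) • (surf n d E).restrict (ball z (2 * (1 / 2) ^ k))) ^ 2 := by
  refine iSup₂_le fun w hw => ?_
  by_cases hwz : dist w z < (1 / 2) ^ k
  · calc _ ≤ scaleBeta n d q E k w * 1 := by
          gcongr
          rw [ENNReal.ofReal_le_one]
          have : 0 ≤ (2 : ℝ) ^ k * dist z w := by positivity
          linarith
      _ ≤ _ := by
          rw [mul_one]
          exact iSup₂_le fun t ht => betaE_sq_le hE hC₀ hq hqq hD hw hwz ht P hP
  · rw [ENNReal.ofReal_of_nonpos, mul_zero]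
    · exact zero_le
    · have h1 := mul_le_mul_of_nonneg_left (not_lt.1 hwz) (by positivity : (0 : ℝ) ≤ 2 ^ k)
      rw [two_pow_mul_half_pow, dist_comm] at h1
      linarith

end JonesFunction

section RegionEstimate

variable {n d : ℕ}

theorem exists_plane_infDist_le (ι : V d →ₗᵢ[ℝ] V n) (x₀ : V n) (a : V d) (c : V n)
    (L : V d →ₗ[ℝ] V n) :
    ∃ P, IsAffinePlane n d P ∧ ∀ u, infDist u P ≤
      ‖vProj ι (u - x₀) - c - L (hProj ι (u - x₀) - a)‖ := by
  set T : V d →ₗ[ℝ] V n := ι.toLinearMap + (vProj ι).toLinearMap ∘ₗ L with hT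
  have hTa : ∀ v, T v = ι v + vProj ι (L v) := fun v => rfl
  have hTinj : Function.Injective T := by
    intro v w hvw
    have := congrArg (hProj ι) hvw
    rwa [hTa, hTa, map_add, map_add, hProj_embed, hProj_embed, hProj_vProj, hProj_vProj, add_zero,
      add_zero] at this
  set A : AffineSubspace ℝ (V n) := AffineSubspace.mk' (x₀ + ι a + vProj ι c) (LinearMap.range T) with hA
  have hmem : ∀ v, x₀ + ι a + vProj ι c + T v ∈ A := fun v => by
    rw [hA, AffineSubspace.mem_mk', vsub_eq_sub, add_sub_cancel_left]
    exact ⟨v, rfl⟩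
  refine ⟨A, ⟨A, rfl, ?_, ⟨_, hmem 0⟩⟩, fun u => ?_⟩
  · rw [hA, AffineSubspace.direction_mk', LinearMap.finrank_range_of_inj hTinj, finrank_euclideanSpace,
      Fintype.card_fin]
  · refine (infDist_le_dist_of_mem (hmem (hProj ι (u - x₀) - a))).trans ?_
    have hQQ : vProj ι (vProj ι (u - x₀)) = vProj ι (u - x₀) := by
      rw [vProj_apply ι (vProj ι (u - x₀)), hProj_vProj, map_zero, sub_zero]
    have e : u - (x₀ + ι a + vProj ι c + T (hProj ι (u - x₀) - a)) =
        vProj ι (vProj ι (u - x₀) - c - L (hProj ι (u - x₀) - a)) := by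
      rw [hTa, map_sub (vProj ι), map_sub (vProj ι) _ c, hQQ, vProj_apply ι (u - x₀), map_sub ι]
      abel
    rw [dist_eq_norm, e]
    exact norm_vProj_le ι _

/-- The part of the Jones square function coming from scales above `gap`. -/
def regionSum (d : ℕ) (q : ℝ≥0∞) (E : Set (V n)) (ι : V d →ₗᵢ[ℝ] V n) (x₀ : V n) (m : ℕ) (w : V n) :
    ℝ≥0∞ :=
  ∑' i, {w | gap ι E x₀ ((1 / 2) ^ m) (hProj ι (w - x₀)) ≤ (1 / 2) ^ (m + i)}.indicator
    (jonesFun n d q E (m + i)) w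

variable {E : Set (V n)} {C₀ : ℝ}

theorem measurableSet_gap_comp_le (ι : V d →ₗᵢ[ℝ] V n) (E : Set (V n)) (x₀ : V n) (R t : ℝ) :
    MeasurableSet {w | gap ι E x₀ R (hProj ι (w - x₀)) ≤ t} :=
  (isClosed_le (continuous_gap.comp ((hProj ι).continuous.comp (by fun_prop)))
    continuous_const).measurableSet

theorem measurable_regionSum (hE : IsADRegular n d C₀ E) (hC₀ : 1 ≤ C₀) {q : ℝ≥0∞} (hq : 1 ≤ q)
    (hD : ∃ D : Submodule ℝ (V n), Module.finrank ℝ D = d) (ι : V d →ₗᵢ[ℝ] V n) (x₀ : V n) (m : ℕ) :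
    Measurable (regionSum d q E ι x₀ m) :=
  Measurable.tsum fun _ => (measurable_jonesFun hE hC₀ hq hD _).indicator
    (measurableSet_gap_comp_le ι E x₀ _ _)

theorem IsADRegular.isLocallyFinite (hE : IsADRegular n d C₀ E) :
    IsLocallyFiniteMeasure (surf n d E) := by
  refine ⟨fun x => ?_⟩
  by_cases hx : x ∈ E
  · exact ⟨ball x 1, ball_mem_nhds x one_pos,
      (hE.measure_le x hx 1 one_pos le_rfl).trans_lt ENNReal.ofReal_lt_top⟩
  · refine ⟨Eᶜ, hE.isClosed.isOpen_compl.mem_nhds hx, ?_⟩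
    rw [surf, Measure.restrict_apply hE.isClosed.isOpen_compl.measurableSet, compl_inter_self,
      measure_empty]
    exact ENNReal.zero_lt_top

theorem IsADRegular.ae_mem (hE : IsADRegular n d C₀ E) : ∀ᵐ u ∂(surf n d E), u ∈ E :=
  ae_restrict_mem hE.isClosed.measurableSet

theorem ofReal_mul_half_pow_pow {a : ℝ} (ha : 0 ≤ a) (l d : ℕ) :
    ENNReal.ofReal (a * ((1 / 2) ^ l) ^ d) = ENNReal.ofReal a * 2⁻¹ ^ (l * d) := by
  rw [← pow_mul, ENNReal.ofReal_mul ha, ofReal_half_pow]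

theorem IsADRegular.le_measure_dyadic (hE : IsADRegular n d C₀ E) (hC₀ : 1 ≤ C₀) {u : V n} (hu : u ∈ E)
    (l : ℕ) : 1 ≤ ENNReal.ofReal C₀ * 2 ^ (l * d) * surf n d E (ball u ((1 / 2) ^ l)) := by
  have h := hE.le_measure u hu ((1 / 2) ^ l) (by positivity) (pow_le_one₀ (by norm_num) (by norm_num))
  rw [ofReal_mul_half_pow_pow (by positivity)] at h
  refine le_trans (le_of_eq ?_) (mul_le_mul_right h _)
  rw [mul_mul_mul_comm, ← ENNReal.ofReal_mul (by positivity), mul_inv_cancel₀ (by positivity),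
    ← mul_pow, ENNReal.mul_inv_cancel (by norm_num) (by norm_num), one_pow, ENNReal.ofReal_one, one_mul]

theorem IsADRegular.measure_le_dyadic (hE : IsADRegular n d C₀ E) (hC₀ : 1 ≤ C₀) {u : V n} (hu : u ∈ E)
    {M : ℝ} (hM : 0 < M) {l : ℕ} (hl : M * (1 / 2) ^ l ≤ 1) :
    surf n d E (ball u (M * (1 / 2) ^ l)) ≤ ENNReal.ofReal (C₀ * M ^ d) * 2⁻¹ ^ (l * d) := by
  refine (hE.measure_le u hu _ (by positivity) hl).trans (le_of_eq ?_)
  rw [mul_pow, ← mul_assoc, ofReal_mul_half_pow_pow (by positivity)]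

/-- Carleson estimate for the scales above `gap`. -/
theorem exists_lintegral_regionSum_le (n d : ℕ) (hd : 0 < d) (hdn : d < n) {C₀ : ℝ} (hC₀ : 1 ≤ C₀)
    {q q' : ℝ≥0∞} (hq : 1 ≤ q) (hqq : q ≤ q') (hq' : 2 ≤ q') (hτ : scaleRatio d q' < 1) :
    ∃ C : ℝ≥0∞, C ≠ ⊤ ∧ ∀ (E : Set (V n)), IsADRegular n d C₀ E → ∀ (ι : V d →ₗᵢ[ℝ] V n),
      ∀ x₀ ∈ E, ∀ m : ℕ, (64 + 6 * n) * (1 / 2 : ℝ) ^ m ≤ 1 →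
      ∫⁻ w in ball x₀ (2 * (1 / 2) ^ m), regionSum d q E ι x₀ m w ∂(surf n d E) ≤
        C * 2⁻¹ ^ (m * d) := by
  have hn2 : (2 : ℝ) ≤ n := by exact_mod_cast (by omega : 2 ≤ n)
  set M : ℝ := 2 + 6 * n with hM
  have hM0 : 0 < M := by positivity
  set B : ℝ≥0∞ := ENNReal.ofReal (C₀ * M ^ d) with hB
  have hM1 : 1 ≤ M ^ d := one_le_pow₀ (by linarith)
  have hBC : ENNReal.ofReal C₀ ≤ B := ENNReal.ofReal_le_ofReal (le_mul_of_one_le_right (by linarith) hM1)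
  have hB1 : 1 ≤ B := (ENNReal.one_le_ofReal.2 hC₀).trans hBC
  obtain ⟨C, hC, hmain⟩ := exists_affine_error_carleson (G := V d) (H := V n) (X := V n) d
    (by rw [finrank_euclideanSpace, Fintype.card_fin]) q' hq' hτ n M (by positivity) le_rfl
    (by linarith) B hB1 ENNReal.ofReal_ne_top
  refine ⟨betaConst d C₀ * C, ENNReal.mul_ne_top (betaConst_ne_top d C₀) hC, ?_⟩
  intro E hE ι x₀ hx₀ m hm
  have hD : ∃ D : Submodule ℝ (V n), Module.finrank ℝ D = d :=
    ⟨LinearMap.range ι.toLinearMap, by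
      rw [LinearMap.finrank_range_of_inj ι.injective, finrank_euclideanSpace, Fintype.card_fin]⟩
  have := hE.isLocallyFinite
  set μ := surf n d E with hμ
  set g : V n → ℝ := fun u => gap ι E x₀ ((1 / 2) ^ m) (hProj ι (u - x₀)) with hg
  have hfinite : ∀ j : ℕ, ∑ i ∈ Finset.range j, ∫⁻ w in ball x₀ (2 * (1 / 2) ^ m),
      {w | g w ≤ (1 / 2) ^ (m + i)}.indicator (jonesFun n d q E (m + i)) w ∂μ ≤
      betaConst d C₀ * C * 2⁻¹ ^ (m * d) := by
    intro j
    obtain ⟨f, hf⟩ := exists_graphApprox (ι := ι) (m := m) hx₀ (m + j)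
    obtain ⟨W, hW1, hW2⟩ := hmain μ E x₀ m (m + j) f _ _ _ hf hE.ae_mem hx₀ (fun u => le_max_right _ _)
      (fun u hu l _ => (hE.le_measure_dyadic hC₀ hu l).trans (by gcongr))
      (fun u hu l hl => hE.measure_le_dyadic hC₀ hu hM0 (by
        have h1 : (1 / 2 : ℝ) ^ l ≤ (1 / 2) ^ m := pow_le_pow_of_le_one (by norm_num) (by norm_num) hl
        have h2 : M * (1 / 2 : ℝ) ^ l ≤ M * (1 / 2) ^ m := by gcongr
        have h3 : (0 : ℝ) < (1 / 2) ^ m := by positivity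
        linarith))
    calc _ ≤ ∑ i ∈ Finset.range j, betaConst d C₀ * ∫⁻ w in ball x₀ (2 * (1 / 2) ^ m) ∩
          {w | max (g w) ((1 / 2) ^ (m + j)) ≤ (1 / 2) ^ (m + i)}, W (m + i) w ∂μ := by
          refine Finset.sum_le_sum fun i hi => ?_
          have hij : i < j := Finset.mem_range.1 hi
          have hset : {w | max (g w) ((1 / 2) ^ (m + j)) ≤ (1 / 2 : ℝ) ^ (m + i)} =
              {w | g w ≤ (1 / 2) ^ (m + i)} := by
            ext w
            simp only [mem_ofPred_eq, max_le_iff, and_iff_left_iff_imp]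
            exact fun _ => pow_le_pow_of_le_one (by norm_num) (by norm_num) (by omega)
          have hms : MeasurableSet {w | g w ≤ (1 / 2) ^ (m + i)} := measurableSet_gap_comp_le ι E x₀ _ _
          rw [hset, ← lintegral_const_mul' _ _ (betaConst_ne_top d C₀), lintegral_indicator hms,
            Measure.restrict_restrict hms, inter_comm]
          refine lintegral_mono_ae ?_
          rw [ae_restrict_iff' (measurableSet_ball.inter hms)]
          filter_upwards [hE.ae_mem] with z hz hzb
          obtain ⟨c, L, hcL⟩ := hW1 (m + i) (Finset.mem_Ico.2 ⟨by omega, by omega⟩) z hz hzb.1 (by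
            have : z ∈ {w | max (g w) ((1 / 2) ^ (m + j)) ≤ (1 / 2 : ℝ) ^ (m + i)} := hset ▸ hzb.2
            exact this)
          obtain ⟨P, hP, hPu⟩ := exists_plane_infDist_le ι x₀ (hProj ι (z - x₀)) c L
          refine (jonesFun_le_eLpNorm hE hC₀ hq hqq hD z (m + i) P hP).trans ?_
          gcongr betaConst d C₀ * ?_
          refine le_trans ?_ hcL
          gcongr ?_ ^ 2
          refine eLpNorm_mono fun u => ?_
          rw [norm_smul, norm_mul]
          gcongr
          rw [Real.norm_of_nonneg infDist_nonneg]
          exact hPu u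
      _ = betaConst d C₀ * ∑ k ∈ Finset.Ico m (m + j), ∫⁻ w in ball x₀ (2 * (1 / 2) ^ m) ∩
          {w | max (g w) ((1 / 2) ^ (m + j)) ≤ (1 / 2) ^ k}, W k w ∂μ := by
          rw [Finset.mul_sum, Finset.sum_Ico_eq_sum_range, Nat.add_sub_cancel_left]
      _ ≤ betaConst d C₀ * (C * 2⁻¹ ^ (m * d)) := by gcongr
      _ = _ := by ring
  unfold regionSum
  rw [lintegral_tsum fun i => ((measurable_jonesFun hE hC₀ hq hD _).indicator
    (measurableSet_gap_comp_le ι E x₀ _ _)).aemeasurable]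
  rw [ENNReal.tsum_eq_iSup_nat]
  exact iSup_le hfinite

end RegionEstimate

section Sawtooth

variable {n d : ℕ} {ι : V d →ₗᵢ[ℝ] V n} {E : Set (V n)} {x₀ : V n} {R : ℝ}

/-- Pairs `(p, w)` such that `w` is within `τ * gap p` of a point of `E` lying almost over `p`. -/
def sawtooth (ι : V d →ₗᵢ[ℝ] V n) (E : Set (V n)) (x₀ : V n) (R τ r : ℝ) : Set (V d × V n) :=
  {z | ‖z.1‖ < (1 - 4 * τ) * r ∧ ∃ y ∈ E, ‖y - x₀‖ < (1 - 2 * τ) * r ∧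
    ‖hProj ι (y - x₀) - z.1‖ < τ * (τ * gap ι E x₀ R z.1) ∧ ‖z.2 - y‖ < τ * gap ι E x₀ R z.1}

theorem measurableSet_sawtooth (τ r : ℝ) : MeasurableSet (sawtooth ι E x₀ R τ r) := by
  have : sawtooth ι E x₀ R τ r = {z : V d × V n | ‖z.1‖ < (1 - 4 * τ) * r} ∩
      ⋃ y, ⋃ (_ : y ∈ E ∧ ‖y - x₀‖ < (1 - 2 * τ) * r),
        ({z : V d × V n | ‖hProj ι (y - x₀) - z.1‖ < τ * (τ * gap ι E x₀ R z.1)} ∩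
          {z : V d × V n | ‖z.2 - y‖ < τ * gap ι E x₀ R z.1}) := by
    ext z
    simp only [sawtooth, mem_ofPred_eq, mem_iUnion, mem_inter_iff, exists_prop, and_assoc]
  rw [this]
  have hg : Continuous fun z : V d × V n => gap ι E x₀ R z.1 := continuous_gap.comp continuous_fst
  refine (IsOpen.inter ?_ ?_).measurableSet
  · exact isOpen_lt (by fun_prop) continuous_const
  · refine isOpen_iUnion fun y => isOpen_iUnion fun _ => IsOpen.inter ?_ ?_
    · exact isOpen_lt (by fun_prop) (by fun_prop)
    · exact isOpen_lt (by fun_prop) (by fun_prop)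

variable {ε τ r : ℝ}

theorem hProj_sub_hProj (u w : V n) :
    hProj ι (u - x₀) - hProj ι (w - x₀) = hProj ι (u - w) := by
  rw [← map_sub, sub_sub_sub_cancel_right]

theorem norm_hProj_sub_lt_of_mem_sawtooth {z : V d × V n} (hz : z ∈ sawtooth ι E x₀ R τ r) :
    ‖z.1 - hProj ι (z.2 - x₀)‖ < (1 + τ) * (τ * gap ι E x₀ R z.1) := by
  obtain ⟨-, y, -, -, h1, h2⟩ := hz
  have h3 := norm_sub_le_norm_sub_add_norm_sub z.1 (hProj ι (y - x₀)) (hProj ι (z.2 - x₀))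
  rw [hProj_sub_hProj, norm_sub_rev z.1 (hProj ι (y - x₀))] at h3
  have h4 := norm_hProj_le ι (y - z.2)
  rw [norm_sub_rev y z.2] at h4
  linarith

theorem gap_pos_of_mem_sawtooth (hτ0 : 0 < τ) {z : V d × V n} (hz : z ∈ sawtooth ι E x₀ R τ r) :
    0 < gap ι E x₀ R z.1 := by
  obtain ⟨-, y, -, -, -, h2⟩ := hz
  exact pos_of_mul_pos_right ((norm_nonneg _).trans_lt h2) hτ0.le

theorem gap_hProj_le_of_mem_sawtooth (hτ0 : 0 < τ) (hτ : τ ≤ 1 / 100000) {z : V d × V n}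
    (hz : z ∈ sawtooth ι E x₀ R τ r) :
    gap ι E x₀ R (hProj ι (z.2 - x₀)) ≤ (1 + 2 * τ) * gap ι E x₀ R z.1 := by
  have h1 := norm_hProj_sub_lt_of_mem_sawtooth hz
  have h2 := gap_le_add (ι := ι) (E := E) (x₀ := x₀) (R := R) (hProj ι (z.2 - x₀)) z.1
  rw [norm_sub_rev] at h2
  have h3 := mul_pos hτ0 (gap_pos_of_mem_sawtooth hτ0 hz)
  nlinarith

theorem gap_le_of_mem_sawtooth (hτ0 : 0 < τ) (hτ : τ ≤ 1 / 100000) {z : V d × V n}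
    (hz : z ∈ sawtooth ι E x₀ R τ r) :
    gap ι E x₀ R z.1 ≤ (1 + 4 * τ) * gap ι E x₀ R (hProj ι (z.2 - x₀)) := by
  have h1 := norm_hProj_sub_lt_of_mem_sawtooth hz
  have h2 := gap_le_add (ι := ι) (E := E) (x₀ := x₀) (R := R) z.1 (hProj ι (z.2 - x₀))
  have h3 := mul_pos hτ0 (gap_pos_of_mem_sawtooth hτ0 hz)
  set g := gap ι E x₀ R z.1
  have h4 : g * (1 - 2 * τ) ≤ gap ι E x₀ R (hProj ι (z.2 - x₀)) := by nlinarith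
  have h5 : (1 - 2 * τ) * (1 + 4 * τ) ≥ 1 := by nlinarith
  nlinarith [gap_nonneg (ι := ι) (E := E) (x₀ := x₀) (R := R) z.1]

theorem mem_ball_of_mem_sawtooth (h : IsFrame ι E ε x₀ R) (hε0 : 0 ≤ ε) (hτ0 : 0 < τ)
    (hτ : τ ≤ 1 / 100000) (hετ : ε ≤ τ ^ 2 / 10000000) (hr : R / 2 < r) {z : V d × V n}
    (hz : z ∈ sawtooth ι E x₀ R τ r) : z.2 ∈ ball x₀ r := by
  have hg := h.gap_le hε0 z.1
  obtain ⟨-, y, -, h1, -, h2⟩ := hz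
  have h3 := norm_sub_le_norm_sub_add_norm_sub z.2 y x₀
  have hR := h.pos
  have hε1 : 1280 * ε ≤ 1 / 2 := by nlinarith
  have h4 : gap ι E x₀ R z.1 ≤ r := by nlinarith
  rw [mem_ball, dist_eq_norm]
  nlinarith

theorem mem_coreSet_of_mem_sawtooth (hτ0 : 0 < τ) (hτ : τ ≤ 1 / 100000) {z : V d × V n}
    (hz : z ∈ sawtooth ι E x₀ R τ r) (hc : z.1 ∈ coreSet ι E x₀ R (1 / 4)) :
    hProj ι (z.2 - x₀) ∈ coreSet ι E x₀ R (1 / 2) := by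
  obtain ⟨a, b, hab, h1, h2⟩ := hc
  refine ⟨a, b, hab, ?_, h2⟩
  have h3 := norm_hProj_sub_lt_of_mem_sawtooth hz
  have h4 := gap_le_add (ι := ι) (E := E) (x₀ := x₀) (R := R) z.1 (hProj ι (a - x₀))
  have h5 := norm_sub_le_norm_sub_add_norm_sub (hProj ι (z.2 - x₀)) z.1 (hProj ι (a - x₀))
  rw [norm_sub_rev _ z.1] at h5
  have h6 := hab.norm_pos
  have h7 : gap ι E x₀ R z.1 ≤ 9 / 4 * ‖a - b‖ := by linarith
  have h8 : (1 + τ) * (τ * gap ι E x₀ R z.1) ≤ 2 * (1 / 100000 * (9 / 4 * ‖a - b‖)) := by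
    have := gap_nonneg (ι := ι) (E := E) (x₀ := x₀) (R := R) z.1
    gcongr
    linarith
  linarith

theorem gap_pos_of_mem_coreSet {p : V d} {κ : ℝ} (hκ : κ ≤ 1) (hp : p ∈ coreSet ι E x₀ R κ) :
    0 < gap ι E x₀ R p := by
  obtain ⟨a, b, hab, h1, -⟩ := hp
  have h2 := hab.le_gap p
  have h3 := hab.norm_pos
  nlinarith

/-- The weight normalizing the sections of the sawtooth region. -/
def gapWeight (ι : V d →ₗᵢ[ℝ] V n) (E : Set (V n)) (x₀ : V n) (R τ : ℝ) (p : V d) : ℝ≥0∞ :=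
  (ENNReal.ofReal ((τ * gap ι E x₀ R p) ^ d))⁻¹

theorem measurable_gapWeight (τ : ℝ) : Measurable (gapWeight ι E x₀ R τ) := by
  have := (continuous_gap (ι := ι) (E := E) (x₀ := x₀) (R := R)).measurable
  unfold gapWeight
  fun_prop

/-- Each section of the sawtooth region has normalized measure at most slightly more than the
unit ball, with a definite saving over the core. -/
theorem lintegral_section_add_le (lam : Measure (V d)) [lam.IsAddHaarMeasure] (hE : IsFlat n d ε E)
    (h : IsFrame ι E ε x₀ R) (hε0 : 0 ≤ ε) (hτ0 : 0 < τ) (hτ : τ ≤ 1 / 100000)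
    (hετ : ε ≤ τ ^ 2 / 10000000) {w : V n} (hw : w ∈ E) (hwx : ‖w - x₀‖ < R) :
    (∫⁻ p in {p | (p, w) ∈ sawtooth ι E x₀ R τ r}, gapWeight ι E x₀ R τ p ∂lam) +
      ENNReal.ofReal ((1 / 40000) ^ d) * lam (ball 0 1) *
        {w | hProj ι (w - x₀) ∈ coreSet ι E x₀ R (1 / 2)}.indicator 1 w ≤
      ENNReal.ofReal ((1 + 8 * τ) ^ (2 * d)) * lam (ball 0 1) := by
  set b := hProj ι (w - x₀) with hb
  set G := gap ι E x₀ R b with hG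
  set σ := τ * G with hσ
  set K := {p | (p, w) ∈ sawtooth ι E x₀ R τ r} with hK
  have hG0 : 0 ≤ G := gap_nonneg _
  have hΘ : (1 : ℝ) ≤ (1 + 8 * τ) ^ (2 * d) := one_le_pow₀ (by linarith)
  have hKm : MeasurableSet K := (measurableSet_sawtooth τ r).preimage measurable_prodMk_right
  have hKsub : K ⊆ ball b ((1 + 8 * τ) * σ) := by
    intro p hp
    have h1 := norm_hProj_sub_lt_of_mem_sawtooth hp
    have h2 := gap_le_of_mem_sawtooth hτ0 hτ hp
    rw [mem_ball, dist_eq_norm]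
    refine h1.trans_le ?_
    have h3 : (1 + τ) * (τ * gap ι E x₀ R p) ≤ (1 + τ) * (τ * ((1 + 4 * τ) * G)) := by gcongr
    have h4 : (1 + τ) * (1 + 4 * τ) ≤ 1 + 8 * τ := by nlinarith
    calc _ ≤ _ := h3
      _ = (1 + τ) * (1 + 4 * τ) * σ := by rw [hσ]; ring
      _ ≤ _ := by gcongr
  have hhole : ENNReal.ofReal ((1 / 40000) ^ d) ≤ 1 :=
    ENNReal.ofReal_le_one.2 (pow_le_one₀ (by norm_num) (by norm_num))
  have hind : {w | hProj ι (w - x₀) ∈ coreSet ι E x₀ R (1 / 2)}.indicator (1 : V n → ℝ≥0∞) w ≤ 1 := by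
    unfold indicator; split_ifs <;> simp
  rcases hG0.lt_or_eq with hGpos | hG00
  · have hσ0 : 0 < σ := by positivity
    have hweight : ∀ p ∈ K, gapWeight ι E x₀ R τ p ≤ ENNReal.ofReal ((1 + 8 * τ) ^ d * (σ ^ d)⁻¹) := by
      intro p hp
      have h1 := gap_hProj_le_of_mem_sawtooth hτ0 hτ hp
      have h2 := gap_pos_of_mem_sawtooth hτ0 hp
      have h2 : 0 < τ * gap ι E x₀ R p := mul_pos hτ0 h2
      rw [gapWeight, ← ENNReal.ofReal_inv_of_pos (by positivity)]
      refine ENNReal.ofReal_le_ofReal ?_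
      rw [← div_eq_mul_inv, ← div_pow, ← inv_pow]
      refine pow_le_pow_left₀ (by positivity) ?_ d
      rw [inv_eq_one_div, div_le_div_iff₀ h2 hσ0]
      have h3 : σ ≤ τ * ((1 + 2 * τ) * gap ι E x₀ R p) := by rw [hσ]; gcongr
      nlinarith
    have h_int : ∫⁻ p in K, gapWeight ι E x₀ R τ p ∂lam ≤
        ENNReal.ofReal ((1 + 8 * τ) ^ d * (σ ^ d)⁻¹) * lam K := by
      rw [← setLIntegral_const]
      exact setLIntegral_mono' hKm hweight
    have hball : lam (ball b ((1 + 8 * τ) * σ)) = ENNReal.ofReal (((1 + 8 * τ) * σ) ^ d) * lam (ball 0 1) := by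
      rw [Measure.addHaar_ball_of_pos lam b (by positivity : 0 < (1 + 8 * τ) * σ), finrank_euclideanSpace,
        Fintype.card_fin]
    have hKmeas : lam K + ENNReal.ofReal ((1 / 40000 * σ) ^ d) * lam (ball 0 1) *
        {w | hProj ι (w - x₀) ∈ coreSet ι E x₀ R (1 / 2)}.indicator 1 w ≤
        ENNReal.ofReal (((1 + 8 * τ) * σ) ^ d) * lam (ball 0 1) := by
      by_cases hcore : b ∈ coreSet ι E x₀ R (1 / 2)
      · rw [indicator_of_mem (by exact hcore), Pi.one_apply, mul_one]
        obtain ⟨c, hc1, hc2⟩ := exists_hole hE h hε0 hτ0 hτ (by nlinarith) hw hwx hcore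
        have hcball : lam (ball c (1 / 40000 * σ)) =
            ENNReal.ofReal ((1 / 40000 * σ) ^ d) * lam (ball 0 1) := by
          rw [Measure.addHaar_ball_of_pos lam c (by positivity : 0 < 1 / 40000 * σ),
            finrank_euclideanSpace, Fintype.card_fin]
        rw [← hcball, ← hball, ← measure_union _ measurableSet_ball]
        · refine measure_mono (union_subset hKsub (ball_subset_ball' ?_))
          rw [dist_eq_norm]
          have : 0 ≤ τ * σ := by positivity
          linarith
        · refine Set.disjoint_left.2 fun p hp hpc => ?_
          obtain ⟨-, y, hy, -, h1, h2⟩ := hp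
          have := hc2 p y hy h1 h2
          rw [mem_ball, dist_eq_norm] at hpc
          linarith
      · rw [indicator_of_notMem (by exact hcore), mul_zero, add_zero, ← hball]
        exact measure_mono hKsub
    have hσd : σ ^ d ≠ 0 := by positivity
    calc _ ≤ ENNReal.ofReal ((1 + 8 * τ) ^ d * (σ ^ d)⁻¹) * lam K +
          ENNReal.ofReal ((1 + 8 * τ) ^ d * (σ ^ d)⁻¹) * (ENNReal.ofReal ((1 / 40000 * σ) ^ d) *
            lam (ball 0 1) * {w | hProj ι (w - x₀) ∈ coreSet ι E x₀ R (1 / 2)}.indicator 1 w) := by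
          refine add_le_add h_int ?_
          rw [← mul_assoc, ← mul_assoc, ← ENNReal.ofReal_mul (by positivity)]
          gcongr
          have : (1 + 8 * τ) ^ d * (σ ^ d)⁻¹ * (1 / 40000 * σ) ^ d =
              (1 + 8 * τ) ^ d * (1 / 40000) ^ d := by
            rw [mul_pow (1 / 40000 : ℝ) σ d, mul_comm ((1 / 40000 : ℝ) ^ d), mul_assoc,
              inv_mul_cancel_left₀ hσd]
          rw [this]
          exact le_mul_of_one_le_left (by positivity) (one_le_pow₀ (by linarith))
      _ = ENNReal.ofReal ((1 + 8 * τ) ^ d * (σ ^ d)⁻¹) * _ := (mul_add _ _ _).symm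
      _ ≤ _ := mul_le_mul_right hKmeas _
      _ = _ := by
          rw [← mul_assoc, ← ENNReal.ofReal_mul (by positivity)]
          congr 2
          rw [mul_pow (1 + 8 * τ) σ d, mul_comm ((1 + 8 * τ) ^ d) (σ ^ d), mul_assoc,
            inv_mul_cancel_left₀ hσd, two_mul, pow_add]
  · have hKe : K = ∅ := by
      rw [Set.eq_empty_iff_forall_notMem]
      intro p hp
      have h1 := hKsub hp
      rw [hσ, ← hG00, mul_zero, mul_zero, ball_zero] at h1
      exact h1
    rw [hKe, Measure.restrict_empty, lintegral_zero_measure, zero_add]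
    calc _ ≤ 1 * lam (ball 0 1) * 1 := by gcongr
      _ = ENNReal.ofReal 1 * lam (ball 0 1) := by rw [ENNReal.ofReal_one, mul_one]
      _ ≤ _ := by gcongr

end Sawtooth

theorem lintegral_mul_measure_section_le {X Y : Type*} [MeasurableSpace X] [MeasurableSpace Y]
    {lam : Measure X} {μ : Measure Y} [SFinite lam] [SFinite μ] {K : Set (X × Y)}
    (hK : MeasurableSet K) {v : X → ℝ≥0∞} (hv : Measurable v) {S : Set X} (hS : MeasurableSet S)
    {T G : Set Y} (hT : MeasurableSet T)
    (hKT : ∀ p ∈ S, ∀ w, (p, w) ∈ K → w ∈ T) :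
    ∫⁻ p in S, v p * μ ({w | (p, w) ∈ K} ∩ G) ∂lam ≤
      ∫⁻ w in T ∩ G, (∫⁻ p in {p | (p, w) ∈ K}, v p ∂lam) ∂μ := by
  have hKp : ∀ p, MeasurableSet {w | (p, w) ∈ K} := fun p => hK.preimage measurable_prodMk_left
  have hKw : ∀ w, MeasurableSet {p | (p, w) ∈ K} := fun w => hK.preimage measurable_prodMk_right
  have h1 : ∀ p, v p * μ ({w | (p, w) ∈ K} ∩ G) =
      ∫⁻ w in G, K.indicator (fun z => v z.1) (p, w) ∂μ := by
    intro p
    have : (fun w => K.indicator (fun z => v z.1) (p, w)) =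
        {w | (p, w) ∈ K}.indicator fun _ => v p := by
      ext w; simp [indicator]
    rw [this, lintegral_indicator (hKp p), setLIntegral_const, Measure.restrict_apply (hKp p)]
  simp_rw [h1]
  rw [lintegral_lintegral_swap]
  · rw [← Measure.restrict_restrict hT, ← lintegral_indicator hT]
    refine lintegral_mono fun w => ?_
    by_cases hw : w ∈ T
    · rw [indicator_of_mem hw]
      have : (fun p => K.indicator (fun z => v z.1) (p, w)) = {p | (p, w) ∈ K}.indicator v := by
        ext p; simp [indicator]
      rw [this, lintegral_indicator (hKw w)]
      exact lintegral_mono' (Measure.restrict_mono le_rfl Measure.restrict_le_self) le_rfl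
    · rw [indicator_of_notMem hw, nonpos_iff_eq_zero]
      refine (setLIntegral_congr_fun hS fun p hp => ?_).trans lintegral_zero
      exact indicator_of_notMem (fun h => hw (hKT p hp w h)) _
  · exact ((hv.comp measurable_fst).indicator hK).aemeasurable

section Pointwise

variable {n d : ℕ} {ι : V d →ₗᵢ[ℝ] V n} {E : Set (V n)} {x₀ : V n} {q b : ℝ≥0∞}

theorem tailSum_le_regionSum_add (hF : ∀ k z, jonesFun n d q E k z ≤ b) {m l N : ℕ} (hml : m ≤ l)
    {w : V n} (hw : gap ι E x₀ ((1 / 2) ^ m) (hProj ι (w - x₀)) ≤ 2 ^ N * (1 / 2) ^ l) :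
    tailSum (jonesFun n d q E) m w ≤
      regionSum d q E ι x₀ m w + N * b + tailSum (jonesFun n d q E) l w := by
  rcases le_total l (m + N) with hl | hl
  · obtain ⟨i, rfl⟩ := Nat.exists_eq_add_of_le hml
    calc _ ≤ (i : ℝ≥0∞) * b + tailSum (jonesFun n d q E) (m + i) w := tailSum_le_add hF m i w
      _ ≤ N * b + tailSum (jonesFun n d q E) (m + i) w := by
          gcongr; omega
      _ ≤ _ := by gcongr; exact le_add_self
  · obtain ⟨i, hi⟩ := Nat.exists_eq_add_of_le hl
    have hl' : l = m + i + N := by omega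
    rw [tailSum_eq_sum_add _ m i, add_assoc]
    refine add_le_add ?_ (hl' ▸ tailSum_le_add hF (m + i) N w)
    refine le_trans (Finset.sum_le_sum fun j hj => ?_) (ENNReal.sum_le_tsum (Finset.range i))
    rw [indicator_of_mem]
    refine hw.trans ?_
    rw [hl', pow_add, mul_comm ((1 / 2 : ℝ) ^ (m + i)), ← mul_assoc, two_pow_mul_half_pow, one_mul]
    have := Finset.mem_range.1 hj
    exact pow_le_pow_of_le_one (by norm_num) (by norm_num) (by omega)

/-- Points where the square function is bounded, or where its part over the region above the
graph is large. -/
def tameSet (n d : ℕ) (q : ℝ≥0∞) (E : Set (V n)) (ι : V d →ₗᵢ[ℝ] V n) (x₀ : V n) (m : ℕ)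
    (A A' : ℝ≥0∞) : Set (V n) :=
  {w | tailSum (jonesFun n d q E) m w ≤ A} ∪ {w | A' < regionSum d q E ι x₀ m w}

/-- In every small ball centred on `E` either a definite proportion of the points has bounded
square function, or the measure is at least `a * r ^ d`. -/
def MassAlternative (n d : ℕ) (q : ℝ≥0∞) (E : Set (V n)) (m₀ : ℕ) (θ a : ℝ) (A : ℝ≥0∞) : Prop :=
  ∀ x ∈ E, ∀ m, m₀ ≤ m → ∀ r ∈ Ioc ((1 / 2 : ℝ) ^ (m + 1)) ((1 / 2) ^ m),
    ENNReal.ofReal (θ * r ^ d) ≤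
        surf n d E (ball x r ∩ {z | tailSum (jonesFun n d q E) m z ≤ A}) ∨
      ENNReal.ofReal (a * r ^ d) ≤ surf n d E (ball x r)

variable {ε τ r θ a : ℝ} {A A' : ℝ≥0∞} {m₀ m N : ℕ}

theorem MassAlternative.le_gapWeight_mul (hM : MassAlternative n d q E m₀ θ a A) (hm : m₀ ≤ m)
    (hE : IsFlat n d ε E) (h : IsFrame ι E ε x₀ ((1 / 2) ^ m)) (hε0 : 0 ≤ ε) (hτ0 : 0 < τ)
    (hτ : τ ≤ 1 / 100000) (hετ : ε ≤ τ ^ 2 / 10000000) (hθ : 0 < θ) (ha : 0 < a)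
    (hr : r ∈ Ioc ((1 / 2 : ℝ) ^ (m + 1)) ((1 / 2) ^ m))
    (hF : ∀ k z, jonesFun n d q E k z ≤ b) (hN : 2 / τ ≤ 2 ^ N) {p : V d}
    (hp : ‖p‖ < (1 - 4 * τ) * r) (hg : 0 < gap ι E x₀ ((1 / 2) ^ m) p) :
    ENNReal.ofReal a ≤ gapWeight ι E x₀ ((1 / 2) ^ m) τ p *
      surf n d E {w | (p, w) ∈ sawtooth ι E x₀ ((1 / 2) ^ m) τ r} +
      ENNReal.ofReal (a / θ) * (gapWeight ι E x₀ ((1 / 2) ^ m) τ p *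
        surf n d E ({w | (p, w) ∈ sawtooth ι E x₀ ((1 / 2) ^ m) τ r} ∩
          tameSet n d q E ι x₀ m (A' + N * b + A) A')) := by
  set R : ℝ := (1 / 2) ^ m with hR
  set K := {w | (p, w) ∈ sawtooth ι E x₀ R τ r} with hK
  set s := τ * gap ι E x₀ R p with hs
  have hR0 : 0 < R := h.pos
  have hrR : R / 2 < r := by have := hr.1; rw [pow_succ] at this; linarith
  have hr0 : 0 < r := by linarith
  have hs0 : 0 < s := by positivity
  have hpR : ‖p‖ ≤ R := by have := hr.2; nlinarith
  obtain ⟨y, hyE, hy1, hy2⟩ := exists_near_of_gap_pos (c := τ ^ 2 / 4) hE h hε0 (by nlinarith)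
    (by linarith) hpR hg
  have hsub : ball y s ⊆ K := by
    intro w hw
    rw [mem_ball, dist_eq_norm] at hw
    refine ⟨hp, y, hyE, ?_, ?_, hw⟩
    · have : τ * (τ * R) ≤ τ * (1 * (2 * r)) := by gcongr <;> linarith
      nlinarith
    · change _ < τ * s
      have : 0 < τ * s := by positivity
      have e : 2 * (τ ^ 2 / 4) * gap ι E x₀ R p = τ * s / 2 := by rw [hs]; ring
      linarith
  have hsR : s ≤ R := by
    have h1 := h.gap_le hε0 p
    have h2 : 1280 * ε ≤ 1 := by nlinarith
    nlinarith
  obtain ⟨l, hl1, hl2⟩ := exists_nat_pow_near_of_lt_one hs0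
    (hsR.trans (pow_le_one₀ (by norm_num) (by norm_num))) (by norm_num : (0 : ℝ) < 1 / 2)
    (by norm_num)
  have hml : m ≤ l := by
    have : (1 / 2 : ℝ) ^ (l + 1) < (1 / 2) ^ m := hl1.trans_le hsR
    have := (pow_lt_pow_iff_right_of_lt_one₀ (by norm_num) (by norm_num)).1 this
    omega
  have hsd : 0 < s ^ d := by positivity
  have hwt : gapWeight ι E x₀ R τ p = ENNReal.ofReal ((s ^ d)⁻¹) := by
    rw [gapWeight, ← ENNReal.ofReal_inv_of_pos (by positivity)]
  rcases hM y hyE l (hm.trans hml) s ⟨hl1, hl2⟩ with h1 | h1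
  · refine le_add_left ?_
    have h2 : ball y s ∩ {z | tailSum (jonesFun n d q E) l z ≤ A} ⊆
        K ∩ tameSet n d q E ι x₀ m (A' + N * b + A) A' := by
      rintro w ⟨hw1, hw2⟩
      refine ⟨hsub hw1, ?_⟩
      by_cases hI : A' < regionSum d q E ι x₀ m w
      · exact Or.inr hI
      · left
        refine (tailSum_le_regionSum_add (ι := ι) (x₀ := x₀) (N := N) hF hml ?_).trans
          (add_le_add (add_le_add (not_lt.1 hI) le_rfl) hw2)
        have h3 := gap_hProj_le_of_mem_sawtooth hτ0 hτ (hsub hw1)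
        have h4 : gap ι E x₀ R p = s / τ := by rw [hs]; field_simp
        calc _ ≤ _ := h3
          _ ≤ 2 * gap ι E x₀ R p := by gcongr; linarith
          _ = 2 / τ * s := by rw [h4]; ring
          _ ≤ _ := by gcongr
    calc ENNReal.ofReal a = ENNReal.ofReal (a / θ) * (ENNReal.ofReal ((s ^ d)⁻¹) *
          ENNReal.ofReal (θ * s ^ d)) := by
          rw [← ENNReal.ofReal_mul (by positivity), ← ENNReal.ofReal_mul (by positivity)]
          congr 1; field_simp
      _ ≤ _ := by
          rw [hwt]
          gcongr
          exact h1.trans (measure_mono h2)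
  · refine le_add_right ?_
    calc ENNReal.ofReal a = ENNReal.ofReal ((s ^ d)⁻¹) * ENNReal.ofReal (a * s ^ d) := by
          rw [← ENNReal.ofReal_mul (by positivity)]
          congr 1; field_simp
      _ ≤ _ := by
          rw [hwt]
          gcongr
          exact h1.trans (measure_mono hsub)

end Pointwise

instance isAddHaarMeasure_hausdorffMeasure_euclidean (d : ℕ) :
    (μH[(d : ℝ)] : Measure (V d)).IsAddHaarMeasure := by
  simpa using isAddHaarMeasure_hausdorffMeasure (E := EuclideanSpace ℝ (Fin d))

section Integrated

variable {n d : ℕ} {ι : V d →ₗᵢ[ℝ] V n} {E : Set (V n)} {x₀ : V n} {q b : ℝ≥0∞}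
  {ε τ r θ a C₀ : ℝ} {A A' : ℝ≥0∞} {m₀ m N : ℕ}

/-- The normalized measure of the section of the sawtooth region over `w`. -/
def sectionMass (ι : V d →ₗᵢ[ℝ] V n) (E : Set (V n)) (x₀ : V n) (R τ r : ℝ) (w : V n) : ℝ≥0∞ :=
  ∫⁻ p in {p | (p, w) ∈ sawtooth ι E x₀ R τ r}, gapWeight ι E x₀ R τ p ∂(μH[(d : ℝ)] : Measure (V d))

theorem MassAlternative.mul_measure_le (hM : MassAlternative n d q E m₀ θ a A) (hm : m₀ ≤ m)
    (hE : IsFlat n d ε E) (hAD : IsADRegular n d C₀ E)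
    (h : IsFrame ι E ε x₀ ((1 / 2) ^ m)) (hε0 : 0 ≤ ε) (hτ0 : 0 < τ)
    (hτ : τ ≤ 1 / 100000) (hετ : ε ≤ τ ^ 2 / 10000000) (hθ : 0 < θ) (ha : 0 < a)
    (hr : r ∈ Ioc ((1 / 2 : ℝ) ^ (m + 1)) ((1 / 2) ^ m))
    (hF : ∀ k z, jonesFun n d q E k z ≤ b) (hN : 2 / τ ≤ 2 ^ N) {S : Set (V d)}
    (hSm : MeasurableSet S) (hS : S ⊆ ball 0 ((1 - 4 * τ) * r))
    (hSg : ∀ p ∈ S, 0 < gap ι E x₀ ((1 / 2) ^ m) p) {T : Set (V n)} (hTm : MeasurableSet T)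
    (hST : ∀ p ∈ S, ∀ w, (p, w) ∈ sawtooth ι E x₀ ((1 / 2) ^ m) τ r → w ∈ T) :
    ENNReal.ofReal a * μH[(d : ℝ)] S ≤
      ∫⁻ w in T, sectionMass ι E x₀ ((1 / 2) ^ m) τ r w ∂(surf n d E) +
      ENNReal.ofReal (a / θ) * ∫⁻ w in ball x₀ r ∩ tameSet n d q E ι x₀ m (A' + N * b + A) A',
        sectionMass ι E x₀ ((1 / 2) ^ m) τ r w ∂(surf n d E) := by
  have := hAD.isLocallyFinite
  have hrR : (1 / 2 : ℝ) ^ m / 2 < r := by have := hr.1; rw [pow_succ] at this; linarith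
  have hK : MeasurableSet (sawtooth ι E x₀ ((1 / 2) ^ m) τ r) := measurableSet_sawtooth τ r
  have hv : Measurable (gapWeight ι E x₀ ((1 / 2) ^ m) τ) := measurable_gapWeight τ
  have hball : ∀ p ∈ S, ∀ w, (p, w) ∈ sawtooth ι E x₀ ((1 / 2) ^ m) τ r → w ∈ ball x₀ r :=
    fun p _ w hw => mem_ball_of_mem_sawtooth (z := (p, w)) h hε0 hτ0 hτ hετ hrR hw
  calc ENNReal.ofReal a * μH[(d : ℝ)] S = ∫⁻ p in S, ENNReal.ofReal a ∂μH[(d : ℝ)] := by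
        rw [setLIntegral_const]
    _ ≤ ∫⁻ p in S, (gapWeight ι E x₀ ((1 / 2) ^ m) τ p *
          surf n d E {w | (p, w) ∈ sawtooth ι E x₀ ((1 / 2) ^ m) τ r} +
        ENNReal.ofReal (a / θ) * (gapWeight ι E x₀ ((1 / 2) ^ m) τ p *
          surf n d E ({w | (p, w) ∈ sawtooth ι E x₀ ((1 / 2) ^ m) τ r} ∩
            tameSet n d q E ι x₀ m (A' + N * b + A) A'))) ∂μH[(d : ℝ)] := by
        refine setLIntegral_mono' hSm fun p hp => ?_
        exact hM.le_gapWeight_mul hm hE h hε0 hτ0 hτ hετ hθ ha hr hF hN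
          (by simpa using hS hp) (hSg p hp)
    _ = ∫⁻ p in S, gapWeight ι E x₀ ((1 / 2) ^ m) τ p *
          surf n d E {w | (p, w) ∈ sawtooth ι E x₀ ((1 / 2) ^ m) τ r} ∂μH[(d : ℝ)] +
        ENNReal.ofReal (a / θ) * ∫⁻ p in S, (gapWeight ι E x₀ ((1 / 2) ^ m) τ p *
          surf n d E ({w | (p, w) ∈ sawtooth ι E x₀ ((1 / 2) ^ m) τ r} ∩
            tameSet n d q E ι x₀ m (A' + N * b + A) A')) ∂μH[(d : ℝ)] := by
        rw [lintegral_add_left, lintegral_const_mul' _ _ ENNReal.ofReal_ne_top]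
        exact hv.mul (measurable_measure_prodMk_left hK)
    _ ≤ _ := by
        refine add_le_add ?_ (mul_le_mul_right ?_ _)
        · have := lintegral_mul_measure_section_le (μ := surf n d E) (lam := μH[(d : ℝ)]) hK hv hSm
            (G := univ) hTm hST
          simpa only [inter_univ, sectionMass] using this
        · simp only [sectionMass]
          exact lintegral_mul_measure_section_le (μ := surf n d E) (lam := μH[(d : ℝ)]) hK hv hSm
            (G := tameSet n d q E ι x₀ m (A' + N * b + A) A') measurableSet_ball hball

/-- The part of `E` over which there is no bad chord is a Lipschitz image in the other direction. -/
theorem hausdorffMeasure_gap_zero_le (hE : IsFlat n d ε E) (hAD : IsADRegular n d C₀ E)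
    (h : IsFrame ι E ε x₀ ((1 / 2) ^ m)) (hε0 : 0 ≤ ε) (hτ0 : 0 < τ)
    (hτ : τ ≤ 1 / 100000) (hετ : ε ≤ τ ^ 2 / 10000000)
    (hr : r ∈ Ioc ((1 / 2 : ℝ) ^ (m + 1)) ((1 / 2) ^ m)) (hA : A' ≤ A) :
    μH[(d : ℝ)] (ball (0 : V d) ((1 - 8 * τ) * r) ∩ {p | gap ι E x₀ ((1 / 2) ^ m) p = 0}) ≤
      surf n d E (ball x₀ r ∩ tameSet n d q E ι x₀ m A A') := by
  set R : ℝ := (1 / 2) ^ m with hR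
  have hrR : R / 2 < r := by have := hr.1; rw [pow_succ] at this; linarith
  have hR0 : 0 < R := h.pos
  set W₀ := ball x₀ r ∩ {w | gap ι E x₀ R (hProj ι (w - x₀)) = 0} with hW₀
  have hcont : Continuous fun w => gap ι E x₀ R (hProj ι (w - x₀)) :=
    continuous_gap.comp (by fun_prop)
  have hW₀m : MeasurableSet W₀ :=
    measurableSet_ball.inter (isClosed_eq hcont continuous_const).measurableSet
  have hsub : W₀ ⊆ ball x₀ r ∩ tameSet n d q E ι x₀ m A A' := by
    rintro w ⟨hw1, hw2⟩
    refine ⟨hw1, ?_⟩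
    by_cases hI : A' < regionSum d q E ι x₀ m w
    · exact Or.inr hI
    · left
      refine le_trans (le_of_eq ?_) ((not_lt.1 hI).trans hA)
      refine tsum_congr fun i => ?_
      rw [indicator_of_mem]
      change gap ι E x₀ R (hProj ι (w - x₀)) ≤ _
      rw [show gap ι E x₀ R (hProj ι (w - x₀)) = 0 from hw2]
      positivity
  have hlip : LipschitzWith 1 fun w => hProj ι (w - x₀) := by
    refine LipschitzWith.of_dist_le_mul fun u w => ?_
    rw [dist_eq_norm, dist_eq_norm, hProj_sub_hProj, NNReal.coe_one, one_mul]
    exact norm_hProj_le ι _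
  have himg : ball (0 : V d) ((1 - 8 * τ) * r) ∩ {p | gap ι E x₀ R p = 0} ⊆
      (fun w => hProj ι (w - x₀)) '' (W₀ ∩ E) := by
    rintro p ⟨hp1, hp2⟩
    rw [mem_ball_zero_iff] at hp1
    obtain ⟨y, hyE, hy1, hy2⟩ := exists_over_of_gap_eq_zero (c := τ ^ 2 / 4) hE hAD.isClosed h hε0
      (by nlinarith) (by linarith) (by have := hr.2; nlinarith) hp2
    refine ⟨y, ⟨⟨?_, ?_⟩, hyE⟩, hy1⟩
    · rw [mem_ball, dist_eq_norm]
      have : τ * (τ * R) ≤ τ * (1 * (2 * r)) := by gcongr <;> linarith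
      nlinarith
    · change gap ι E x₀ R (hProj ι (y - x₀)) = 0
      rw [hy1]; exact hp2
  calc _ ≤ μH[(d : ℝ)] ((fun w => hProj ι (w - x₀)) '' (W₀ ∩ E)) := measure_mono himg
    _ ≤ μH[(d : ℝ)] (W₀ ∩ E) := by
        simpa using hlip.hausdorffMeasure_image_le (Nat.cast_nonneg d) (W₀ ∩ E)
    _ = surf n d E W₀ := (Measure.restrict_apply hW₀m).symm
    _ ≤ _ := measure_mono hsub

theorem setLIntegral_sectionMass_le (hE : IsFlat n d ε E) (hAD : IsADRegular n d C₀ E)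
    (h : IsFrame ι E ε x₀ ((1 / 2) ^ m)) (hε0 : 0 ≤ ε) (hτ0 : 0 < τ)
    (hτ : τ ≤ 1 / 100000) (hετ : ε ≤ τ ^ 2 / 10000000) (hr : r ≤ (1 / 2) ^ m) {T : Set (V n)}
    (hT : T ⊆ ball x₀ r) :
    ∫⁻ w in T, sectionMass ι E x₀ ((1 / 2) ^ m) τ r w ∂(surf n d E) +
      ENNReal.ofReal ((1 / 40000) ^ d) * μH[(d : ℝ)] (ball (0 : V d) 1) *
        surf n d E ({w | hProj ι (w - x₀) ∈ coreSet ι E x₀ ((1 / 2) ^ m) (1 / 2)} ∩ T) ≤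
      ENNReal.ofReal ((1 + 8 * τ) ^ (2 * d)) * μH[(d : ℝ)] (ball (0 : V d) 1) * surf n d E T := by
  have hcm : MeasurableSet {w | hProj ι (w - x₀) ∈ coreSet ι E x₀ ((1 / 2) ^ m) (1 / 2)} :=
    ((isOpen_coreSet _).preimage (by fun_prop : Continuous fun w => hProj ι (w - x₀))).measurableSet
  have hone : surf n d E ({w | hProj ι (w - x₀) ∈ coreSet ι E x₀ ((1 / 2) ^ m) (1 / 2)} ∩ T) =
      ∫⁻ w in T, {w | hProj ι (w - x₀) ∈ coreSet ι E x₀ ((1 / 2) ^ m) (1 / 2)}.indicator 1 w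
        ∂(surf n d E) := by
    rw [lintegral_indicator_one hcm, Measure.restrict_apply hcm]
  rw [hone, ← lintegral_const_mul _ (measurable_one.indicator hcm), ← lintegral_add_right _
    ((measurable_one.indicator hcm).const_mul _),
    ← setLIntegral_const T]
  refine lintegral_mono_ae ?_
  have hTae : ∀ᵐ w ∂(surf n d E).restrict T, w ∈ ball x₀ r :=
    ae_mono (Measure.restrict_mono hT le_rfl) (ae_restrict_mem measurableSet_ball)
  filter_upwards [ae_restrict_of_ae hAD.ae_mem, hTae] with w hwE hw
  rw [mem_ball, dist_eq_norm] at hw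
  exact lintegral_section_add_le μH[(d : ℝ)] hE h hε0 hτ0 hτ hετ hwE (hw.trans_le hr)

end Integrated

theorem mass_growth_real {a h ω Θ M Mc G LP LPc L H κ θ θ' ρ t : ℝ} (ha : 0 < a) (hω : 0 < ω)
    (hΘ0 : 0 < Θ) (hΘ : Θ ≤ 2) (h0 : 0 ≤ h) (h1 : h ≤ 1) (hH : 0 < H) (hκ : κ = h / 2 / H)
    (hθ : 0 < θ) (hρ : 0 < ρ) (hMc : 0 ≤ Mc) (hG : 0 ≤ G)
    (hA : a * LP + h * ω * Mc ≤ Θ * ω * M + a / θ * (Θ * ω * G))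
    (hB : a * LPc ≤ Θ * ω * Mc + a / θ * (Θ * ω * G))
    (hL : L ≤ LP) (hLc : L ≤ H * LPc) (hZ : t * ρ * ω ≤ L + G) (hGθ : G ≤ 2 * θ' * ρ)
    (ht : (1 + κ / 8) * Θ ≤ (1 + κ / 2) * t) (ht2 : 1 / 2 ≤ t)
    (hθ' : θ' * ((1 + κ) + 3 * ω / θ) = κ / 8 * ω) : a * (1 + κ / 8) * ρ ≤ M := by
  have hκ0 : 0 ≤ κ := by rw [hκ]; positivity
  have e1 : a * L * (1 + κ) ≤ a * LP + h / 2 * (a * LPc) := by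
    have : κ * L ≤ h / 2 * LPc := by
      calc κ * L ≤ κ * (H * LPc) := by gcongr
        _ = _ := by rw [hκ]; field_simp
    nlinarith
  set X := a / θ * (ω * G) with hX
  have hX0 : 0 ≤ X := by positivity
  have e2 : a / θ * (Θ * ω * G) = Θ * X := by rw [hX]; ring
  rw [e2] at hA hB
  have e3 : a * L * (1 + κ) ≤ Θ * ω * M + 3 * X := by
    have p1 : h / 2 * (a * LPc) ≤ h / 2 * (Θ * ω * Mc + Θ * X) := by gcongr
    have p2 : Θ * (h * (ω * Mc)) ≤ 2 * (h * (ω * Mc)) := by gcongr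
    have p3 : Θ * X ≤ 2 * X := by gcongr
    have p4 : h * (Θ * X) ≤ 1 * (2 * X) := by gcongr
    nlinarith
  have e4 : a * (1 + κ) * (t * ρ * ω) ≤ Θ * ω * M + a * ((1 + κ) + 3 * ω / θ) * G := by
    have p1 : a * (1 + κ) * (t * ρ * ω) ≤ a * (1 + κ) * (L + G) := by gcongr
    have p2 : 3 * X = a * (3 * ω / θ) * G := by rw [hX]; ring
    nlinarith
  have e5 : a * ((1 + κ) + 3 * ω / θ) * G ≤ a * (κ / 4) * ω * ρ := by
    calc a * ((1 + κ) + 3 * ω / θ) * G ≤ a * ((1 + κ) + 3 * ω / θ) * (2 * θ' * ρ) := by gcongr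
      _ = 2 * a * ρ * (θ' * ((1 + κ) + 3 * ω / θ)) := by ring
      _ = _ := by rw [hθ']; ring
  have e6 : ω * (Θ * (a * (1 + κ / 8) * ρ)) ≤ ω * (Θ * M) := by
    have p1 : a * ρ * ω * ((1 + κ / 8) * Θ) ≤ a * ρ * ω * ((1 + κ / 2) * t) := by gcongr
    have p2 : a * ρ * ω * κ * (1 / 2) ≤ a * ρ * ω * κ * t := by gcongr
    nlinarith
  exact le_of_mul_le_mul_left (le_of_mul_le_mul_left e6 hω) hΘ0

theorem mass_growth {a h Θ H κ θ θ' ρ t : ℝ} {ω M Mc G LP LPc L : ℝ≥0∞} (ha : 0 < a) (hω0 : ω ≠ 0)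
    (hω : ω ≠ ⊤) (hMt : M ≠ ⊤) (hMct : Mc ≠ ⊤) (hGt : G ≠ ⊤) (hLPt : LP ≠ ⊤) (hLPct : LPc ≠ ⊤)
    (hLt : L ≠ ⊤) (hΘ0 : 0 < Θ) (hΘ : Θ ≤ 2) (h0 : 0 ≤ h) (h1 : h ≤ 1) (hH : 0 < H)
    (hκ : κ = h / 2 / H) (hθ : 0 < θ) (hθ0 : 0 < θ') (hρ : 0 < ρ)
    (hA : ENNReal.ofReal a * LP + ENNReal.ofReal h * ω * Mc ≤
      ENNReal.ofReal Θ * ω * M + ENNReal.ofReal (a / θ) * (ENNReal.ofReal Θ * ω * G))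
    (hB : ENNReal.ofReal a * LPc ≤
      ENNReal.ofReal Θ * ω * Mc + ENNReal.ofReal (a / θ) * (ENNReal.ofReal Θ * ω * G))
    (hL : L ≤ LP) (hLc : L ≤ ENNReal.ofReal H * LPc) (hZ : ENNReal.ofReal (t * ρ) * ω ≤ L + G)
    (hGθ : G ≤ ENNReal.ofReal (2 * θ' * ρ)) (ht : (1 + κ / 8) * Θ ≤ (1 + κ / 2) * t)
    (ht2 : 1 / 2 ≤ t) (hθ' : θ' * ((1 + κ) + 3 * ω.toReal / θ) = κ / 8 * ω.toReal) :
    ENNReal.ofReal (a * (1 + κ / 8) * ρ) ≤ M := by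
  rw [← ENNReal.ofReal_toReal hMt]
  refine ENNReal.ofReal_le_ofReal ?_
  have hA' := ENNReal.toReal_mono (by finiteness) hA
  have hB' := ENNReal.toReal_mono (by finiteness) hB
  have hLc' := ENNReal.toReal_mono (by finiteness) hLc
  have hZ' := ENNReal.toReal_mono (by finiteness) hZ
  have hG' := ENNReal.toReal_mono (by finiteness) hGθ
  rw [ENNReal.toReal_add (by finiteness) (by finiteness),
    ENNReal.toReal_add (by finiteness) (by finiteness)] at hA'
  rw [ENNReal.toReal_add (by finiteness) (by finiteness)] at hB' hZ'
  have hq : 0 ≤ a / θ := by positivity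
  have htρ : 0 ≤ t * ρ := by nlinarith
  have h2 : 0 ≤ 2 * θ' * ρ := by positivity
  simp only [ENNReal.toReal_mul, ENNReal.toReal_ofReal ha.le, ENNReal.toReal_ofReal h0,
    ENNReal.toReal_ofReal hΘ0.le, ENNReal.toReal_ofReal hq] at hA' hB'
  rw [ENNReal.toReal_mul, ENNReal.toReal_ofReal hH.le] at hLc'
  rw [ENNReal.toReal_mul, ENNReal.toReal_ofReal htρ] at hZ'
  rw [ENNReal.toReal_ofReal h2] at hG'
  exact mass_growth_real ha (ENNReal.toReal_pos hω0 hω) hΘ0 hΘ h0 h1 hH hκ hθ hρ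
    ENNReal.toReal_nonneg ENNReal.toReal_nonneg hA' hB' (ENNReal.toReal_mono hLPt hL) hLc' hZ' hG'
    ht ht2 hθ'

/-- The gain in each step of the mass iteration. -/
def massGain (d : ℕ) : ℝ := (1 / 40000) ^ d / 2 / 160 ^ d

theorem massGain_pos (d : ℕ) : 0 < massGain d := by unfold massGain; positivity

theorem exists_aperture (d : ℕ) : ∃ τ : ℝ, 0 < τ ∧ τ ≤ 1 / 100000 ∧ (1 + 8 * τ) ^ (2 * d) ≤ 2 ∧
    (1 + massGain d / 8) * (1 + 8 * τ) ^ (2 * d) ≤ (1 + massGain d / 2) * (1 - 8 * τ) ^ d ∧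
    1 / 2 ≤ (1 - 8 * τ) ^ d := by
  have hκ := massGain_pos d
  have e1 : ∀ᶠ τ : ℝ in nhds 0, (1 + 8 * τ) ^ (2 * d) < 2 :=
    (by fun_prop : Continuous fun τ : ℝ => (1 + 8 * τ) ^ (2 * d)).continuousAt.eventually_lt
      continuousAt_const (by norm_num)
  have e2 : ∀ᶠ τ : ℝ in nhds 0, (1 + massGain d / 8) * (1 + 8 * τ) ^ (2 * d) <
      (1 + massGain d / 2) * (1 - 8 * τ) ^ d :=
    (by fun_prop : Continuous fun τ : ℝ => (1 + massGain d / 8) * (1 + 8 * τ) ^ (2 * d)).continuousAt.eventually_lt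
      (by fun_prop : Continuous fun τ : ℝ => (1 + massGain d / 2) * (1 - 8 * τ) ^ d).continuousAt
      (by norm_num; linarith)
  have e3 : ∀ᶠ τ : ℝ in nhds 0, 1 / 2 < (1 - 8 * τ) ^ d :=
    continuousAt_const.eventually_lt
      (by fun_prop : Continuous fun τ : ℝ => (1 - 8 * τ) ^ d).continuousAt (by norm_num)
  have e4 : ∀ᶠ τ : ℝ in nhds 0, τ < 1 / 100000 := eventually_lt_nhds (by norm_num)
  have e : ∀ᶠ τ : ℝ in nhdsWithin 0 (Ioi 0), _ := ((e1.and e2).and (e3.and e4)).filter_mono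
    nhdsWithin_le_nhds
  obtain ⟨τ, ⟨⟨h1, h2⟩, h3, h4⟩, h0⟩ := (e.and self_mem_nhdsWithin).exists
  exact ⟨τ, h0, h4.le, h1.le, h2.le, h3.le⟩

theorem MassAlternative.exists_step (n d : ℕ) (hd : 0 < d) (hdn : d < n) {C₀ : ℝ} (hC₀ : 1 ≤ C₀)
    {q q' : ℝ≥0∞} (hq : 1 ≤ q) (hqq : q ≤ q') (hq' : 2 ≤ q') (hsc : scaleRatio d q' < 1) {τ : ℝ}
    (hτ0 : 0 < τ) (hτ : τ ≤ 1 / 100000) (hΘ : (1 + 8 * τ) ^ (2 * d) ≤ 2)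
    (ht : (1 + massGain d / 8) * (1 + 8 * τ) ^ (2 * d) ≤ (1 + massGain d / 2) * (1 - 8 * τ) ^ d)
    (ht2 : 1 / 2 ≤ (1 - 8 * τ) ^ d) {m₀ : ℕ} (hm₀ : (64 + 6 * n) * (1 / 2 : ℝ) ^ m₀ ≤ 1)
    {θ a : ℝ} (hθ : 0 < θ) (ha : 0 < a) {A : ℝ≥0∞} (hA : A ≠ ⊤) :
    ∃ θ' : ℝ, 0 < θ' ∧ ∃ A₁ : ℝ≥0∞, A₁ ≠ ⊤ ∧ ∀ (ε : ℝ) (E : Set (V n)), 0 ≤ ε →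
      ε ≤ τ ^ 2 / 10000000 → IsFlat n d ε E → IsADRegular n d C₀ E →
      MassAlternative n d q E m₀ θ a A →
      MassAlternative n d q E m₀ θ' (a * (1 + massGain d / 8)) A₁ := by
  obtain ⟨C, hC, hreg⟩ := exists_lintegral_regionSum_le n d hd hdn hC₀ hq hqq hq' hsc
  obtain ⟨N, hN⟩ := pow_unbounded_of_one_lt (2 / τ) (by norm_num : (1 : ℝ) < 2)
  set ω : ℝ≥0∞ := μH[(d : ℝ)] (ball (0 : V d) 1) with hωdef
  have hω : ω ≠ ⊤ := measure_ball_lt_top.ne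
  have hω0 : ω ≠ 0 := (measure_ball_pos _ _ one_pos).ne'
  have hωr : 0 < ω.toReal := ENNReal.toReal_pos hω0 hω
  set κ := massGain d with hκdef
  have hκ : 0 < κ := massGain_pos d
  set θ' : ℝ := κ / 8 * ω.toReal / ((1 + κ) + 3 * ω.toReal / θ) with hθ'def
  have hθ'0 : 0 < θ' := by positivity
  set A' : ℝ≥0∞ := C * 2 ^ d / ENNReal.ofReal θ' + 1 with hA'
  set b : ℝ≥0∞ := ENNReal.ofReal C₀ ^ 2 with hb
  have hθ'1 : ENNReal.ofReal θ' ≠ 0 := by simpa using hθ'0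
  have hA't : A' ≠ ⊤ := ENNReal.add_ne_top.2 ⟨ENNReal.div_ne_top (by finiteness) hθ'1, by simp⟩
  refine ⟨θ', hθ'0, A' + N * b + A, by finiteness, fun ε E hε0 hετ hE hAD hM x hx m hm r hr => ?_⟩
  have hR0 : (0 : ℝ) < (1 / 2) ^ m := by positivity
  have hn0 : (0 : ℝ) ≤ n := Nat.cast_nonneg n
  have hmR : (64 + 6 * n) * (1 / 2 : ℝ) ^ m ≤ 1 := le_trans
    (by gcongr ?_ * ?_; exact pow_le_pow_of_le_one (by norm_num) (by norm_num) hm) hm₀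
  have hrR : (1 / 2 : ℝ) ^ m / 2 < r := by have := hr.1; rw [pow_succ] at this; linarith
  have hr0 : 0 < r := by linarith
  have hρ : 0 < r ^ d := by positivity
  obtain ⟨ι, h⟩ := hE.exists_isFrame hx hR0 (by nlinarith)
  have hlf := hAD.isLocallyFinite
  have hD : ∃ D : Submodule ℝ (V n), Module.finrank ℝ D = d := by
    obtain ⟨D, hD, -⟩ := hE x hx 1 one_pos le_rfl
    exact ⟨D, hD⟩
  have hF : ∀ k z, jonesFun n d q E k z ≤ b := fun k z => jonesFun_le hAD hC₀ hq hD k z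
  set W := ball x r with hW
  set U := tameSet n d q E ι x m (A' + N * b + A) A' with hU
  set μ := surf n d E with hμ
  have hMt : μ W ≠ ⊤ := measure_ball_lt_top.ne
  by_cases hcase : ENNReal.ofReal (2 * θ' * r ^ d) ≤ μ (W ∩ U)
  · left
    have hcheb : μ (W ∩ {w | A' < regionSum d q E ι x m w}) ≤ ENNReal.ofReal (θ' * r ^ d) := by
      have h1 : A' * μ (W ∩ {w | A' < regionSum d q E ι x m w}) ≤ C * 2⁻¹ ^ (m * d) := by
        refine le_trans ?_ (hreg E hAD ι x hx m hmR)
        refine le_trans ?_ (mul_meas_ge_le_lintegral (measurable_regionSum hAD hC₀ hq hD ι x m) A')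
        refine mul_le_mul_right ?_ A'
        refine le_trans (measure_mono ?_) (Measure.le_restrict_apply _ _)
        rintro w ⟨hw1, hw2⟩
        exact ⟨show A' ≤ _ from le_of_lt hw2, ball_subset_ball (by linarith [hr.2]) hw1⟩
      have h2 : (2⁻¹ : ℝ≥0∞) ^ (m * d) ≤ 2 ^ d * ENNReal.ofReal (r ^ d) := by
        rw [pow_mul, ← ofReal_half_pow, ENNReal.ofReal_pow hr0.le, ← mul_pow]
        gcongr
        rw [show (2 : ℝ≥0∞) = ENNReal.ofReal 2 by simp, ← ENNReal.ofReal_mul (by norm_num)]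
        exact ENNReal.ofReal_le_ofReal (by linarith)
      have h3 : C * 2 ^ d ≤ A' * ENNReal.ofReal θ' :=
        (ENNReal.div_le_iff hθ'1 ENNReal.ofReal_ne_top).1 le_self_add
      have h4 : A' ≠ 0 := by rw [hA']; simp
      rw [← ENNReal.mul_le_mul_iff_right h4 hA't]
      calc _ ≤ _ := h1
        _ ≤ C * (2 ^ d * ENNReal.ofReal (r ^ d)) := by gcongr
        _ = C * 2 ^ d * ENNReal.ofReal (r ^ d) := by ring
        _ ≤ A' * ENNReal.ofReal θ' * ENNReal.ofReal (r ^ d) := by gcongr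
        _ = _ := by rw [ENNReal.ofReal_mul hθ'0.le, mul_assoc]
    have h1 : μ (W ∩ U) ≤ μ (W ∩ {z | tailSum (jonesFun n d q E) m z ≤ A' + N * b + A}) +
        μ (W ∩ {w | A' < regionSum d q E ι x m w}) := by
      rw [hU, tameSet, inter_union_distrib_left]
      exact measure_union_le _ _
    have h2 : ENNReal.ofReal (2 * θ' * r ^ d) =
        ENNReal.ofReal (θ' * r ^ d) + ENNReal.ofReal (θ' * r ^ d) := by
      rw [← ENNReal.ofReal_add (by positivity) (by positivity)]; congr 1; ring
    rw [h2] at hcase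
    exact (ENNReal.add_le_add_iff_right ENNReal.ofReal_ne_top).1
      (hcase.trans (h1.trans (add_le_add le_rfl hcheb)))
  · right
    set Wc := {w | hProj ι (w - x) ∈ coreSet ι E x ((1 / 2) ^ m) (1 / 2)} ∩ W with hWc
    have hWcm : MeasurableSet Wc :=
      (((isOpen_coreSet _).preimage (by fun_prop : Continuous fun w => hProj ι (w - x)))).measurableSet.inter
        measurableSet_ball
    set P := ball (0 : V d) ((1 - 4 * τ) * r) ∩ {p | 0 < gap ι E x ((1 / 2) ^ m) p} with hP
    set Pc := ball (0 : V d) ((1 - 4 * τ) * r) ∩ coreSet ι E x ((1 / 2) ^ m) (1 / 4) with hPc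
    set P' := ball (0 : V d) ((1 - 8 * τ) * r) ∩ {p | 0 < gap ι E x ((1 / 2) ^ m) p} with hP'
    have hgm : MeasurableSet {p | 0 < gap ι E x ((1 / 2) ^ m) p} :=
      (isOpen_lt continuous_const continuous_gap).measurableSet
    have hWU : ∫⁻ w in W ∩ U, sectionMass ι E x ((1 / 2) ^ m) τ r w ∂μ ≤
        ENNReal.ofReal ((1 + 8 * τ) ^ (2 * d)) * ω * μ (W ∩ U) :=
      le_self_add.trans (setLIntegral_sectionMass_le hE hAD h hε0 hτ0 hτ hετ hr.2 inter_subset_left)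
    have hball : ∀ p w, (p, w) ∈ sawtooth ι E x ((1 / 2) ^ m) τ r → w ∈ W :=
      fun p w hw => mem_ball_of_mem_sawtooth (z := (p, w)) h hε0 hτ0 hτ hετ hrR hw
    refine mass_growth (h := (1 / 40000) ^ d) (Θ := (1 + 8 * τ) ^ (2 * d)) (H := 160 ^ d) (θ := θ)
      (θ' := θ') (t := (1 - 8 * τ) ^ d) (ω := ω) (Mc := μ Wc) (G := μ (W ∩ U)) (LP := μH[(d : ℝ)] P)
      (LPc := μH[(d : ℝ)] Pc) (L := μH[(d : ℝ)] P') ha hω0 hω hMt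
      (measure_ne_top_of_subset inter_subset_right hMt)
      (measure_ne_top_of_subset inter_subset_left hMt)
      (measure_ne_top_of_subset inter_subset_left measure_ball_lt_top.ne)
      (measure_ne_top_of_subset inter_subset_left measure_ball_lt_top.ne)
      (measure_ne_top_of_subset inter_subset_left measure_ball_lt_top.ne)
      (by positivity) hΘ (by positivity) (pow_le_one₀ (by norm_num) (by norm_num)) (by positivity)
      rfl hθ hθ'0 hρ ?_ ?_ ?_ ?_ ?_ (not_le.1 hcase).le ht ht2 ?_
    · have h1 := hM.mul_measure_le (A' := A') hm hE hAD h hε0 hτ0 hτ hετ hθ ha hr hF hN.le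
        (S := P) (measurableSet_ball.inter hgm) inter_subset_left (fun p hp => hp.2) (T := W)
        measurableSet_ball (fun p _ => hball p)
      have h2 := setLIntegral_sectionMass_le hE hAD h hε0 hτ0 hτ hετ hr.2 (T := W) subset_rfl
      calc _ ≤ _ := add_le_add h1 le_rfl
        _ = _ := add_right_comm _ _ _
        _ ≤ _ := add_le_add h2 (mul_le_mul_right hWU _)
    · have h1 := hM.mul_measure_le (A' := A') hm hE hAD h hε0 hτ0 hτ hετ hθ ha hr hF hN.le
        (S := Pc) (measurableSet_ball.inter (isOpen_coreSet _).measurableSet) inter_subset_left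
        (fun p hp => gap_pos_of_mem_coreSet (by norm_num) hp.2) (T := Wc) hWcm
        (fun p hp w hw => ⟨mem_coreSet_of_mem_sawtooth (z := (p, w)) hτ0 hτ hw hp.2, hball p w hw⟩)
      refine h1.trans (add_le_add ?_ (mul_le_mul_right hWU _))
      exact le_self_add.trans
        (setLIntegral_sectionMass_le hE hAD h hε0 hτ0 hτ hετ hr.2 inter_subset_right)
    · refine measure_mono (inter_subset_inter_left _ (ball_subset_ball ?_))
      nlinarith
    · refine measure_gap_pos_le μH[(d : ℝ)] h ?_
      have h1 : ε * (1 / 2) ^ m ≤ τ ^ 2 / 10000000 * (2 * r) := by gcongr; linarith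
      have h2 : τ ^ 2 * r ≤ τ * r := by gcongr; nlinarith
      have h3 : 0 < τ * r := by positivity
      linarith
    · have h1 := hausdorffMeasure_gap_zero_le (q := q) hE hAD h hε0 hτ0 hτ hετ hr
        (A := A' + N * b + A) (A' := A') (by rw [add_assoc]; exact le_self_add)
      have h2 : ENNReal.ofReal ((1 - 8 * τ) ^ d * r ^ d) * ω =
          μH[(d : ℝ)] (ball (0 : V d) ((1 - 8 * τ) * r)) := by
        rw [Measure.addHaar_ball_of_pos _ _ (by nlinarith : 0 < (1 - 8 * τ) * r),
          finrank_euclideanSpace, Fintype.card_fin, mul_pow]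
      rw [h2, ← measure_inter_add_sdiff _ hgm]
      refine add_le_add le_rfl (le_trans (measure_mono ?_) h1)
      rintro p ⟨hp1, hp2⟩
      exact ⟨hp1, le_antisymm (not_lt.1 hp2) (gap_nonneg p)⟩
    · rw [hθ'def]; field_simp

theorem exists_massAlternative (n d : ℕ) (hd : 0 < d) (hdn : d < n) {C₀ : ℝ} (hC₀ : 1 ≤ C₀)
    {q q' : ℝ≥0∞} (hq : 1 ≤ q) (hqq : q ≤ q') (hq' : 2 ≤ q') (hsc : scaleRatio d q' < 1) {τ : ℝ}
    (hτ0 : 0 < τ) (hτ : τ ≤ 1 / 100000) (hΘ : (1 + 8 * τ) ^ (2 * d) ≤ 2)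
    (ht : (1 + massGain d / 8) * (1 + 8 * τ) ^ (2 * d) ≤ (1 + massGain d / 2) * (1 - 8 * τ) ^ d)
    (ht2 : 1 / 2 ≤ (1 - 8 * τ) ^ d) {m₀ : ℕ} (hm₀ : (64 + 6 * n) * (1 / 2 : ℝ) ^ m₀ ≤ 1) (i : ℕ) :
    ∃ θ : ℝ, 0 < θ ∧ ∃ A : ℝ≥0∞, A ≠ ⊤ ∧ ∀ (ε : ℝ) (E : Set (V n)), 0 ≤ ε →
      ε ≤ τ ^ 2 / 10000000 → IsFlat n d ε E → IsADRegular n d C₀ E →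
      MassAlternative n d q E m₀ θ (C₀⁻¹ * (1 + massGain d / 8) ^ i) A := by
  have hκ := massGain_pos d
  induction i with
  | zero =>
    refine ⟨1, one_pos, 0, by simp, fun ε E _ _ _ hAD x hx m _ r hr => Or.inr ?_⟩
    rw [pow_zero, mul_one]
    exact hAD.le_measure x hx r (lt_trans (by positivity) hr.1)
      (hr.2.trans (pow_le_one₀ (by norm_num) (by norm_num)))
  | succ i ih =>
    obtain ⟨θ, hθ, A, hA, h⟩ := ih
    obtain ⟨θ', hθ', A₁, hA₁, h'⟩ := MassAlternative.exists_step n d hd hdn hC₀ hq hqq hq' hsc hτ0 hτ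
      hΘ ht ht2 hm₀ hθ (by positivity : 0 < C₀⁻¹ * (1 + massGain d / 8) ^ i) hA
    refine ⟨θ', hθ', A₁, hA₁, fun ε E hε0 hε hE hAD => ?_⟩
    rw [pow_succ, ← mul_assoc]
    exact h' ε E hε0 hε hE hAD (h ε E hε0 hε hE hAD)

theorem exists_lintegral_tailSum_le_of_small (n d : ℕ) (hd : 0 < d) (hdn : d < n) {C₀ : ℝ} (hC₀ : 1 ≤ C₀)
    {q q' : ℝ≥0∞} (hq : 1 ≤ q) (hqq : q ≤ q') (hq' : 2 ≤ q') (hsc : scaleRatio d q' < 1) {τ : ℝ}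
    (hτ0 : 0 < τ) (hτ : τ ≤ 1 / 100000) (hΘ : (1 + 8 * τ) ^ (2 * d) ≤ 2)
    (ht : (1 + massGain d / 8) * (1 + 8 * τ) ^ (2 * d) ≤ (1 + massGain d / 2) * (1 - 8 * τ) ^ d)
    (ht2 : 1 / 2 ≤ (1 - 8 * τ) ^ d) {m₀ : ℕ} (hm₀ : (64 + 6 * n) * (1 / 2 : ℝ) ^ m₀ ≤ 1) :
    ∃ C : ℝ≥0∞, C ≠ ⊤ ∧ ∀ (ε : ℝ) (E : Set (V n)), 0 ≤ ε →
      ε ≤ τ ^ 2 / 10000000 → IsFlat n d ε E → IsADRegular n d C₀ E → ∀ x ∈ E, ∀ m, m₀ ≤ m →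
      ∫⁻ z in ball x ((1 / 2) ^ m), tailSum (jonesFun n d q E) m z ∂(surf n d E) ≤
        C * 2⁻¹ ^ (m * d) := by
  have hκ := massGain_pos d
  have hC0 : 0 < C₀ := by linarith
  obtain ⟨i, hi⟩ := pow_unbounded_of_one_lt (C₀ * C₀) (by linarith : 1 < 1 + massGain d / 8)
  obtain ⟨θ, hθ, A, hA, h⟩ := exists_massAlternative n d hd hdn hC₀ hq hqq hq' hsc hτ0 hτ
      hΘ ht ht2 hm₀ i
  set b : ℝ≥0∞ := ENNReal.ofReal C₀ ^ 2 with hb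
  set B : ℝ≥0∞ := ENNReal.ofReal (C₀ * 6 ^ d) with hB
  have hθ0 : ENNReal.ofReal θ ≠ 0 := by simpa using hθ
  refine ⟨(4 * b + A) * ((1 - B / (ENNReal.ofReal θ + B))⁻¹ * B), ?_,
    fun ε E hε0 hε hE hAD x hx m hm => ?_⟩
  · have : B / (ENNReal.ofReal θ + B) < 1 := by
      rw [ENNReal.div_lt_iff (Or.inl (by simp [hθ])) (Or.inl (by finiteness)), one_mul]
      rw [add_comm]
      exact ENNReal.lt_add_right (by finiteness) hθ0
    have h1 : (1 - B / (ENNReal.ofReal θ + B))⁻¹ ≠ ⊤ := by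
      rw [ENNReal.inv_ne_top]; exact (tsub_pos_of_lt this).ne'
    finiteness
  · have hD : ∃ D : Submodule ℝ (V n), Module.finrank ℝ D = d := by
      obtain ⟨D, hD, -⟩ := hE x hx 1 one_pos le_rfl
      exact ⟨D, hD⟩
    have hM := h ε E hε0 hε hE hAD
    refine lintegral_tailSum_le_of_good hAD.isClosed.measurableSet hAD.ae_mem
      (measurable_jonesFun hAD hC₀ hq hD) (by simpa using hC0) (by finiteness)
      (jonesFun_le hAD hC₀ hq hD) (jonesFun_le_add hAD hC₀ hq hD) hA hθ0 (by finiteness)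
      (by finiteness) (fun u hu l hl => ?_) (fun u hu l hl => ?_) hx
    · have hl0 : (0 : ℝ) < (1 / 2) ^ l := by positivity
      rw [← ofReal_mul_half_pow_pow hθ.le]
      refine (hM u hu l (hm.trans hl) ((1 / 2) ^ l) ⟨?_, le_rfl⟩).resolve_right fun h2 => ?_
      · rw [pow_succ]; linarith
      · have h3 := h2.trans (hAD.measure_le u hu _ hl0 (pow_le_one₀ (by norm_num) (by norm_num)))
        rw [ENNReal.ofReal_le_ofReal_iff (by positivity)] at h3
        have h4 := le_of_mul_le_mul_right h3 (by positivity)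
        rw [inv_mul_le_iff₀ hC0] at h4
        linarith
    · refine hAD.measure_le_dyadic hC₀ hu (by norm_num) ?_
      have h1 : (1 / 2 : ℝ) ^ l ≤ (1 / 2) ^ m₀ :=
        pow_le_pow_of_le_one (by norm_num) (by norm_num) (hm.trans hl)
      have h2 : (0 : ℝ) ≤ n := Nat.cast_nonneg n
      have h3 : (0 : ℝ) < (1 / 2) ^ m₀ := by positivity
      nlinarith

/-- A finite cover argument: integrals over unit balls are controlled by integrals over balls of
a fixed smaller radius. -/
theorem exists_setLIntegral_ball_le (n : ℕ) {δ : ℝ} (hδ : 0 < δ) : ∃ k : ℕ,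
    ∀ (μ : Measure (V n)) (E : Set (V n)), (∀ᵐ u ∂μ, u ∈ E) → ∀ (f : V n → ℝ≥0∞) (M : ℝ≥0∞),
      (∀ y ∈ E, ∫⁻ z in ball y δ, f z ∂μ ≤ M) → ∀ x, ∫⁻ z in ball x 1, f z ∂μ ≤ k * M := by
  obtain ⟨t, -, htf, ht⟩ := (isCompact_closedBall (0 : V n) 1).finite_cover_balls (half_pos hδ)
  refine ⟨htf.toFinset.card, fun μ E hE f M hM x => ?_⟩
  have hsub : ball x 1 ⊆ ⋃ i : htf.toFinset, ball (x + i) (δ / 2) := by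
    intro z hz
    have h1 : z - x ∈ closedBall (0 : V n) 1 := by
      rw [mem_closedBall, dist_zero_right, ← dist_eq_norm]; exact (mem_ball.1 hz).le
    obtain ⟨i, hi, hzi⟩ := mem_iUnion₂.1 (ht h1)
    refine mem_iUnion.2 ⟨⟨i, htf.mem_toFinset.2 hi⟩, ?_⟩
    rw [mem_ball, dist_eq_norm] at hzi ⊢
    rwa [← sub_sub]
  calc _ ≤ ∫⁻ z in ⋃ i : htf.toFinset, ball (x + i) (δ / 2), f z ∂μ := lintegral_mono_set hsub
    _ ≤ ∑ i ∈ htf.toFinset, ∫⁻ z in ball (x + i) (δ / 2), f z ∂μ := by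
        refine (lintegral_iUnion_le _ _).trans_eq ?_
        rw [tsum_fintype]
        exact Finset.sum_coe_sort htf.toFinset fun i => ∫⁻ z in ball (x + i) (δ / 2), f z ∂μ
    _ ≤ ∑ i ∈ htf.toFinset, M := by
        refine Finset.sum_le_sum fun i _ => ?_
        by_cases hne : ∃ y ∈ E, y ∈ ball (x + i) (δ / 2)
        · obtain ⟨y, hy, hyi⟩ := hne
          refine le_trans (lintegral_mono_set fun z hz => ?_) (hM y hy)
          have := dist_triangle_right z y (x + i)
          rw [mem_ball] at hz hyi ⊢
          linarith
        · push Not at hne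
          have : μ (ball (x + i) (δ / 2)) = 0 :=
            measure_mono_null (fun z hz hzE => hne z hzE hz) hE
          rw [Measure.restrict_eq_zero.2 this, lintegral_zero_measure]
          exact zero_le
    _ = _ := by rw [Finset.sum_const, nsmul_eq_mul]

theorem exists_lintegral_tailSum_le (n d : ℕ) (hd : 0 < d) (hdn : d < n) : ∃ ε₀ : ℝ, 0 < ε₀ ∧
    ∀ C₀ : ℝ, 1 ≤ C₀ → ∀ q q' : ℝ≥0∞, 1 ≤ q → q ≤ q' → 2 ≤ q' → scaleRatio d q' < 1 →
    ∃ C : ℝ≥0∞, C ≠ ⊤ ∧ ∀ (ε : ℝ) (E : Set (V n)), 0 ≤ ε → ε ≤ ε₀ → IsFlat n d ε E →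
      IsADRegular n d C₀ E → ∀ x ∈ E, ∀ m,
      ∫⁻ z in ball x ((1 / 2) ^ m), tailSum (jonesFun n d q E) m z ∂(surf n d E) ≤
        C * 2⁻¹ ^ (m * d) := by
  obtain ⟨τ, hτ0, hτ, hΘ, ht, ht2⟩ := exists_aperture d
  refine ⟨τ ^ 2 / 10000000, by positivity, fun C₀ hC₀ q q' hq hqq hq' hsc => ?_⟩
  have hn : (0 : ℝ) < 64 + 6 * n := by positivity
  obtain ⟨m₀, hm₀⟩ := exists_pow_lt_of_lt_one (inv_pos.2 hn) (by norm_num : (1 / 2 : ℝ) < 1)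
  have hm₀ : (64 + 6 * n) * (1 / 2 : ℝ) ^ m₀ ≤ 1 := by
    calc _ ≤ (64 + 6 * n) * (64 + 6 * n : ℝ)⁻¹ := by gcongr
      _ = 1 := mul_inv_cancel₀ hn.ne'
  obtain ⟨C, hC, h⟩ := exists_lintegral_tailSum_le_of_small n d hd hdn hC₀ hq hqq hq' hsc hτ0 hτ
    hΘ ht ht2 hm₀
  obtain ⟨k, hk⟩ := exists_setLIntegral_ball_le n (δ := (1 / 2) ^ m₀) (by positivity)
  set b : ℝ≥0∞ := ENNReal.ofReal C₀ ^ 2 with hb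
  set C' : ℝ≥0∞ := k * (m₀ * b * ENNReal.ofReal C₀ + C) with hC'
  refine ⟨C + C' * 2 ^ (m₀ * d), by finiteness, fun ε E hε0 hε hE hAD x hx m => ?_⟩
  rcases le_or_gt m₀ m with hm | hm
  · refine (h ε E hε0 hε hE hAD x hx m hm).trans ?_
    gcongr
    exact le_self_add
  · have hD : ∃ D : Submodule ℝ (V n), Module.finrank ℝ D = d := by
      obtain ⟨D, hD, -⟩ := hE x hx 1 one_pos le_rfl
      exact ⟨D, hD⟩
    have h1 : ∀ z, tailSum (jonesFun n d q E) m z ≤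
        m₀ * b + tailSum (jonesFun n d q E) m₀ z := by
      intro z
      obtain ⟨i, rfl⟩ := Nat.exists_eq_add_of_lt hm
      refine (tailSum_le_add (jonesFun_le hAD hC₀ hq hD) m (i + 1) z).trans ?_
      rw [← add_assoc]
      gcongr
      omega
    have h2 : ∀ y ∈ E, ∫⁻ z in ball y ((1 / 2) ^ m₀), tailSum (jonesFun n d q E) m z ∂(surf n d E) ≤
        m₀ * b * ENNReal.ofReal C₀ + C := by
      intro y hy
      refine (lintegral_mono h1).trans ?_
      rw [lintegral_add_left measurable_const, setLIntegral_const]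
      refine add_le_add (mul_le_mul_right ?_ _) ((h ε E hε0 hε hE hAD y hy m₀ le_rfl).trans ?_)
      · refine (hAD.measure_le y hy _ (by positivity) (pow_le_one₀ (by norm_num) (by norm_num))).trans
          (ENNReal.ofReal_le_ofReal ?_)
        exact mul_le_of_le_one_right (by linarith)
          (pow_le_one₀ (by positivity) (pow_le_one₀ (by norm_num) (by norm_num)))
      · exact mul_le_of_le_one_right' (pow_le_one₀ zero_le (by simp))
    calc _ ≤ ∫⁻ z in ball x 1, tailSum (jonesFun n d q E) m z ∂(surf n d E) :=
          lintegral_mono_set (ball_subset_ball (pow_le_one₀ (by norm_num) (by norm_num)))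
      _ ≤ C' := hk _ E hAD.ae_mem _ _ h2 x
      _ = C' * (2 ^ (m₀ * d) * 2⁻¹ ^ (m₀ * d)) := by
          rw [← mul_pow, ENNReal.mul_inv_cancel (by norm_num) (by norm_num), one_pow, mul_one]
      _ ≤ C' * (2 ^ (m₀ * d) * 2⁻¹ ^ (m * d)) := by
          refine mul_le_mul_right (mul_le_mul_right ?_ _) _
          exact pow_le_pow_of_le_one zero_le (ENNReal.inv_le_one.2 one_le_two) (Nat.mul_le_mul_right d hm.le)
      _ = C' * 2 ^ (m₀ * d) * 2⁻¹ ^ (m * d) := (mul_assoc _ _ _).symm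
      _ ≤ _ := by gcongr; exact le_add_self

theorem IsLARRF.isADRegular {n d : ℕ} {ε C₀ : ℝ} {E : Set (V n)} (h : IsLARRF n d ε C₀ E) :
    IsADRegular n d C₀ E where
  isClosed := h.2.1
  le_measure x hx r hr hr1 := by
    rw [surf, Measure.restrict_apply measurableSet_ball, inter_comm]
    exact (h.2.2 x hx r hr hr1).2.1
  measure_le x hx r hr hr1 := by
    rw [surf, Measure.restrict_apply measurableSet_ball, inter_comm]
    exact (h.2.2 x hx r hr hr1).2.2

theorem infDist_le_biSup {n : ℕ} {x y : V n} {r : ℝ} {A B : Set (V n)} (hx : x ∈ B)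
    (hy : y ∈ A ∩ ball x r) : infDist y B ≤ ⨆ z ∈ A ∩ ball x r, infDist z B := by
  have hr : 0 < r := pos_of_mem_ball hy.2
  have hb : BddAbove (range fun z => ⨆ _ : z ∈ A ∩ ball x r, infDist z B) := by
    refine ⟨r, ?_⟩
    rintro _ ⟨z, rfl⟩
    refine Real.iSup_le (fun hz => ?_) hr.le
    exact (infDist_le_dist_of_mem hx).trans (mem_ball.1 hz.2).le
  refine le_trans ?_ (le_ciSup hb y)
  simp only [hy, ciSup_unique, le_refl]

/-- The Hausdorff-distance form of Reifenberg flatness gives pointwise approximation on both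
sides. -/
theorem IsLARRF.isFlat {n d : ℕ} {ε C₀ : ℝ} {E : Set (V n)} (hε : 0 < ε)
    (h : IsLARRF n d ε C₀ E) : IsFlat n d (2 * ε) E := by
  intro x hx t ht ht1
  obtain ⟨⟨_, ⟨Q, rfl, hQ, -⟩, hxQ, hn⟩, -⟩ := h.2.2 x hx t ht ht1
  rw [nhd, inv_mul_le_iff₀ ht, max_le_iff] at hn
  have hlt : t * ε < 2 * ε * t := by nlinarith [mul_pos ht hε]
  refine ⟨Q.direction, hQ, fun y hy hyx => ?_, fun p hp hpt => ?_⟩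
  · have hyb : y ∈ E ∩ ball x t := ⟨hy, by rwa [mem_ball, dist_eq_norm]⟩
    obtain ⟨z, hz, hyz⟩ := (infDist_lt_iff ⟨x, hxQ⟩).1
      (((infDist_le_biSup hxQ hyb).trans hn.2).trans_lt hlt)
    refine ⟨z - x, AffineSubspace.vsub_mem_direction hz hxQ, ?_⟩
    rw [sub_sub_sub_cancel_right, ← dist_eq_norm]
    exact hyz.le
  · have hpQ : x + p ∈ (Q : Set (V n)) := by
      rw [add_comm]
      exact AffineSubspace.vadd_mem_of_mem_direction hp hxQ
    have hpb : x + p ∈ (Q : Set (V n)) ∩ ball x t := ⟨hpQ, by simpa [mem_ball, dist_eq_norm] using hpt⟩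
    obtain ⟨z, hz, hyz⟩ := (infDist_lt_iff ⟨x, hx⟩).1
      (((infDist_le_biSup hx hpb).trans hn.1).trans_lt hlt)
    refine ⟨z, hz, ?_⟩
    rw [← dist_eq_norm, dist_comm]
    exact hyz.le

theorem lintegral_betaE_sq_le_tailSum {n d : ℕ} {q : ℝ≥0∞} {E : Set (V n)} {w : V n} (hw : w ∈ E)
    {m : ℕ} {r : ℝ} (hr : r ≤ (1 / 2) ^ m) :
    ∫⁻ t in Ioc (0 : ℝ) r, betaE n d q E w t ^ 2 / ENNReal.ofReal t ≤
      tailSum (jonesFun n d q E) m w := by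
  have hsub : Ioc (0 : ℝ) r ⊆ ⋃ i : ℕ, Ioc ((1 / 2) ^ (m + i + 1)) ((1 / 2) ^ (m + i)) := by
    intro t ht
    obtain ⟨k, hk1, hk2⟩ := exists_nat_pow_near_of_lt_one (div_pos ht.1 (by positivity :
      (0 : ℝ) < (1 / 2) ^ m)) ((div_le_one (by positivity)).2 (ht.2.trans hr))
      (by norm_num : (0 : ℝ) < 1 / 2) (by norm_num)
    rw [lt_div_iff₀ (by positivity), ← pow_add] at hk1
    rw [div_le_iff₀ (by positivity), ← pow_add] at hk2
    refine mem_iUnion.2 ⟨k, ?_, ?_⟩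
    · rwa [add_assoc, add_comm m]
    · rwa [add_comm m]
  refine (lintegral_mono_set hsub).trans ((lintegral_iUnion_le _ _).trans
    (ENNReal.tsum_le_tsum fun i => ?_))
  set k := m + i
  calc _ ≤ ∫⁻ _ in Ioc ((1 / 2 : ℝ) ^ (k + 1)) ((1 / 2) ^ k),
        jonesFun n d q E k w / 2⁻¹ ^ (k + 1) := by
        refine setLIntegral_mono' measurableSet_Ioc fun t ht => ?_
        rw [← ofReal_half_pow]
        exact ENNReal.div_le_div (betaE_sq_le_jonesFun hw ht) (ENNReal.ofReal_le_ofReal ht.1.le)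
    _ = jonesFun n d q E k w := by
        rw [setLIntegral_const, Real.volume_Ioc]
        have : (1 / 2 : ℝ) ^ k - (1 / 2) ^ (k + 1) = (1 / 2) ^ (k + 1) := by ring
        rw [this, ofReal_half_pow]
        refine ENNReal.div_mul_cancel (by simp) ?_
        finiteness

theorem scaleRatio_max_two_lt_one {d : ℕ} (hd : 0 < d) {q : ℝ≥0∞}
    (hq : 2 < d → q < ENNReal.ofReal (2 * d / ((d : ℝ) - 2))) (hq' : q = ⊤ → d = 1) :
    scaleRatio d (max q 2) < 1 := by
  rw [scaleRatio]
  refine ENNReal.rpow_lt_one_of_one_lt_of_neg (by norm_num) ?_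
  have h0 : 0 ≤ (max q 2).toReal⁻¹ := inv_nonneg.2 ENNReal.toReal_nonneg
  rcases eq_or_ne q ⊤ with rfl | hqt
  · simp [hq' rfl]
    norm_num
  have hmt : max q 2 ≠ ⊤ := by simp [hqt]
  have hm0 : 0 < (max q 2).toReal :=
    ENNReal.toReal_pos (lt_of_lt_of_le (by norm_num) (le_max_right q 2)).ne' hmt
  have hd' : (0 : ℝ) < d := by exact_mod_cast hd
  rcases le_or_gt d 2 with h2 | h2
  · have h2 : (d : ℝ) ≤ 2 := by exact_mod_cast h2
    have h3 := mul_pos hd' (inv_pos.2 hm0)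
    linarith
  · have h2' : (2 : ℝ) < d := by exact_mod_cast h2
    have h3 : 0 < (d : ℝ) - 2 := by linarith
    have h4 : (max q 2).toReal < 2 * d / (d - 2) := by
      rw [← ENNReal.lt_ofReal_iff_toReal_lt hmt, max_lt_iff]
      refine ⟨hq h2, ?_⟩
      rw [ENNReal.lt_ofReal_iff_toReal_lt (by norm_num), ENNReal.toReal_ofNat, lt_div_iff₀ h3]
      linarith
    rw [lt_div_iff₀ h3] at h4
    have h5 : (d : ℝ) - 2 < 2 * d * (max q 2).toReal⁻¹ := by
      rwa [← div_eq_mul_inv, lt_div_iff₀ hm0, mul_comm]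
    linarith

/-- **Corollary 15.35** (local geometric lemma for LARRF sets): for
`1 ≤ q < 2d/(d−2)` (any finite `q ≥ 1` if `d = 2`, and also `q = ∞` if `d = 1`),
`∫_{E ∩ B(x,r)} ∫₀^r β_q(y,t)² dt/t dH^d(y) ≤ C_q r^d`. -/
theorem cor_15_35 (n d : ℕ) (hd : 0 < d) (hdn : d < n) :
    ∃ ε₀ : ℝ, 0 < ε₀ ∧
    ∀ C₀ : ℝ, 1 ≤ C₀ →
    ∀ q : ℝ≥0∞, 1 ≤ q →
      (2 < d → q < ENNReal.ofReal (2 * d / ((d : ℝ) - 2))) →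
      (q = ⊤ → d = 1) →
    ∃ Cq : ℝ, 0 < Cq ∧
    ∀ ε : ℝ, 0 < ε → ε ≤ ε₀ →
    ∀ E : Set (V n), IsLARRF n d ε C₀ E →
    ∀ x ∈ E, ∀ r : ℝ, 0 < r → r ≤ 1 →
      (∫⁻ y in E ∩ ball x r,
          (∫⁻ t in Set.Ioc (0 : ℝ) r, betaE n d q E y t ^ 2 / ENNReal.ofReal t)
        ∂(μH[(d : ℝ)])) ≤ ENNReal.ofReal (Cq * r ^ d) := by
  obtain ⟨ε₀, hε₀, H⟩ := exists_lintegral_tailSum_le n d hd hdn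
  refine ⟨ε₀ / 2, half_pos hε₀, fun C₀ hC₀ q hq hqd hqt => ?_⟩
  obtain ⟨C, hC, H⟩ := H C₀ hC₀ q (max q 2) hq (le_max_left _ _) (le_max_right _ _)
    (scaleRatio_max_two_lt_one hd hqd hqt)
  refine ⟨C.toReal * 2 ^ d + 1, by positivity, fun ε hε hεε E hE x hx r hr hr1 => ?_⟩
  have hAD := hE.isADRegular
  obtain ⟨m, hm1, hm2⟩ := exists_nat_pow_near_of_lt_one hr hr1 (by norm_num : (0 : ℝ) < 1 / 2)
    (by norm_num)
  rw [← surf_restrict E measurableSet_ball]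
  calc _ ≤ ∫⁻ y in ball x r, tailSum (jonesFun n d q E) m y ∂(surf n d E) := by
        refine lintegral_mono_ae ?_
        filter_upwards [ae_restrict_of_ae hAD.ae_mem] with y hy
        exact lintegral_betaE_sq_le_tailSum hy hm2
    _ ≤ ∫⁻ y in ball x ((1 / 2) ^ m), tailSum (jonesFun n d q E) m y ∂(surf n d E) :=
        lintegral_mono_set (ball_subset_ball hm2)
    _ ≤ C * 2⁻¹ ^ (m * d) :=
        H (2 * ε) E (by positivity) (by linarith) (hE.isFlat hε) hAD x hx m
    _ = ENNReal.ofReal (C.toReal * ((1 / 2) ^ m) ^ d) := by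
        rw [ofReal_mul_half_pow_pow ENNReal.toReal_nonneg, ENNReal.ofReal_toReal hC]
    _ ≤ _ := by
        refine ENNReal.ofReal_le_ofReal ?_
        have h1 : (1 / 2 : ℝ) ^ m ≤ 2 * r := by rw [pow_succ] at hm1; linarith
        calc C.toReal * ((1 / 2) ^ m) ^ d ≤ C.toReal * (2 * r) ^ d := by gcongr
          _ = C.toReal * 2 ^ d * r ^ d := by rw [mul_pow, mul_assoc]
          _ ≤ _ := by gcongr; linarith
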